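/- arXiv:2507.13986 — 7 statements merged into one kernel-verified Lean document; each statement's English description precedes it below -/
import Mathlib

section
/- Let k > 0 and q > 0 with q ≠ 1, let D = {(ρ·cos φ, ρ·sin φ) : φ ∈ [−π,π], 0 ≤ ρ < 2 + cos 2φ} be the nonconvex region enclosed by the curve x(t) = (2+cos 2t)(cos t, sin t), and let t₀ = (i/2)·ln(2+√7). Let U : ℂ² → ℂ be entire and satisfy ∂²U/∂z₁² + ∂²U/∂z₂² + k²·U = 0 on all of ℂ². If U( (2+cos 2t₀)·cos t₀, (2+cos 2t₀)·sin t₀ ) ≠ 0, then the function λ ↦ ∫_D U(x₁,x₂)·exp(λ·x₁ + i·√(λ²+k²q)·x₂) dx is not identically zero on (0,∞). (Consequently, any finite linear combination of plane waves or any Herglotz wave that is nonvanishing at x(t₀) is scattered by D.) -/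
open Complex MeasureTheory

noncomputable section

/-- Partial derivative of `U` in the first variable. -/
def P1 (U : ℂ → ℂ → ℂ) : ℂ → ℂ → ℂ := fun z w => deriv (fun z' => U z' w) z

/-- Partial derivative of `U` in the second variable. -/
def P2 (U : ℂ → ℂ → ℂ) : ℂ → ℂ → ℂ := fun z w => deriv (fun w' => U z w') w

/-- The nonconvex region bounded by the curve `x(t) = (2 + cos 2t)(cos t, sin t)`. -/
def ncvD : Set (ℝ × ℝ) :=
  {p : ℝ × ℝ | ∃ φ ρ : ℝ, φ ∈ Set.Icc (-Real.pi) Real.pi ∧ 0 ≤ ρ ∧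
    ρ < 2 + Real.cos (2 * φ) ∧ p = (ρ * Real.cos φ, ρ * Real.sin φ)}

open Filter Topology Set in
/-- Laplace's method at an edge point `(σ, θ) = (1, 0)` for a phase of the form `σ * h θ`. -/
theorem tendsto_laplace_edge {h : ℝ → ℂ} (hh : Continuous h) {A : ℝ → ℝ × ℝ → ℂ}
    (hA : ∀ l, Continuous (A l)) {M g₀ c b : ℝ} (hM0 : 0 ≤ M)
    (hM : ∀ l, 1 ≤ l → ∀ σ ∈ Ioc (0 : ℝ) 1, ∀ θ ∈ Ioc (-Real.pi) Real.pi, ‖A l (σ, θ)‖ ≤ M)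
    (hre : ∀ θ ∈ Ioc (-Real.pi) Real.pi, (h θ).re ≤ g₀ - c * θ ^ 2) (hc : 0 < c)
    (hcg : c * Real.pi ^ 2 < g₀) {A₀ : ℂ}
    (hA₀ : ∀ u y : ℝ, Tendsto (fun l : ℝ => A l (1 - u / l, y / √l)) atTop (𝓝 A₀))
    (hlim : ∀ y : ℝ, Tendsto (fun l : ℝ => (l : ℂ) * (h (y / √l) - g₀)) atTop
      (𝓝 (-(b * y ^ 2 : ℝ)))) (hh0 : h 0 = g₀) :
    Tendsto (fun l : ℝ => ((l * √l * Real.exp (-(l * g₀)) : ℝ) : ℂ) *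
        ∫ σ in (0 : ℝ)..1, ∫ θ in (-Real.pi)..Real.pi, A l (σ, θ) * exp (l * σ * h θ)) atTop
      (𝓝 (A₀ * (((∫ u in Ici (0 : ℝ), Real.exp (-g₀ * u)) * ∫ y : ℝ, Real.exp (-b * y ^ 2) :
        ℝ) : ℂ))) := by
  have hpi := Real.pi_pos
  let G : ℝ → ℝ × ℝ → ℂ := fun l =>
    (Ioc (0 : ℝ) 1 ×ˢ Ioc (-Real.pi) Real.pi).indicator
      (fun p => A l p * exp (l * p.1 * h p.2))
  let F : ℝ → ℝ × ℝ → ℂ := fun l p =>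
    ((Real.exp (-(l * g₀)) : ℝ) : ℂ) * G l (1 - p.1 / l, p.2 / √l)
  let B : ℝ × ℝ → ℝ := fun p =>
    M * ((Ici (0 : ℝ)).indicator (fun u => Real.exp (-(g₀ - c * Real.pi ^ 2) * u)) p.1 *
      Real.exp (-c * p.2 ^ 2))
  have hGm : ∀ l, Measurable (G l) := by
    intro l
    refine Measurable.indicator ?_ (measurableSet_Ioc.prod measurableSet_Ioc)
    have := hA l
    exact Continuous.measurable (by fun_prop)
  have hFm : ∀ l, Measurable (F l) := by
    intro l
    have := hGm l
    exact Measurable.const_mul (this.comp (by fun_prop)) _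
  have hexpi : ∀ a : ℝ, 0 < a →
      Integrable ((Ici (0 : ℝ)).indicator (fun u => Real.exp (-a * u))) := by
    intro a ha
    rw [integrable_indicator_iff measurableSet_Ici]
    exact (integrableOn_Ici_iff_integrableOn_Ioi (by simp)).2 (exp_neg_integrableOn_Ioi 0 ha)
  have hB : Integrable B := by
    refine Integrable.const_mul ?_ M
    exact (hexpi _ (by linarith)).mul_prod (integrable_exp_neg_mul_sq hc)
  have hbound : ∀ l, 1 ≤ l → ∀ p, ‖F l p‖ ≤ B p := by
    rintro l hl ⟨u, y⟩
    have hl0 : 0 < l := by linarith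
    by_cases hp : (1 - u / l, y / √l) ∈ Ioc (0 : ℝ) 1 ×ˢ Ioc (-Real.pi) Real.pi
    · obtain ⟨⟨h1, h2⟩, h3⟩ := hp
      have hu : 0 ≤ u := by
        have : 0 ≤ u / l := by simpa using h2
        have := mul_nonneg this hl0.le
        rwa [div_mul_cancel₀ _ hl0.ne'] at this
      have hG : G l (1 - u / l, y / √l) = A l (1 - u / l, y / √l) *
          exp (l * ((1 - u / l : ℝ) : ℂ) * h (y / √l)) :=
        indicator_of_mem (show _ ∈ Ioc (0 : ℝ) 1 ×ˢ Ioc (-Real.pi) Real.pi from ⟨⟨h1, h2⟩, h3⟩) _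
      have hθ2 : (y / √l) ^ 2 ≤ Real.pi ^ 2 := sq_le_sq' h3.1.le h3.2
      have hly : l * (y / √l) ^ 2 = y ^ 2 := by
        rw [div_pow, Real.sq_sqrt hl0.le]; field_simp
      have hlu : l * (1 - u / l) = l - u := by field_simp
      have hlul : 0 ≤ l - u := by rw [← hlu]; positivity
      have hkey : -(l * g₀) + (l - u) * (h (y / √l)).re
          ≤ -(g₀ - c * Real.pi ^ 2) * u + -c * y ^ 2 := by
        have e1 := mul_le_mul_of_nonneg_left (hre _ h3) hlul
        have e2 := mul_le_mul_of_nonneg_left hθ2 (mul_nonneg hc.le hu)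
        nlinarith [hly]
      simp only [F, B, hG, indicator_of_mem (show u ∈ Ici (0 : ℝ) from hu)]
      rw [norm_mul, norm_mul, Complex.norm_exp, Complex.norm_real, Real.norm_eq_abs,
        Real.abs_exp, ← Complex.ofReal_mul, Complex.re_ofReal_mul, hlu, mul_left_comm,
        ← Real.exp_add, ← Real.exp_add]
      exact mul_le_mul (hM l hl _ ⟨h1, h2⟩ _ h3) (Real.exp_le_exp.2 hkey) (Real.exp_pos _).le hM0
    · have : G l (1 - u / l, y / √l) = 0 := indicator_of_notMem hp _
      simp only [F, this, mul_zero, norm_zero, B]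
      exact mul_nonneg hM0 (mul_nonneg (indicator_nonneg (fun _ _ => (Real.exp_pos _).le) _)
        (Real.exp_pos _).le)
  have hsqrt : ∀ y : ℝ, Tendsto (fun l : ℝ => y / √l) atTop (𝓝 0) := fun y =>
    Tendsto.div_atTop tendsto_const_nhds Real.tendsto_sqrt_atTop
  have hpt : ∀ p : ℝ × ℝ, Tendsto (fun l => F l p) atTop
      (𝓝 (A₀ * ((((Ici (0 : ℝ)).indicator (fun u => Real.exp (-g₀ * u)) p.1 *
        Real.exp (-b * p.2 ^ 2) : ℝ)) : ℂ))) := by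
    rintro ⟨u, y⟩
    by_cases hu : 0 ≤ u
    · have hev : ∀ᶠ l : ℝ in atTop, F l (u, y) = A l (1 - u / l, y / √l) *
          exp (l * (h (y / √l) - g₀) - u * h (y / √l)) := by
        have h1 : ∀ᶠ l : ℝ in atTop, y / √l ∈ Ioo (-Real.pi) Real.pi :=
          hsqrt y (Ioo_mem_nhds (by linarith) hpi)
        filter_upwards [h1, eventually_gt_atTop u] with l h1 h2
        have hl0 : 0 < l := by linarith
        have hmem : (1 - u / l, y / √l) ∈ Ioc (0 : ℝ) 1 ×ˢ Ioc (-Real.pi) Real.pi := by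
          refine ⟨⟨?_, ?_⟩, Ioo_subset_Ioc_self h1⟩
          · simpa using (div_lt_one hl0).2 h2
          · simpa using div_nonneg hu hl0.le
        have hG : G l (1 - u / l, y / √l) = A l (1 - u / l, y / √l) *
          exp (l * ((1 - u / l : ℝ) : ℂ) * h (y / √l)) := indicator_of_mem hmem _
        simp only [F, hG]
        rw [Complex.ofReal_exp, mul_left_comm, ← Complex.exp_add]
        have : (l : ℂ) ≠ 0 := by exact_mod_cast hl0.ne'
        congr 2
        push_cast
        field_simp
        ring
      refine Tendsto.congr' (EventuallyEq.symm hev) ?_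
      refine (hA₀ u y).mul ?_
      have h2 : Tendsto (fun l : ℝ => h (y / √l)) atTop (𝓝 (g₀ : ℂ)) := by
        rw [← hh0]; exact (hh.tendsto 0).comp (hsqrt y)
      have h3 := ((hlim y).sub (h2.const_mul (u : ℂ)))
      have h4 := (Complex.continuous_exp.tendsto _).comp h3
      refine (congrArg (fun z => Tendsto _ atTop (𝓝 z)) ?_).mp h4
      rw [indicator_of_mem (show u ∈ Ici (0 : ℝ) from hu), ← Real.exp_add, Complex.ofReal_exp]
      congr 1
      push_cast
      ring
    · have hev : ∀ᶠ l : ℝ in atTop, F l (u, y) = 0 := by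
        filter_upwards [eventually_gt_atTop 0] with l hl0
        have hmem : (1 - u / l, y / √l) ∉ Ioc (0 : ℝ) 1 ×ˢ Ioc (-Real.pi) Real.pi := by
          rintro ⟨⟨-, h2⟩, -⟩
          have : u / l < 0 := div_neg_of_neg_of_pos (not_le.1 hu) hl0
          simp only at h2
          linarith
        have hG : G l (1 - u / l, y / √l) = 0 := indicator_of_notMem hmem _
        simp only [F, hG, mul_zero]
      rw [indicator_of_notMem (show u ∉ Ici (0 : ℝ) from hu)]
      simpa using Tendsto.congr' (EventuallyEq.symm hev) tendsto_const_nhds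
  have hFi : ∀ l, 1 ≤ l → Integrable (F l) := fun l hl =>
    hB.mono' (hFm l).aestronglyMeasurable (ae_of_all _ (hbound l hl))
  have hT := tendsto_integral_filter_of_dominated_convergence (μ := volume) B
    (Eventually.of_forall fun l => (hFm l).aestronglyMeasurable)
    ((eventually_ge_atTop 1).mono fun l hl => ae_of_all _ (hbound l hl)) hB
    (ae_of_all _ hpt)
  rw [integral_const_mul, integral_complex_ofReal, Measure.volume_eq_prod,
    integral_prod_mul ((Ici (0 : ℝ)).indicator fun u => Real.exp (-g₀ * u))
      (fun y : ℝ => Real.exp (-b * y ^ 2)), integral_indicator measurableSet_Ici] at hT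
  refine Tendsto.congr' ?_ hT
  filter_upwards [eventually_ge_atTop 1] with l hl
  have hl0 : 0 < l := by linarith
  rw [integral_prod _ (hFi l hl)]
  have hinner : ∀ σ : ℝ, ∫ y : ℝ, G l (σ, y / √l) = √l • ∫ θ : ℝ, G l (σ, θ) := by
    intro σ
    rw [Measure.integral_comp_div (fun θ => G l (σ, θ)), abs_of_nonneg (Real.sqrt_nonneg l)]
  have houter : ∫ u : ℝ, ∫ θ : ℝ, G l (1 - u / l, θ) = l • ∫ σ : ℝ, ∫ θ : ℝ, G l (σ, θ) := by
    rw [Measure.integral_comp_div (fun v => ∫ θ : ℝ, G l (1 - v, θ)), abs_of_pos hl0,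
      integral_sub_left_eq_self (fun v => ∫ θ : ℝ, G l (v, θ)) volume 1]
  have hG : ∫ σ : ℝ, ∫ θ : ℝ, G l (σ, θ) = ∫ σ in (0 : ℝ)..1, ∫ θ in (-Real.pi)..Real.pi,
      A l (σ, θ) * exp (l * σ * h θ) := by
    rw [intervalIntegral.integral_of_le zero_le_one, ← integral_indicator measurableSet_Ioc]
    congr 1
    ext σ
    by_cases hσ : σ ∈ Ioc (0 : ℝ) 1
    · rw [indicator_of_mem hσ, intervalIntegral.integral_of_le (by linarith),
        ← integral_indicator measurableSet_Ioc]
      congr 1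
      ext θ
      simp only [G, indicator, mem_prod, hσ, true_and]
    · rw [indicator_of_notMem hσ]
      simp only [G, indicator, mem_prod, hσ, false_and, if_false, integral_zero]
  simp only [F, integral_const_mul, hinner, houter, hG, Complex.real_smul]
  push_cast
  ring

theorem mem_ncvD_polar {ρ φ : ℝ} (hρ : 0 < ρ) (hφ : φ ∈ Set.Icc (-Real.pi) Real.pi) :
    (ρ * Real.cos φ, ρ * Real.sin φ) ∈ ncvD ↔ ρ < 2 + Real.cos (2 * φ) := by
  refine ⟨?_, fun h => ⟨φ, ρ, hφ, hρ.le, h, rfl⟩⟩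
  rintro ⟨φ', ρ', -, hρ', h, hp⟩
  obtain ⟨h1, h2⟩ := Prod.ext_iff.1 hp
  simp only at h1 h2
  have hsq : ρ ^ 2 = ρ' ^ 2 := by
    linear_combination (ρ * Real.cos φ + ρ' * Real.cos φ') * h1 +
      (ρ * Real.sin φ + ρ' * Real.sin φ') * h2 - ρ ^ 2 * Real.sin_sq_add_cos_sq φ +
      ρ' ^ 2 * Real.sin_sq_add_cos_sq φ'
  have hρρ : ρ = ρ' := by
    rw [← Real.sqrt_sq hρ.le, hsq, Real.sqrt_sq hρ']
  subst hρρ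
  have hcos : Real.cos φ = Real.cos φ' := mul_left_cancel₀ hρ.ne' h1
  rwa [Real.cos_two_mul, hcos, ← Real.cos_two_mul]

theorem measurableSet_ncvD : MeasurableSet ncvD := by
  have : ncvD = {p : ℝ × ℝ | p = 0} ∪
      {p : ℝ × ℝ | √(p.1 ^ 2 + p.2 ^ 2) ^ 3 < 3 * p.1 ^ 2 + p.2 ^ 2} := by
    ext ⟨x, y⟩
    simp only [Set.mem_union, Set.mem_ofPred_eq]
    constructor
    · rintro ⟨φ, ρ, -, hρ, h, hp⟩
      obtain ⟨rfl, rfl⟩ := Prod.ext_iff.1 hp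
      rcases hρ.eq_or_lt with rfl | hρ
      · left; simp
      · right
        have h1 : (ρ * Real.cos φ) ^ 2 + (ρ * Real.sin φ) ^ 2 = ρ ^ 2 := by
          linear_combination ρ ^ 2 * Real.sin_sq_add_cos_sq φ
        simp only
        rw [h1, Real.sqrt_sq hρ.le]
        have h2 := mul_lt_mul_of_pos_left h (pow_pos hρ 2)
        rw [Real.cos_two_mul] at h2
        have h3 : 3 * (ρ * Real.cos φ) ^ 2 + (ρ * Real.sin φ) ^ 2 =
            ρ ^ 2 * (2 + (2 * Real.cos φ ^ 2 - 1)) := by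
          linear_combination ρ ^ 2 * Real.sin_sq_add_cos_sq φ
        rw [h3]
        linarith
    · rintro (hp | hp)
      · rw [hp]
        exact ⟨0, 0, ⟨by linarith [Real.pi_pos], Real.pi_pos.le⟩, le_rfl, by norm_num,
          by simp [Prod.ext_iff]⟩
      · set z : ℂ := ⟨x, y⟩ with hz
        have hx : x = ‖z‖ * Real.cos z.arg := (Complex.norm_mul_cos_arg z).symm
        have hy : y = ‖z‖ * Real.sin z.arg := (Complex.norm_mul_sin_arg z).symm
        have hn : √(x ^ 2 + y ^ 2) = ‖z‖ := by
          rw [Complex.norm_eq_sqrt_sq_add_sq]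
        rw [hn] at hp
        have hz0 : 0 < ‖z‖ := by
          refine (norm_nonneg z).lt_of_ne fun h => ?_
          rw [← h, zero_mul] at hx hy
          rw [← h, hx, hy] at hp
          norm_num at hp
        refine ⟨z.arg, ‖z‖, ⟨(Complex.neg_pi_lt_arg z).le, Complex.arg_le_pi z⟩, hz0.le, ?_,
          Prod.ext hx hy⟩
        have h3 : 3 * x ^ 2 + y ^ 2 = ‖z‖ ^ 2 * (2 + Real.cos (2 * z.arg)) := by
          rw [Real.cos_two_mul, hx, hy]
          linear_combination ‖z‖ ^ 2 * Real.sin_sq_add_cos_sq z.arg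
        rw [h3, pow_succ] at hp
        exact lt_of_mul_lt_mul_left hp (by positivity)
  rw [this]
  exact (measurableSet_eq).union (measurableSet_lt (by fun_prop) (by fun_prop))

theorem setIntegral_ncvD {f : ℝ × ℝ → ℂ} (hf : Continuous f) :
    ∫ p in ncvD, f p = ∫ φ in (-Real.pi)..Real.pi, ∫ σ in (0 : ℝ)..1,
      (((2 + Real.cos (2 * φ)) ^ 2 * σ : ℝ) : ℂ) *
        f (σ * ((2 + Real.cos (2 * φ)) * Real.cos φ),
          σ * ((2 + Real.cos (2 * φ)) * Real.sin φ)) := by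
  have hpi := Real.pi_pos
  let T : Set (ℝ × ℝ) := {p | (0 < p.1 ∧ p.1 < 2 + Real.cos (2 * p.2)) ∧
    p.2 ∈ Set.Ioc (-Real.pi) Real.pi}
  let f' : ℝ × ℝ → ℂ := fun p => (p.1 : ℂ) * f (p.1 * Real.cos p.2, p.1 * Real.sin p.2)
  have hf' : Continuous f' := by fun_prop
  have hT : MeasurableSet T :=
    ((measurableSet_lt measurable_const measurable_fst).inter
      (measurableSet_lt measurable_fst
        (by fun_prop : Measurable fun p : ℝ × ℝ => 2 + Real.cos (2 * p.2)))).inter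
      (measurable_snd measurableSet_Ioc)
  have hTi : Integrable (T.indicator f') := by
    rw [integrable_indicator_iff hT]
    refine (hf'.continuousOn.integrableOn_compact
      (isCompact_Icc.prod isCompact_Icc : IsCompact (Set.Icc (0 : ℝ) 3 ×ˢ
        Set.Icc (-Real.pi) Real.pi))).mono_set ?_
    rintro ⟨ρ, φ⟩ ⟨⟨h1, h2⟩, h3⟩
    exact ⟨⟨h1.le, by linarith [Real.cos_le_one (2 * φ)]⟩, h3.1.le, h3.2⟩
  have hpolar : ∫ p in ncvD, f p = ∫ p, T.indicator f' p := by
    rw [← integral_indicator measurableSet_ncvD, ← integral_comp_polarCoord_symm,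
      ← integral_indicator polarCoord.open_target.measurableSet]
    refine integral_congr_ae ?_
    have hne : ∀ᵐ p : ℝ × ℝ, p.2 ≠ Real.pi := by
      have : ∀ᵐ y : ℝ, y ≠ Real.pi := by simp [ae_iff]
      exact Measure.quasiMeasurePreserving_snd.ae this
    filter_upwards [hne] with ⟨ρ, φ⟩ hne
    by_cases hm : (ρ, φ) ∈ polarCoord.target
    · rw [Set.indicator_of_mem hm]
      obtain ⟨h1, h2⟩ := hm
      have h1 : 0 < ρ := h1
      have h2 : φ ∈ Set.Ioo (-Real.pi) Real.pi := h2
      have hiff := mem_ncvD_polar h1 (Set.Ioo_subset_Icc_self h2)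
      have hs : polarCoord.symm (ρ, φ) = (ρ * Real.cos φ, ρ * Real.sin φ) := rfl
      rw [hs]
      by_cases hr : ρ < 2 + Real.cos (2 * φ)
      · rw [Set.indicator_of_mem (hiff.2 hr),
          Set.indicator_of_mem (show (ρ, φ) ∈ T from ⟨⟨h1, hr⟩, h2.1, h2.2.le⟩)]
        simp [f']
      · rw [Set.indicator_of_notMem (fun h => hr (hiff.1 h)),
          Set.indicator_of_notMem (fun h : (ρ, φ) ∈ T => hr h.1.2), smul_zero]
    · rw [Set.indicator_of_notMem hm, Set.indicator_of_notMem]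
      rintro ⟨⟨h1, -⟩, h2⟩
      exact hm ⟨h1, h2.1, lt_of_le_of_ne h2.2 hne⟩
  rw [hpolar, Measure.volume_eq_prod, integral_prod_symm _ hTi,
    intervalIntegral.integral_of_le (by linarith), ← integral_indicator measurableSet_Ioc]
  congr 1
  ext φ
  by_cases hφ : φ ∈ Set.Ioc (-Real.pi) Real.pi
  · rw [Set.indicator_of_mem hφ]
    set R : ℝ := 2 + Real.cos (2 * φ) with hR
    have hR0 : 0 < R := by linarith [Real.neg_one_le_cos (2 * φ)]
    have h1 : ∀ ρ, T.indicator f' (ρ, φ) = (Set.Ioo 0 R).indicator (fun ρ => f' (ρ, φ)) ρ := by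
      intro ρ
      simp only [T, Set.indicator, Set.mem_ofPred_eq, hφ, and_true, Set.mem_Ioo, hR]
    simp only [h1]
    rw [integral_indicator measurableSet_Ioo, ← integral_Ioc_eq_integral_Ioo,
      ← intervalIntegral.integral_of_le hR0.le]
    have h2 := intervalIntegral.integral_comp_mul_right (a := 0) (b := 1)
      (fun ρ => f' (ρ, φ)) hR0.ne'
    rw [zero_mul, one_mul, eq_inv_smul_iff₀ hR0.ne', ← intervalIntegral.integral_smul] at h2
    rw [← h2]
    congr 1
    ext σ
    simp only [f', Complex.real_smul]
    rw [mul_assoc σ, mul_assoc σ]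
    push_cast
    ring
  · rw [Set.indicator_of_notMem hφ]
    have : ∀ ρ, T.indicator f' (ρ, φ) = 0 := fun ρ =>
      Set.indicator_of_notMem (fun h : (ρ, φ) ∈ T => hφ h.2) _
    simp [this]

/-- The integral of an entire `2π`-periodic function over a period is invariant under
translations of the contour in the imaginary direction. -/
theorem integral_periodic_shift {f : ℂ → ℂ} (hf : Differentiable ℂ f)
    (hp : ∀ t, f (t + 2 * Real.pi) = f t) (τ : ℝ) :
    ∫ x in (-Real.pi)..Real.pi, f x = ∫ x in (-Real.pi)..Real.pi, f (x + τ * I) := by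
  have h := Complex.integral_boundary_rect_eq_zero_of_differentiableOn f (-Real.pi : ℝ)
    (Real.pi + τ * I) hf.differentiableOn
  simp only [Complex.ofReal_re, Complex.ofReal_im, Complex.add_re, Complex.add_im,
    Complex.mul_re, Complex.mul_im, Complex.I_re, Complex.I_im, mul_zero, mul_one, sub_zero,
    zero_add, add_zero, Complex.ofReal_zero, zero_mul] at h
  have hside : ∀ y : ℝ, f ((Real.pi : ℝ) + y * I) = f ((-Real.pi : ℝ) + y * I) := by
    intro y
    rw [← hp ((-Real.pi : ℝ) + y * I)]
    congr 1
    push_cast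
    ring
  simp only [hside] at h
  linear_combination h

/-- The first coordinate of the complexified boundary curve of `ncvD`. -/
def ncvX (t : ℂ) : ℂ := (2 + cos (2 * t)) * cos t

/-- The second coordinate of the complexified boundary curve of `ncvD`. -/
def ncvY (t : ℂ) : ℂ := (2 + cos (2 * t)) * sin t

theorem differentiable_ncvX : Differentiable ℂ ncvX := by
  unfold ncvX; fun_prop

theorem differentiable_ncvY : Differentiable ℂ ncvY := by
  unfold ncvY; fun_prop

@[fun_prop]
theorem continuous_ncvX : Continuous ncvX := differentiable_ncvX.continuous

@[fun_prop]
theorem continuous_ncvY : Continuous ncvY := differentiable_ncvY.continuous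

theorem cos_two_mul_add_two_pi (t : ℂ) : cos (2 * (t + 2 * Real.pi)) = cos (2 * t) := by
  rw [cos_two_mul, cos_add_two_pi, ← cos_two_mul]

theorem ncvX_add_two_pi (t : ℂ) : ncvX (t + 2 * Real.pi) = ncvX t := by
  rw [ncvX, ncvX, cos_two_mul_add_two_pi, cos_add_two_pi]

theorem ncvY_add_two_pi (t : ℂ) : ncvY (t + 2 * Real.pi) = ncvY t := by
  rw [ncvY, ncvY, cos_two_mul_add_two_pi, sin_add_two_pi]

/-- The phase `x₁ + i x₂` along the shifted contour through the saddle point. -/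
theorem ncv_phase_eq {τ r : ℝ} (hτ : Real.exp (-τ) = r) (hr : 3 * r ^ 4 + 4 * r ^ 2 = 1) (θ : ℝ) :
    ncvX (θ + τ * I) + I * ncvY (θ + τ * I) = (4 * r + 2 * r ^ 3 : ℝ) -
      ((r * (1 - Real.cos θ) : ℝ) : ℂ) *
        (r ^ 2 * exp (θ * I) ^ 2 + 2 * r ^ 2 * exp (θ * I) + (3 * r ^ 2 + 4)) := by
  set e : ℂ := exp (θ * I) with he
  set E : ℂ := exp (-(θ * I)) with hE
  have heE : e * E = 1 := by rw [he, hE, ← Complex.exp_add]; simp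
  have hr0 : r ≠ 0 := by rw [← hτ]; exact (Real.exp_pos _).ne'
  have hrC : (3 * r ^ 4 + 4 * r ^ 2 : ℂ) = 1 := by exact_mod_cast hr
  have hτ' : exp (-(τ : ℂ)) = r := by rw [← hτ]; push_cast; rfl
  have hτ2 : exp (τ : ℂ) = 3 * r ^ 3 + 4 * r := by
    have h1 : exp (τ : ℂ) * r = 1 := by rw [← hτ', ← Complex.exp_add]; simp
    have hr0' : (r : ℂ) ≠ 0 := by exact_mod_cast hr0
    apply mul_right_cancel₀ hr0'
    rw [h1]
    linear_combination -hrC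
  have hw : exp ((θ + τ * I) * I) = r * e := by
    rw [← hτ', he, ← Complex.exp_add]
    congr 1
    linear_combination (τ : ℂ) * Complex.I_mul_I
  have hW : exp (-(θ + τ * I) * I) = (3 * r ^ 3 + 4 * r) * E := by
    rw [← hτ2, hE, ← Complex.exp_add]
    congr 1
    linear_combination -(τ : ℂ) * Complex.I_mul_I
  have hcos : cos (2 * (θ + τ * I)) = ((r * e) ^ 2 + ((3 * r ^ 3 + 4 * r) * E) ^ 2) / 2 := by
    rw [Complex.cos, ← hw, ← hW, ← Complex.exp_nat_mul, ← Complex.exp_nat_mul]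
    congr 3 <;> push_cast <;> ring
  have hcosθ : (Real.cos θ : ℂ) = (e + E) / 2 := by
    rw [Complex.ofReal_cos, Complex.cos, he, hE, neg_mul]
  have hlhs : ncvX (θ + τ * I) + I * ncvY (θ + τ * I) =
      (2 + cos (2 * (θ + τ * I))) * exp ((θ + τ * I) * I) := by
    rw [Complex.exp_mul_I, ncvX, ncvY]
    ring
  have hwW : (r * e) * ((3 * r ^ 3 + 4 * r) * E) = 1 := by
    linear_combination (3 * r ^ 4 + 4 * r ^ 2) * heE + hrC
  have hlhs' : (2 + ((r * e) ^ 2 + ((3 * r ^ 3 + 4 * r) * E) ^ 2) / 2) * (r * e) =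
      2 * (r * e) + ((r * e) ^ 3 + (3 * r ^ 3 + 4 * r) * E) / 2 := by
    linear_combination ((3 * r ^ 3 + 4 * r) * E / 2) * hwW
  rw [hlhs, hcos, hw, hlhs']
  push_cast
  rw [← Complex.ofReal_cos, hcosθ]
  linear_combination (-(r : ℂ) ^ 3 * e / 2 - r ^ 3) * heE

theorem ncv_phase_re_le {τ r : ℝ} (hτ : Real.exp (-τ) = r) (hr : 3 * r ^ 4 + 4 * r ^ 2 = 1)
    {θ : ℝ} (hθ : |θ| ≤ Real.pi) :
    (ncvX (θ + τ * I) + I * ncvY (θ + τ * I)).re ≤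
      4 * r + 2 * r ^ 3 - r / Real.pi ^ 2 * θ ^ 2 := by
  have hr0 : 0 < r := by rw [← hτ]; exact Real.exp_pos _
  rw [ncv_phase_eq hτ hr, Complex.sub_re, Complex.ofReal_re, Complex.re_ofReal_mul,
    ← Complex.exp_nat_mul]
  have h1 : (r ^ 2 * exp ((2 : ℕ) * (θ * I)) + 2 * r ^ 2 * exp (θ * I) + (3 * r ^ 2 + 4) : ℂ).re =
      r ^ 2 * Real.cos (2 * θ) + 2 * r ^ 2 * Real.cos θ + (3 * r ^ 2 + 4) := by
    have e1 : ((2 : ℕ) * (θ * I) : ℂ) = ((2 * θ : ℝ) : ℂ) * I := by push_cast; ring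
    have e2 : (r ^ 2 : ℂ) = ((r ^ 2 : ℝ) : ℂ) := by push_cast; ring
    have e3 : (2 * ((r ^ 2 : ℝ) : ℂ)) = ((2 * r ^ 2 : ℝ) : ℂ) := by push_cast; ring
    have e4 : (3 * ((r ^ 2 : ℝ) : ℂ) + 4) = ((3 * r ^ 2 + 4 : ℝ) : ℂ) := by push_cast; ring
    rw [e1, e2, e3, e4, Complex.add_re, Complex.add_re, Complex.re_ofReal_mul,
      Complex.re_ofReal_mul, Complex.exp_ofReal_mul_I_re, Complex.exp_ofReal_mul_I_re,
      Complex.ofReal_re]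
  rw [h1]
  have h2 := Real.cos_le_one_sub_mul_cos_sq hθ
  have h3 : 1 ≤ r ^ 2 * Real.cos (2 * θ) + 2 * r ^ 2 * Real.cos θ + (3 * r ^ 2 + 4) := by
    nlinarith [Real.neg_one_le_cos (2 * θ), Real.neg_one_le_cos θ, sq_nonneg r]
  have h4 : 1 / Real.pi ^ 2 * θ ^ 2 ≤ 1 - Real.cos θ := by
    have : 0 ≤ 1 / Real.pi ^ 2 * θ ^ 2 := by positivity
    have e : 2 / Real.pi ^ 2 * θ ^ 2 = 2 * (1 / Real.pi ^ 2 * θ ^ 2) := by ring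
    linarith
  have h5 : 0 ≤ r * (1 - Real.cos θ) := mul_nonneg hr0.le (by linarith [Real.cos_le_one θ])
  have h6 := mul_le_mul_of_nonneg_left h3 h5
  have h7 := mul_le_mul_of_nonneg_left h4 hr0.le
  have h8 : r / Real.pi ^ 2 * θ ^ 2 = r * (1 / Real.pi ^ 2 * θ ^ 2) := by ring
  rw [h8]
  linarith

open Filter Topology in
theorem tendsto_mul_one_sub_cos_div_sqrt (y : ℝ) :
    Tendsto (fun l : ℝ => l * (1 - Real.cos (y / √l))) atTop (𝓝 (y ^ 2 / 2)) := by
  have h0 : Tendsto (fun l : ℝ => y / √l / 2) atTop (𝓝 0) := by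
    simpa using (Tendsto.div_atTop (tendsto_const_nhds (x := y))
      Real.tendsto_sqrt_atTop).div_const 2
  have h1 : Tendsto (fun l : ℝ => y ^ 2 / 2 * Real.sinc (y / √l / 2) ^ 2) atTop
      (𝓝 (y ^ 2 / 2)) := by
    have := (((Real.continuous_sinc.tendsto 0).comp h0).pow 2).const_mul (y ^ 2 / 2)
    simpa using this
  refine h1.congr' ?_
  filter_upwards [eventually_gt_atTop 0] with l hl
  rcases eq_or_ne y 0 with rfl | hy
  · simp
  have hs : 0 < √l := Real.sqrt_pos.2 hl
  have hx : y / √l / 2 ≠ 0 := by positivity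
  have hcos : Real.cos (y / √l) = 1 - 2 * Real.sin (y / √l / 2) ^ 2 := by
    conv_lhs => rw [show y / √l = 2 * (y / √l / 2) by ring]
    rw [Real.cos_two_mul]
    linarith [Real.sin_sq_add_cos_sq (y / √l / 2)]
  rw [hcos, Real.sinc_of_ne_zero hx]
  generalize Real.sin (y / √l / 2) = S
  field_simp
  rw [Real.sq_sqrt hl.le]
  ring

open Filter Topology in
theorem tendsto_ncv_phase {τ r : ℝ} (hτ : Real.exp (-τ) = r) (hr : 3 * r ^ 4 + 4 * r ^ 2 = 1)
    (y : ℝ) :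
    Tendsto (fun l : ℝ => (l : ℂ) * (ncvX ((y / √l : ℝ) + τ * I) +
      I * ncvY ((y / √l : ℝ) + τ * I) - (4 * r + 2 * r ^ 3 : ℝ))) atTop
      (𝓝 (-(r * (3 * r ^ 2 + 2) * y ^ 2 : ℝ))) := by
  have h0 : Tendsto (fun l : ℝ => y / √l) atTop (𝓝 0) :=
    Tendsto.div_atTop tendsto_const_nhds Real.tendsto_sqrt_atTop
  have h1 : Tendsto (fun l : ℝ => ((l * (1 - Real.cos (y / √l)) : ℝ) : ℂ)) atTop
      (𝓝 ((y ^ 2 / 2 : ℝ) : ℂ)) :=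
    (Complex.continuous_ofReal.tendsto _).comp (tendsto_mul_one_sub_cos_div_sqrt y)
  have hc : Continuous fun x : ℝ =>
      (r ^ 2 * exp (x * I) ^ 2 + 2 * r ^ 2 * exp (x * I) + (3 * r ^ 2 + 4) : ℂ) := by fun_prop
  have h2 := ((h1.mul ((hc.tendsto 0).comp h0)).const_mul (r : ℂ)).neg
  refine Tendsto.congr (fun l => ?_) ((congrArg (fun z => Tendsto _ atTop (𝓝 z)) ?_).mp h2)
  · rw [ncv_phase_eq hτ hr]
    simp only [Function.comp_apply]
    push_cast
    ring
  · simp only [Complex.ofReal_zero, zero_mul, Complex.exp_zero]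
    push_cast
    ring

/-- Passage from the integral over `ncvD` to an integral over the shifted contour. -/
theorem setIntegral_ncvD_eq_shift {U : ℂ → ℂ → ℂ}
    (hU : Differentiable ℂ (fun p : ℂ × ℂ => U p.1 p.2)) (l s τ : ℝ) :
    ∫ p in ncvD, U (p.1 : ℂ) (p.2 : ℂ) * exp ((l : ℂ) * (p.1 : ℂ) + I * (s : ℂ) * (p.2 : ℂ)) =
      ∫ σ in (0 : ℝ)..1, ∫ θ in (-Real.pi)..Real.pi,
        ((σ : ℂ) * (2 + cos (2 * (θ + τ * I))) ^ 2 *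
          U (σ * ncvX (θ + τ * I)) (σ * ncvY (θ + τ * I)) *
            exp (I * (s - l : ℝ) * (σ * ncvY (θ + τ * I)))) *
          exp (l * σ * (ncvX (θ + τ * I) + I * ncvY (θ + τ * I))) := by
  let N : ℝ → ℂ → ℂ := fun σ t => (σ : ℂ) * (2 + cos (2 * t)) ^ 2 *
    U (σ * ncvX t) (σ * ncvY t) * exp (l * (σ * ncvX t) + I * s * (σ * ncvY t))
  have hUc := hU.continuous
  have hN : ∀ σ, Differentiable ℂ (N σ) := by
    intro σ
    have h1 := differentiable_ncvX
    have h2 := differentiable_ncvY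
    have h3 : Differentiable ℂ fun t => U (σ * ncvX t) (σ * ncvY t) :=
      hU.comp (f := fun t => ((σ : ℂ) * ncvX t, (σ : ℂ) * ncvY t)) (by fun_prop)
    fun_prop
  have hNp : ∀ σ t, N σ (t + 2 * Real.pi) = N σ t := by
    intro σ t
    simp only [N, ncvX_add_two_pi, ncvY_add_two_pi, cos_two_mul_add_two_pi]
  have hNc : Continuous fun p : ℝ × ℝ => N p.2 p.1 := by
    have h3 : Continuous fun p : ℝ × ℝ => U (p.2 * ncvX p.1) (p.2 * ncvY p.1) :=
      hUc.comp (f := fun p : ℝ × ℝ => ((p.2 : ℂ) * ncvX p.1, (p.2 : ℂ) * ncvY p.1)) (by fun_prop)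
    fun_prop
  have hfc : Continuous fun p : ℝ × ℝ => U (p.1 : ℂ) (p.2 : ℂ) *
      exp ((l : ℂ) * (p.1 : ℂ) + I * (s : ℂ) * (p.2 : ℂ)) := by
    have h3 : Continuous fun p : ℝ × ℝ => U (p.1 : ℂ) (p.2 : ℂ) :=
      hUc.comp (f := fun p : ℝ × ℝ => ((p.1 : ℂ), (p.2 : ℂ))) (by fun_prop)
    fun_prop
  have hswap : ∫ φ in (-Real.pi)..Real.pi, ∫ σ in (0 : ℝ)..1, N σ φ =
      ∫ σ in (0 : ℝ)..1, ∫ φ in (-Real.pi)..Real.pi, N σ φ := by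
    refine intervalIntegral_intervalIntegral_swap ?_
    exact (hNc.continuousOn.integrableOn_compact
      (isCompact_uIcc.prod isCompact_uIcc)).mono_set
      (Set.prod_mono Set.uIoc_subset_uIcc Set.uIoc_subset_uIcc)
  rw [setIntegral_ncvD hfc]
  trans ∫ φ in (-Real.pi)..Real.pi, ∫ σ in (0 : ℝ)..1, N σ φ
  · congr 1
    ext φ
    congr 1
    ext σ
    simp only [N, ncvX, ncvY]
    push_cast
    ring
  · rw [hswap]
    congr 1
    ext σ
    rw [integral_periodic_shift (hN σ) (hNp σ) τ]
    congr 1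
    ext θ
    simp only [N]
    rw [mul_assoc _ (exp _) (exp _), ← Complex.exp_add]
    congr 2
    push_cast
    ring

open Filter Topology in
theorem tendsto_sqrt_sq_add_sub {K : ℝ} (hK : 0 ≤ K) :
    Tendsto (fun l : ℝ => √(l ^ 2 + K) - l) atTop (𝓝 0) := by
  have h0 : Tendsto (fun l : ℝ => K / l) atTop (𝓝 0) :=
    Tendsto.div_atTop tendsto_const_nhds tendsto_id
  refine tendsto_of_tendsto_of_tendsto_of_le_of_le' tendsto_const_nhds h0 ?_ ?_
  · filter_upwards [eventually_gt_atTop 0] with l hl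
    linarith [Real.le_sqrt_of_sq_le (show l ^ 2 ≤ l ^ 2 + K by linarith)]
  · filter_upwards [eventually_gt_atTop 0] with l hl
    have h1 : √(l ^ 2 + K) ≤ l + K / l := by
      refine Real.sqrt_le_iff.2 ⟨by positivity, ?_⟩
      have : (l + K / l) ^ 2 = l ^ 2 + 2 * K + (K / l) ^ 2 := by field_simp; ring
      rw [this]
      nlinarith [sq_nonneg (K / l)]
    linarith

open Filter Topology Set in
/-- Leading-order behaviour of the integral over `ncvD` is nonzero when `U` does not vanish at the
complex critical point of the boundary curve. -/
theorem exists_setIntegral_ncvD_ne_zero {U : ℂ → ℂ → ℂ}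
    (hU : Differentiable ℂ (fun p : ℂ × ℂ => U p.1 p.2)) {K τ r : ℝ} (hK : 0 ≤ K)
    (hτ : Real.exp (-τ) = r) (hr : 3 * r ^ 4 + 4 * r ^ 2 = 1)
    (hnv : U (ncvX (τ * I)) (ncvY (τ * I)) ≠ 0) :
    ∃ l : ℝ, 0 < l ∧ ∫ p in ncvD, U (p.1 : ℂ) (p.2 : ℂ) *
      exp ((l : ℂ) * (p.1 : ℂ) + I * ((√(l ^ 2 + K) : ℝ) : ℂ) * (p.2 : ℂ)) ≠ 0 := by
  by_contra! hzero
  have hpi := Real.pi_pos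
  have hr0 : 0 < r := by rw [← hτ]; exact Real.exp_pos _
  let Φ : ℝ × ℝ × ℝ → ℂ := fun p =>
    (p.2.1 : ℂ) * (2 + cos (2 * (p.2.2 + τ * I))) ^ 2 *
      U (p.2.1 * ncvX (p.2.2 + τ * I)) (p.2.1 * ncvY (p.2.2 + τ * I)) *
        exp (I * p.1 * (p.2.1 * ncvY (p.2.2 + τ * I)))
  have hΦ : Continuous Φ := by
    have h3 : Continuous fun p : ℝ × ℝ × ℝ =>
        U (p.2.1 * ncvX (p.2.2 + τ * I)) (p.2.1 * ncvY (p.2.2 + τ * I)) :=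
      hU.continuous.comp (f := fun p : ℝ × ℝ × ℝ =>
        ((p.2.1 : ℂ) * ncvX (p.2.2 + τ * I), (p.2.1 : ℂ) * ncvY (p.2.2 + τ * I))) (by fun_prop)
    exact Continuous.mul (Continuous.mul (by fun_prop) h3) (by fun_prop)
  obtain ⟨M, hM⟩ := (isCompact_Icc.prod (isCompact_Icc.prod isCompact_Icc) :
    IsCompact (Icc (0 : ℝ) K ×ˢ Icc (0 : ℝ) 1 ×ˢ
      Icc (-Real.pi) Real.pi)).exists_bound_of_continuousOn
    hΦ.continuousOn
  have hM0 : 0 ≤ M := (norm_nonneg _).trans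
    (hM (0, 0, 0) ⟨⟨le_rfl, hK⟩, ⟨le_rfl, zero_le_one⟩, by linarith, hpi.le⟩)
  have hδ : ∀ l : ℝ, 1 ≤ l → √(l ^ 2 + K) - l ∈ Icc 0 K := by
    intro l hl
    have h1 := Real.le_sqrt_of_sq_le (show l ^ 2 ≤ l ^ 2 + K by linarith)
    have h2 : √(l ^ 2 + K) ≤ l + K := Real.sqrt_le_iff.2 ⟨by linarith, by nlinarith⟩
    exact ⟨by linarith, by linarith⟩
  have hlap := tendsto_laplace_edge
    (h := fun θ : ℝ => ncvX (θ + τ * I) + I * ncvY (θ + τ * I))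
    (A := fun l p => Φ (√(l ^ 2 + K) - l, p.1, p.2)) (by fun_prop)
    (fun l => hΦ.comp (by fun_prop)) (M := M) (g₀ := 4 * r + 2 * r ^ 3)
    (c := r / Real.pi ^ 2) (b := r * (3 * r ^ 2 + 2)) (A₀ := Φ (0, 1, 0)) hM0
    (fun l hl σ hσ θ hθ => hM _ ⟨hδ l hl, Ioc_subset_Icc_self hσ, Ioc_subset_Icc_self hθ⟩)
    (fun θ hθ => ncv_phase_re_le hτ hr (abs_le.2 ⟨hθ.1.le, hθ.2⟩)) (by positivity)
    (by rw [div_mul_cancel₀ _ (by positivity)]; nlinarith [pow_pos hr0 3])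
    (fun u y => by
      have h1 : Tendsto (fun l : ℝ => 1 - u / l) atTop (𝓝 1) := by
        simpa using (Tendsto.div_atTop (tendsto_const_nhds (x := u)) tendsto_id).const_sub 1
      have h2 : Tendsto (fun l : ℝ => y / √l) atTop (𝓝 0) :=
        Tendsto.div_atTop tendsto_const_nhds Real.tendsto_sqrt_atTop
      exact (hΦ.tendsto (0, 1, 0)).comp
        ((tendsto_sqrt_sq_add_sub hK).prodMk_nhds (h1.prodMk_nhds h2)))
    (fun y => tendsto_ncv_phase hτ hr y) (by rw [ncv_phase_eq hτ hr]; simp)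
  have hlim0 := tendsto_nhds_unique_of_eventuallyEq hlap (tendsto_const_nhds (x := (0 : ℂ))) (by
    filter_upwards [eventually_gt_atTop 0] with l hl
    have h := hzero l hl
    rw [setIntegral_ncvD_eq_shift hU l _ τ] at h
    rw [mul_eq_zero]
    exact Or.inr h)
  have hΦ0 : Φ (0, 1, 0) ≠ 0 := by
    have hcos : (2 + cos (2 * (τ * I)) : ℂ) ≠ 0 := by
      have : (2 + cos (2 * (τ * I)) : ℂ) = ((2 + Real.cosh (2 * τ) : ℝ) : ℂ) := by
        rw [← mul_assoc, Complex.cos_mul_I]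
        push_cast
        rfl
      rw [this]
      exact_mod_cast (by linarith [Real.cosh_pos (2 * τ)] : 0 < 2 + Real.cosh (2 * τ)).ne'
    simpa [Φ, hcos] using hnv
  refine mul_ne_zero hΦ0 ?_ hlim0
  rw [integral_Ici_eq_integral_Ioi, integral_exp_mul_Ioi (by nlinarith [pow_pos hr0 3]),
    integral_gaussian]
  have h1 : 0 < 4 * r + 2 * r ^ 3 := by positivity
  have h2 : 0 < √(Real.pi / (r * (3 * r ^ 2 + 2))) := Real.sqrt_pos.2 (by positivity)
  rw [mul_zero, Real.exp_zero, neg_div_neg_eq]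
  exact_mod_cast (mul_pos (one_div_pos.2 h1) h2).ne'

theorem stmt6
    (k q : ℝ) (hk : 0 < k) (hq : 0 < q) (hq1 : q ≠ 1)
    (t₀ : ℂ) (ht₀ : t₀ = (Complex.I / 2) * ((Real.log (2 + Real.sqrt 7) : ℝ) : ℂ))
    (U : ℂ → ℂ → ℂ)
    (hUan : ∀ p : ℂ × ℂ, AnalyticAt ℂ (fun p : ℂ × ℂ => U p.1 p.2) p)
    (hHelm : ∀ z w : ℂ, P1 (P1 U) z w + P2 (P2 U) z w + (k : ℂ) ^ 2 * U z w = 0)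
    (hnv : U (((2 : ℂ) + Complex.cos (2 * t₀)) * Complex.cos t₀)
      (((2 : ℂ) + Complex.cos (2 * t₀)) * Complex.sin t₀) ≠ 0) :
    ¬ (∀ lam : ℝ, 0 < lam →
      (∫ p in ncvD,
        U (p.1 : ℂ) (p.2 : ℂ) *
          Complex.exp ((lam : ℂ) * (p.1 : ℂ)
            + Complex.I * ((Real.sqrt (lam ^ 2 + k ^ 2 * q) : ℝ) : ℂ) * (p.2 : ℂ))) = 0) := by
  intro hzero
  have h7 : √(7 : ℝ) ^ 2 = 7 := Real.sq_sqrt (by norm_num)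
  have hs : 0 < 2 + √(7 : ℝ) := by positivity
  set τ : ℝ := Real.log (2 + √7) / 2 with hτ
  have ht : t₀ = τ * I := by
    rw [ht₀, hτ]
    push_cast
    ring
  have hsq : Real.exp (-τ) ^ 2 = (2 + √7)⁻¹ := by
    rw [← Real.exp_nat_mul, hτ, show ((2 : ℕ) : ℝ) * -(Real.log (2 + √7) / 2) =
      -Real.log (2 + √7) by push_cast; ring, Real.exp_neg, Real.exp_log hs]
  have hr : 3 * Real.exp (-τ) ^ 4 + 4 * Real.exp (-τ) ^ 2 = 1 := by
    rw [show Real.exp (-τ) ^ 4 = (Real.exp (-τ) ^ 2) ^ 2 by ring, hsq]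
    field_simp
    linear_combination -h7
  have hU : Differentiable ℂ (fun p : ℂ × ℂ => U p.1 p.2) := fun p => (hUan p).differentiableAt
  rw [ht] at hnv
  obtain ⟨l, hl, hne⟩ := exists_setIntegral_ncvD_ne_zero hU
    (show 0 ≤ k ^ 2 * q by positivity) rfl hr hnv
  exact hne (hzero l hl)
end
end

section
/- Define g : ℂ → ℂ by g(t) = (2 + cos 2t)·e^{it}, and let t₀ = (i/2)·ln(2+√7). Then g'(t₀) = 0 and g''(t₀) ≠ 0 (so t₀ is a simple critical point of g), and moreover x₂'(t₀) ≠ 0, where x₂(t) = (2 + cos 2t)·sin t. -/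
open Complex

noncomputable section

/-- Phase function of the nonconvex region: `g(t) = (2 + cos 2t) e^{it}`. -/
def gNcv : ℂ → ℂ := fun t => ((2 : ℂ) + Complex.cos (2 * t)) * Complex.exp (Complex.I * t)

/-- Second component of the parametrization: `x₂(t) = (2 + cos 2t) sin t`. -/
def x2Ncv : ℂ → ℂ := fun t => ((2 : ℂ) + Complex.cos (2 * t)) * Complex.sin t

theorem hasDerivAt_exp_const_mul (a t : ℂ) :
    HasDerivAt (fun s => Complex.exp (a * s)) (a * Complex.exp (a * t)) t := by
  simpa [mul_comm] using ((hasDerivAt_id t).const_mul a).cexp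

/-- The phase function as a combination of exponentials. -/
theorem gNcv_eq_exp : gNcv = fun t => 2 * Complex.exp (I * t) +
    (Complex.exp (3 * I * t) + Complex.exp (-I * t)) / 2 := by
  funext t
  have h₁ : Complex.exp (3 * I * t) = Complex.exp (2 * t * I) * Complex.exp (I * t) := by
    rw [← Complex.exp_add]; ring_nf
  have h₂ : Complex.exp (-I * t) = Complex.exp (-(2 * t) * I) * Complex.exp (I * t) := by
    rw [← Complex.exp_add]; ring_nf
  rw [h₁, h₂, gNcv, Complex.cos]
  ring

theorem deriv_gNcv : deriv gNcv = fun t => I * (2 * Complex.exp (I * t) +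
    (3 * Complex.exp (3 * I * t) - Complex.exp (-I * t)) / 2) := by
  funext t
  rw [gNcv_eq_exp]
  refine HasDerivAt.deriv ?_
  refine HasDerivAt.congr_deriv (((hasDerivAt_exp_const_mul I t).const_mul 2).add
    (((hasDerivAt_exp_const_mul (3 * I) t).add
      (hasDerivAt_exp_const_mul (-I) t)).div_const 2)) ?_
  ring

theorem iteratedDeriv_two_gNcv (t : ℂ) : iteratedDeriv 2 gNcv t =
    -(2 * Complex.exp (I * t) +
      (9 * Complex.exp (3 * I * t) + Complex.exp (-I * t)) / 2) := by
  rw [iteratedDeriv_succ, iteratedDeriv_one, deriv_gNcv]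
  refine HasDerivAt.deriv ?_
  refine HasDerivAt.congr_deriv ((((hasDerivAt_exp_const_mul I t).const_mul 2).add
    ((((hasDerivAt_exp_const_mul (3 * I) t).const_mul 3).sub
      (hasDerivAt_exp_const_mul (-I) t)).div_const 2)).const_mul I) ?_
  linear_combination (2 * Complex.exp (I * t) +
      (9 * Complex.exp (3 * I * t) + Complex.exp (-I * t)) / 2) * I_mul_I

theorem deriv_x2Ncv (t : ℂ) :
    deriv x2Ncv t = 3 / 2 * (Complex.cos t + Complex.cos (3 * t)) := by
  have h : x2Ncv = fun t => 3 / 2 * Complex.sin t + Complex.sin (3 * t) / 2 := by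
    funext t
    rw [x2Ncv, Complex.sin_three_mul, Complex.cos_two_mul, Complex.cos_sq']
    ring
  rw [h]
  refine HasDerivAt.deriv ?_
  refine HasDerivAt.congr_deriv (((Complex.hasDerivAt_sin t).const_mul (3 / 2)).add
    ((((hasDerivAt_id t).const_mul 3).csin).div_const 2)) ?_
  simp only [id]
  ring

theorem stmt7
    (t₀ : ℂ) (ht₀ : t₀ = (Complex.I / 2) * ((Real.log (2 + Real.sqrt 7) : ℝ) : ℂ)) :
    deriv gNcv t₀ = 0 ∧ iteratedDeriv 2 gNcv t₀ ≠ 0 ∧ deriv x2Ncv t₀ ≠ 0 := by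
  obtain ⟨r, hr⟩ : ∃ r : ℝ, r = Real.log (2 + Real.sqrt 7) / 2 := ⟨_, rfl⟩
  have ht : t₀ = r * I := by rw [ht₀, hr]; push_cast; ring
  have hexp : Real.exp r ^ 2 = 2 + Real.sqrt 7 := by
    rw [← Real.exp_nat_mul, hr, ← Real.exp_log (show 0 < 2 + Real.sqrt 7 by positivity)]
    norm_num [mul_div_cancel₀]
  have h₁ : Complex.exp (I * t₀) = ((Real.exp r)⁻¹ : ℝ) := by
    rw [← Real.exp_neg, ofReal_exp, ht]
    congr 1
    push_cast
    linear_combination (r : ℂ) * I_mul_I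
  have h₂ : Complex.exp (3 * I * t₀) = ((Real.exp r)⁻¹ ^ 3 : ℝ) := by
    rw [ofReal_pow, ← h₁, ← Complex.exp_nat_mul]
    congr 1
    push_cast
    ring
  have h₃ : Complex.exp (-I * t₀) = (Real.exp r : ℝ) := by
    rw [neg_mul, Complex.exp_neg, h₁, ofReal_inv, inv_inv]
  refine ⟨?_, ?_, ?_⟩
  · have key : 2 * (Real.exp r)⁻¹ + (3 * (Real.exp r)⁻¹ ^ 3 - Real.exp r) / 2 = 0 := by
      have hpos := Real.exp_pos r
      have hs : Real.sqrt 7 ^ 2 = 7 := Real.sq_sqrt (by norm_num)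
      have hq : Real.exp r ^ 4 - 4 * Real.exp r ^ 2 - 3 = 0 := by
        linear_combination (Real.exp r ^ 2 + Real.sqrt 7 - 2) * hexp + hs
      field_simp
      linear_combination -hq
    rw [deriv_gNcv]
    simp only [h₁, h₂, h₃]
    exact mul_eq_zero_of_right _ (by exact_mod_cast key)
  · rw [iteratedDeriv_two_gNcv, h₁, h₂, h₃, neg_ne_zero]
    have hpos : 2 * (Real.exp r)⁻¹ + (9 * (Real.exp r)⁻¹ ^ 3 + Real.exp r) / 2 ≠ 0 := by
      positivity
    exact_mod_cast hpos
  · rw [deriv_x2Ncv, ht, ← mul_assoc, Complex.cos_mul_I,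
      show (3 : ℂ) * r = ((3 * r : ℝ) : ℂ) by push_cast; ring, Complex.cos_mul_I]
    have hpos : Real.cosh r + Real.cosh (3 * r) ≠ 0 :=
      (add_pos (Real.cosh_pos r) (Real.cosh_pos (3 * r))).ne'
    exact mul_ne_zero (by norm_num) (by exact_mod_cast hpos)
end
end

section
/- Let k > 0 and q > 0, and for λ > 0 set λ̃ = √(λ²+k²q) − λ. Consider the deltoid parametrization x₁(t) = 2·cos t + cos 2t, x₂(t) = 2·sin t − sin 2t, and g = x₁ + i·x₂. Let U : ℂ² → ℂ be analytic on an open set Ω ⊆ ℂ² containing ℝ² and satisfy ∂²U/∂z₁² + ∂²U/∂z₂² + k²·U = 0 on Ω. Define v(t) = U(x₁(t),x₂(t)), V(t) = (∂₁U(x₁(t),x₂(t)), ∂₂U(x₁(t),x₂(t))), and I(λ) = ∫_{−π}^{π} [x₂'(t)V₁(t) − x₁'(t)V₂(t) + iλ·g'(t)·v(t) + iλ̃·x₁'(t)·v(t)]·exp(λ·g(t) + iλ̃·x₂(t)) dt. Then λ^{5/2}·e^{−3λ}·I(λ) − √(π/12)·k²·(q−1)·U(3,0) = O(1/λ) as λ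 → ∞. In particular, if q ≠ 1 and U(3,0) ≠ 0, then I(λ) ≠ 0 for some λ > 0 (so any incident wave nonvanishing at the outward cusp (3,0) of the deltoid is scattered by the enclosed region with constant refractive index q). -/
open Complex MeasureTheory Filter Asymptotics

noncomputable section

/-- `λ̃ = √(λ² + k²q) − λ`. -/
def lamT (k q lam : ℝ) : ℝ := Real.sqrt (lam ^ 2 + k ^ 2 * q) - lam

/-- The phase function `g = x₁ + i x₂`. -/
def gC (x1 x2 : ℂ → ℂ) : ℂ → ℂ := fun t => x1 t + Complex.I * x2 t

/-- The integrand of the boundary functional `I(λ)`. -/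
def bdryIntegrand (k q : ℝ) (x1 x2 : ℂ → ℂ) (U : ℂ → ℂ → ℂ) (lam : ℝ) (z : ℂ) : ℂ :=
  (deriv x2 z * P1 U (x1 z) (x2 z) - deriv x1 z * P2 U (x1 z) (x2 z)
    + Complex.I * (lam : ℂ) * deriv (gC x1 x2) z * U (x1 z) (x2 z)
    + Complex.I * (lamT k q lam : ℂ) * deriv x1 z * U (x1 z) (x2 z))
  * Complex.exp ((lam : ℂ) * gC x1 x2 z + Complex.I * (lamT k q lam : ℂ) * x2 z)

/-- The boundary functional `I(λ)`. -/
def bdryI (k q : ℝ) (x1 x2 : ℂ → ℂ) (U : ℂ → ℂ → ℂ) (lam : ℝ) : ℂ :=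
  ∫ t in (-Real.pi)..Real.pi, bdryIntegrand k q x1 x2 U lam (t : ℂ)

/-- First component of the deltoid parametrization: `x₁(t) = 2 cos t + cos 2t`. -/
def delt1 : ℂ → ℂ := fun t => 2 * Complex.cos t + Complex.cos (2 * t)

/-- Second component of the deltoid parametrization: `x₂(t) = 2 sin t − sin 2t`. -/
def delt2 : ℂ → ℂ := fun t => 2 * Complex.sin t - Complex.sin (2 * t)

namespace Deltoid

/-- Velocity of the complex phase along the deltoid. -/
def G (t : ℝ) : ℂ := 2 * I * (exp (I * t) - exp (-(2 * I * t)))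

/-- Derivative of the first coordinate. -/
def d1 (t : ℝ) : ℂ := G t * ((1 + exp (I * t)) / 2)

/-- Derivative of the second coordinate. -/
def d2 (t : ℝ) : ℂ := G t * ((1 - exp (I * t)) / (2 * I))

/-- The exponential factor, normalised at the cusp. -/
def ker (k q lam t : ℝ) : ℂ :=
  exp ((lam : ℂ) * (gC delt1 delt2 t - 3) + I * (lamT k q lam : ℂ) * delt2 t)

/-- The exponential integral with amplitude `a`. -/
def K (k q : ℝ) (a : ℝ → ℂ) (lam : ℝ) : ℂ :=
  ∫ t in (-Real.pi)..Real.pi, a t * ker k q lam t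

lemma hasDerivAt_delt1 (z : ℂ) :
    HasDerivAt delt1 (-2 * Complex.sin z - 2 * Complex.sin (2 * z)) z := by
  unfold delt1
  have h2 : HasDerivAt (fun z : ℂ => 2 * z) 2 z := by simpa using (hasDerivAt_id z).const_mul 2
  exact (((Complex.hasDerivAt_cos z).const_mul 2).add h2.ccos).congr_deriv (by ring)

lemma hasDerivAt_delt2 (z : ℂ) :
    HasDerivAt delt2 (2 * Complex.cos z - 2 * Complex.cos (2 * z)) z := by
  unfold delt2
  have h2 : HasDerivAt (fun z : ℂ => 2 * z) 2 z := by simpa using (hasDerivAt_id z).const_mul 2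
  exact (((Complex.hasDerivAt_sin z).const_mul 2).sub h2.csin).congr_deriv (by ring)

lemma d1_eq (t : ℝ) : d1 t = -2 * Complex.sin t - 2 * Complex.sin (2 * t) := by
  have h1 : exp (I * t) = Complex.cos t + Complex.sin t * I := by
    rw [mul_comm, Complex.exp_mul_I]
  have h2 : exp (-(2 * I * t)) = (Complex.cos t - Complex.sin t * I) ^ 2 := by
    rw [show -(2 * I * (t : ℂ)) = (2 : ℕ) * ((-t : ℂ) * I) by push_cast; ring, Complex.exp_nat_mul,
      Complex.exp_mul_I, Complex.cos_neg, Complex.sin_neg]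
    ring
  unfold d1 G
  rw [h1, h2, Complex.sin_two_mul]
  have := Complex.sin_sq_add_cos_sq (t : ℂ)
  have hI := Complex.I_sq
  grind

lemma d2_eq (t : ℝ) : d2 t = 2 * Complex.cos t - 2 * Complex.cos (2 * t) := by
  have h1 : exp (I * t) = Complex.cos t + Complex.sin t * I := by
    rw [mul_comm, Complex.exp_mul_I]
  have h2 : exp (-(2 * I * t)) = (Complex.cos t - Complex.sin t * I) ^ 2 := by
    rw [show -(2 * I * (t : ℂ)) = (2 : ℕ) * ((-t : ℂ) * I) by push_cast; ring, Complex.exp_nat_mul,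
      Complex.exp_mul_I, Complex.cos_neg, Complex.sin_neg]
    ring
  unfold d2 G
  rw [h1, h2, Complex.cos_two_mul]
  have := Complex.sin_sq_add_cos_sq (t : ℂ)
  have hI := Complex.I_sq
  have hI0 := Complex.I_ne_zero
  field_simp
  grind

lemma hasDerivAt_x1 (t : ℝ) : HasDerivAt (fun t : ℝ => delt1 t) (d1 t) t := by
  rw [d1_eq]; exact (hasDerivAt_delt1 t).comp_ofReal

lemma hasDerivAt_x2 (t : ℝ) : HasDerivAt (fun t : ℝ => delt2 t) (d2 t) t := by
  rw [d2_eq]; exact (hasDerivAt_delt2 t).comp_ofReal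

lemma G_eq (t : ℝ) : G t = d1 t + I * d2 t := by
  unfold d1 d2
  have hI0 := Complex.I_ne_zero
  field_simp
  ring

lemma conj_G_eq (t : ℝ) : G t * exp (I * t) = d1 t - I * d2 t := by
  unfold d1 d2
  have hI0 := Complex.I_ne_zero
  field_simp
  ring

lemma contDiff_expI : ContDiff ℝ ⊤ (fun t : ℝ => exp (I * t)) := by
  have : ContDiff ℝ ⊤ (fun t : ℝ => (t : ℂ)) := Complex.ofRealCLM.contDiff
  fun_prop

lemma contDiff_G : ContDiff ℝ ⊤ G := by
  have : ContDiff ℝ ⊤ (fun t : ℝ => (t : ℂ)) := Complex.ofRealCLM.contDiff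
  unfold G
  fun_prop

lemma contDiff_d1 : ContDiff ℝ ⊤ d1 := by
  have := contDiff_G
  have := contDiff_expI
  unfold d1
  fun_prop

lemma contDiff_d2 : ContDiff ℝ ⊤ d2 := by
  have := contDiff_G
  have := contDiff_expI
  unfold d2
  fun_prop

lemma contDiff_x1 : ContDiff ℝ ⊤ (fun t : ℝ => delt1 t) := by
  have h : ContDiff ℂ ⊤ delt1 := by unfold delt1; fun_prop
  exact (h.restrict_scalars ℝ).comp Complex.ofRealCLM.contDiff

lemma contDiff_x2 : ContDiff ℝ ⊤ (fun t : ℝ => delt2 t) := by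
  have h : ContDiff ℂ ⊤ delt2 := by unfold delt2; fun_prop
  exact (h.restrict_scalars ℝ).comp Complex.ofRealCLM.contDiff

lemma x1_pi : delt1 ((Real.pi : ℝ) : ℂ) = delt1 ((-Real.pi : ℝ) : ℂ) := by
  simp [delt1]

lemma x2_pi : delt2 ((Real.pi : ℝ) : ℂ) = delt2 ((-Real.pi : ℝ) : ℂ) := by
  simp [delt2, Complex.sin_two_mul]

lemma expI_pi : exp (I * (Real.pi : ℝ)) = exp (I * (-Real.pi : ℝ)) := by
  have h : I * ((-Real.pi : ℝ) : ℂ) = -((Real.pi : ℂ) * I) := by push_cast; ring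
  rw [h, Complex.exp_neg, mul_comm, Complex.exp_pi_mul_I]
  norm_num

lemma hasDerivAt_ker (k q lam t : ℝ) :
    HasDerivAt (ker k q lam) ((lam * G t + I * lamT k q lam * d2 t) * ker k q lam t) t := by
  unfold ker gC
  have h := (((hasDerivAt_x1 t).add ((hasDerivAt_x2 t).const_mul I)).sub_const 3).const_mul (lam : ℂ)
  have h' := (h.add ((hasDerivAt_x2 t).const_mul (I * (lamT k q lam : ℂ)))).cexp
  exact h'.congr_deriv (by rw [G_eq]; simp only [Pi.add_apply]; ring)

lemma continuous_ker (k q lam : ℝ) : Continuous (ker k q lam) :=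
  continuous_iff_continuousAt.2 fun t => (hasDerivAt_ker k q lam t).continuousAt

lemma ker_pi (k q lam : ℝ) : ker k q lam Real.pi = ker k q lam (-Real.pi) := by
  unfold ker gC
  rw [x1_pi, x2_pi]

lemma K_add (k q lam : ℝ) {a b : ℝ → ℂ} (ha : Continuous a) (hb : Continuous b) :
    K k q (fun t => a t + b t) lam = K k q a lam + K k q b lam := by
  have hc := continuous_ker k q lam
  unfold K
  rw [← intervalIntegral.integral_add]
  · simp only [add_mul]
  · exact (ha.mul hc).intervalIntegrable _ _
  · exact (hb.mul hc).intervalIntegrable _ _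

lemma K_const_mul (k q lam : ℝ) (c : ℂ) (a : ℝ → ℂ) :
    K k q (fun t => c * a t) lam = c * K k q a lam := by
  unfold K
  rw [← intervalIntegral.integral_const_mul]
  simp only [mul_assoc]

/-- Integration by parts for closed curves. -/
lemma K_total_deriv (k q lam : ℝ) {a a' : ℝ → ℂ} (ha : ∀ t, HasDerivAt a (a' t) t)
    (ha' : Continuous a') (hper : a Real.pi = a (-Real.pi)) :
    ∫ t in (-Real.pi)..Real.pi,
      (a' t + a t * (lam * G t + I * lamT k q lam * d2 t)) * ker k q lam t = 0 := by
  have hc := continuous_ker k q lam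
  have hac : Continuous a := continuous_iff_continuousAt.2 fun t => (ha t).continuousAt
  have hG := contDiff_G.continuous
  have hd := contDiff_d2.continuous
  rw [intervalIntegral.integral_eq_sub_of_hasDerivAt (f := fun t => a t * ker k q lam t)]
  · simp only [hper, ker_pi, sub_self]
  · intro t _
    exact ((ha t).mul (hasDerivAt_ker k q lam t)).congr_deriv (by ring)
  · exact Continuous.intervalIntegrable (by fun_prop) _ _

lemma K_G_mul (k q : ℝ) {lam : ℝ} (hl : lam ≠ 0) {a a' : ℝ → ℂ} (ha : ∀ t, HasDerivAt a (a' t) t)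
    (ha' : Continuous a') (hper : a Real.pi = a (-Real.pi)) :
    K k q (fun t => G t * a t) lam
      = -(lam : ℂ)⁻¹ * (K k q a' lam + I * lamT k q lam * K k q (fun t => d2 t * a t) lam) := by
  have hac : Continuous a := continuous_iff_continuousAt.2 fun t => (ha t).continuousAt
  have hG := contDiff_G.continuous
  have hd := contDiff_d2.continuous
  have h := K_total_deriv k q lam ha ha' hper
  have h2 : K k q (fun t => a' t + (lam * (G t * a t) + I * lamT k q lam * (d2 t * a t))) lam = 0 := by
    rw [← h]; unfold K; congr 1; ext t; ring
  rw [K_add, K_add, K_const_mul, K_const_mul] at h2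
  · have hl' : (lam : ℂ) ≠ 0 := by exact_mod_cast hl
    field_simp
    linear_combination h2
  all_goals fun_prop

lemma x1_ofReal (t : ℝ) : delt1 t = ((2 * Real.cos t + Real.cos (2 * t) : ℝ) : ℂ) := by
  simp [delt1]

lemma x2_ofReal (t : ℝ) : delt2 t = ((2 * Real.sin t - Real.sin (2 * t) : ℝ) : ℂ) := by
  simp [delt2]

/-- The real part of the normalised phase. -/
def phi (t : ℝ) : ℝ := 2 * Real.cos t + Real.cos (2 * t) - 3

/-- The imaginary part of the phase. -/
def psi (t : ℝ) : ℝ := 2 * Real.sin t - Real.sin (2 * t)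

lemma continuous_phi : Continuous phi := by unfold phi; fun_prop

lemma continuous_psi : Continuous psi := by unfold psi; fun_prop

lemma ker_eq (k q lam t : ℝ) :
    ker k q lam t = Real.exp (lam * phi t) * exp (I * ((lam + lamT k q lam) * psi t : ℝ)) := by
  unfold ker gC
  rw [x1_ofReal, x2_ofReal, Complex.ofReal_exp, ← Complex.exp_add]
  congr 1
  simp only [phi, psi]
  push_cast
  ring

lemma norm_ker (k q lam t : ℝ) : ‖ker k q lam t‖ = Real.exp (lam * phi t) := by
  rw [ker_eq, norm_mul, Complex.norm_exp_I_mul_ofReal, Complex.norm_real, mul_one,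
    Real.norm_of_nonneg (Real.exp_pos _).le]

lemma phi_le {t : ℝ} (ht : |t| ≤ Real.pi) : phi t ≤ -(t ^ 2 / 3) := by
  unfold phi
  rw [Real.cos_two_mul]
  have h1 := Real.cos_le_one_sub_mul_cos_sq ht
  have h2 := Real.neg_one_le_cos t
  have h3 : 1 / 6 ≤ 2 / Real.pi ^ 2 := by
    rw [div_le_div_iff₀ (by norm_num) (by positivity)]
    nlinarith [Real.pi_lt_d2, Real.pi_pos]
  have h4 : 1 / 6 * t ^ 2 ≤ 2 / Real.pi ^ 2 * t ^ 2 := by gcongr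
  nlinarith

lemma abs_phi_add_le (t : ℝ) : |phi t + 3 * t ^ 2| ≤ 19 * t ^ 4 := by
  have h1 := Real.one_sub_sq_div_two_le_cos (x := t)
  have h3 := Real.cos_le_one t
  have h2 : Real.cos t ≤ 1 - t ^ 2 / 2 + 3 * t ^ 4 := by
    rcases le_total |t| 1 with h | h
    · have := (abs_le.1 (Real.cos_bound h)).2
      rw [show |t| ^ 4 = t ^ 4 from Even.pow_abs (by decide) t] at this
      nlinarith [sq_nonneg (t ^ 2)]
    · have : 1 ≤ t ^ 2 := by rw [← sq_abs]; nlinarith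
      nlinarith [sq_nonneg (t ^ 2 - 1)]
  unfold phi
  rw [Real.cos_two_mul, abs_le]
  have h4 : (1 - Real.cos t) ^ 2 ≤ (t ^ 2 / 2) ^ 2 := by
    apply pow_le_pow_left₀ <;> linarith
  constructor <;> nlinarith [sq_nonneg (1 - Real.cos t)]

lemma abs_psi_le (t : ℝ) : |psi t| ≤ |t| ^ 3 := by
  have h : psi t = 2 * Real.sin t * (1 - Real.cos t) := by
    unfold psi; rw [Real.sin_two_mul]; ring
  have h1 := Real.one_sub_sq_div_two_le_cos (x := t)
  have h3 := Real.cos_le_one t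
  rw [h, abs_mul, abs_mul, abs_of_nonneg (by linarith : 0 ≤ 1 - Real.cos t), abs_two]
  have h5 : 1 - Real.cos t ≤ |t| ^ 2 / 2 := by rw [sq_abs]; linarith
  calc 2 * |Real.sin t| * (1 - Real.cos t) ≤ 2 * |t| * (|t| ^ 2 / 2) :=
        mul_le_mul (mul_le_mul_of_nonneg_left Real.abs_sin_le_abs zero_le_two) h5
          (by linarith) (by positivity)
    _ = |t| ^ 3 := by ring

lemma psi_neg (t : ℝ) : psi (-t) = -psi t := by simp [psi]; ring

lemma phi_neg (t : ℝ) : phi (-t) = phi t := by simp [phi]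

lemma gaussian_interval_le {b : ℝ} (hb : 0 < b) :
    ∫ t in (-Real.pi)..Real.pi, Real.exp (-b * t ^ 2) ≤ √(Real.pi / b) := by
  rw [← integral_gaussian b, intervalIntegral.integral_of_le (by linarith [Real.pi_pos])]
  exact setIntegral_le_integral (integrable_exp_neg_mul_sq hb)
    (Eventually.of_forall fun t => (Real.exp_pos _).le)

/-- A Gaussian bound on the integrand bounds the integral. -/
lemma norm_integral_le_gaussian {f : ℝ → ℂ} {b C : ℝ} (hb : 0 < b) (hC : 0 ≤ C)
    (h : ∀ t, |t| ≤ Real.pi → ‖f t‖ ≤ C * Real.exp (-b * t ^ 2)) :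
    ‖∫ t in (-Real.pi)..Real.pi, f t‖ ≤ C * √(Real.pi / b) := by
  have hpi : -Real.pi ≤ Real.pi := by linarith [Real.pi_pos]
  calc ‖∫ t in (-Real.pi)..Real.pi, f t‖
      ≤ ∫ t in (-Real.pi)..Real.pi, C * Real.exp (-b * t ^ 2) := by
        apply intervalIntegral.norm_integral_le_of_norm_le hpi
        · exact Eventually.of_forall fun t ht => h t (abs_le.2 ⟨ht.1.le, ht.2⟩)
        · exact Continuous.intervalIntegrable (by fun_prop) _ _
    _ = C * ∫ t in (-Real.pi)..Real.pi, Real.exp (-b * t ^ 2) :=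
        intervalIntegral.integral_const_mul _ _
    _ ≤ _ := by gcongr; exact gaussian_interval_le hb

lemma gaussian_tail {b : ℝ} (hb : 1 ≤ b) :
    |√(Real.pi / (3 * b)) - ∫ t in (-Real.pi)..Real.pi, Real.exp (-(3 * b) * t ^ 2)|
      ≤ b⁻¹ * √(Real.pi / b) := by
  have hpi : -Real.pi ≤ Real.pi := by linarith [Real.pi_pos]
  have hi := integrable_exp_neg_mul_sq (b := 3 * b) (by linarith)
  have hi1 := integrable_exp_neg_mul_sq (b := b) (by linarith)
  rw [← integral_gaussian (3 * b), ← integral_gaussian b,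
    intervalIntegral.integral_of_le hpi, ← integral_add_compl measurableSet_Ioc hi,
    add_sub_cancel_left, abs_of_nonneg (integral_nonneg fun t => (Real.exp_pos _).le),
    ← integral_const_mul]
  calc _ ≤ ∫ t in (Set.Ioc (-Real.pi) Real.pi)ᶜ, b⁻¹ * Real.exp (-b * t ^ 2) := by
        apply setIntegral_mono_on hi.integrableOn (hi1.const_mul _).integrableOn
          measurableSet_Ioc.compl
        intro t ht
        have h1 : 1 ≤ t ^ 2 := by
          simp only [Set.mem_compl_iff, Set.mem_Ioc, not_and_or, not_lt, not_le] at ht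
          rcases ht with ht | ht <;> nlinarith [Real.pi_gt_three]
        have h2 : Real.exp (-(2 * b)) ≤ b⁻¹ := by
          rw [Real.exp_neg]
          gcongr
          linarith [Real.add_one_le_exp (2 * b)]
        calc Real.exp (-(3 * b) * t ^ 2) ≤ Real.exp (-(2 * b) + -b * t ^ 2) := by
              gcongr; nlinarith
          _ ≤ _ := by rw [Real.exp_add]; gcongr
    _ ≤ _ := setIntegral_le_integral (hi1.const_mul _)
          (Eventually.of_forall fun t => by
            have := Real.exp_pos (-b * t ^ 2)
            have : 0 ≤ b⁻¹ := by positivity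
            positivity)

lemma lamT_nonneg {k q lam : ℝ} (hq : 0 < q) : 0 ≤ lamT k q lam := by
  unfold lamT
  rw [sub_nonneg]
  apply Real.le_sqrt_of_sq_le
  nlinarith [sq_nonneg k]

lemma lamT_eq {k q lam : ℝ} (hq : 0 < q) :
    lamT k q lam * (lamT k q lam + 2 * lam) = k ^ 2 * q := by
  have h : 0 ≤ lam ^ 2 + k ^ 2 * q := by positivity
  unfold lamT
  linear_combination Real.sq_sqrt h

lemma lamT_le {k q lam : ℝ} (hq : 0 < q) (hl : 0 < lam) :
    lamT k q lam ≤ k ^ 2 * q * lam⁻¹ := by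
  have h1 := lamT_eq (k := k) (lam := lam) hq
  have h2 := lamT_nonneg (k := k) (lam := lam) hq
  rw [← div_eq_mul_inv, le_div_iff₀ hl]
  nlinarith

lemma lamT_sub_le {k q lam : ℝ} (hq : 0 < q) (hl : 1 ≤ lam) :
    |lamT k q lam - k ^ 2 * q / (2 * lam)| ≤ (k ^ 2 * q) ^ 2 * lam⁻¹ ^ 2 := by
  have h0 : 0 < lam := by linarith
  have h1 := lamT_eq (k := k) (lam := lam) hq
  have h2 := lamT_nonneg (k := k) (lam := lam) hq
  have h3 := lamT_le (k := k) hq h0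
  have h4 : lamT k q lam - k ^ 2 * q / (2 * lam) = -(lamT k q lam ^ 2 / (2 * lam)) := by
    rw [← h1]; field_simp; ring
  rw [h4, abs_neg, abs_of_nonneg (by positivity), div_le_iff₀ (by positivity)]
  have h5 : lamT k q lam ^ 2 ≤ (k ^ 2 * q * lam⁻¹) ^ 2 := by gcongr
  have h6 : 0 ≤ (k ^ 2 * q * lam⁻¹) ^ 2 := by positivity
  rw [← mul_pow]
  nlinarith

/-- The reference decay `λ^{-1/2}`. -/
def s0 (lam : ℝ) : ℝ := (√lam)⁻¹

lemma sqrt_div_eq {c lam : ℝ} (hc : 0 ≤ c) : √(c / lam) = √c * s0 lam := by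
  rw [Real.sqrt_div hc, s0, div_eq_mul_inv]

lemma exists_bound_Icc {a : ℝ → ℂ} (ha : Continuous a) :
    ∃ M, 0 ≤ M ∧ ∀ t, |t| ≤ Real.pi → ‖a t‖ ≤ M := by
  obtain ⟨M, hM⟩ := (isCompact_Icc (a := -Real.pi) (b := Real.pi)).exists_bound_of_continuousOn
    ha.continuousOn
  have h0 := hM 0 ⟨by linarith [Real.pi_pos], Real.pi_pos.le⟩
  exact ⟨M, (norm_nonneg _).trans h0, fun t ht => hM t (abs_le.1 ht)⟩

lemma K_isBigO (k q : ℝ) {a : ℝ → ℂ} (ha : Continuous a) : K k q a =O[atTop] s0 := by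
  obtain ⟨M, hM0, hM⟩ := exists_bound_Icc ha
  refine IsBigO.of_bound (M * √(3 * Real.pi)) ?_
  filter_upwards [eventually_gt_atTop 0] with lam hl
  have h : ‖K k q a lam‖ ≤ M * √(Real.pi / (lam / 3)) := by
    apply norm_integral_le_gaussian (by positivity) hM0
    intro t ht
    rw [norm_mul, norm_ker]
    have h1 : lam * phi t ≤ -(lam / 3) * t ^ 2 := by nlinarith [phi_le ht]
    exact mul_le_mul (hM t ht) (Real.exp_le_exp.2 h1) (Real.exp_pos _).le hM0
  rw [show Real.pi / (lam / 3) = 3 * Real.pi / lam by field_simp,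
    sqrt_div_eq (by positivity)] at h
  rw [Real.norm_of_nonneg (by unfold s0; positivity)]
  linarith

lemma lamT_isBigO {k q : ℝ} (hq : 0 < q) :
    (fun lam => (lamT k q lam : ℂ)) =O[atTop] (fun lam : ℝ => lam⁻¹) := by
  refine IsBigO.of_bound (k ^ 2 * q) ?_
  filter_upwards [eventually_gt_atTop 0] with lam hl
  rw [Complex.norm_real, Real.norm_of_nonneg (lamT_nonneg hq),
    Real.norm_of_nonneg (by positivity)]
  exact lamT_le hq hl

lemma inv_isBigO : (fun lam : ℝ => (lam : ℂ)⁻¹) =O[atTop] (fun lam : ℝ => lam⁻¹) := by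
  refine IsBigO.of_bound 1 (Eventually.of_forall fun lam => ?_)
  rw [norm_inv, Complex.norm_real, norm_inv, one_mul]

lemma inv_isBigO_one : (fun lam : ℝ => lam⁻¹) =O[atTop] (fun _ : ℝ => (1 : ℝ)) :=
  tendsto_inv_atTop_zero.isBigO_one ℝ

/-- Amplitudes that vanish with the phase velocity gain one power of `λ`. -/
lemma K_G_mul_isBigO {k q : ℝ} (hq : 0 < q) {a : ℝ → ℂ} (ha : ContDiff ℝ 1 a)
    (hper : a Real.pi = a (-Real.pi)) :
    K k q (fun t => G t * a t) =O[atTop] (fun lam => lam⁻¹ * s0 lam) := by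
  have hd := contDiff_d2.continuous
  have hac := ha.continuous
  have ha' : Continuous (deriv a) := ha.continuous_deriv le_rfl
  have h1 : (fun lam : ℝ => -(lam : ℂ)⁻¹ * (K k q (deriv a) lam
      + I * lamT k q lam * K k q (fun t => d2 t * a t) lam)) =O[atTop]
      (fun lam => lam⁻¹ * s0 lam) := by
    refine inv_isBigO.neg_left.mul ((K_isBigO k q ha').add ?_)
    have h2 := (((lamT_isBigO (k := k) hq).trans inv_isBigO_one).const_mul_left I).mul
      (K_isBigO k q (a := fun t => d2 t * a t) (by fun_prop))
    simpa using h2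
  refine h1.congr' ?_ EventuallyEq.rfl
  filter_upwards [eventually_gt_atTop 0] with lam hl
  exact (K_G_mul k q hl.ne' (fun t => (ha.differentiable one_ne_zero t).hasDerivAt) ha' hper).symm

lemma pow_mul_exp_le (n : ℕ) {s : ℝ} (hs : 0 ≤ s) :
    s ^ n * Real.exp (-(s / 3)) ≤ n.factorial * 6 ^ n * Real.exp (-(s / 6)) := by
  have h := Real.pow_div_factorial_le_exp (s / 6) (by positivity) n
  rw [div_le_iff₀ (by positivity), div_pow, div_le_iff₀ (by positivity)] at h
  rw [show -(s / 3) = -(s / 6) + -(s / 6) by ring, Real.exp_add, ← mul_assoc]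
  refine mul_le_mul_of_nonneg_right ?_ (Real.exp_pos _).le
  rw [Real.exp_neg, ← div_eq_mul_inv, div_le_iff₀ (Real.exp_pos _)]
  linarith

lemma norm_exp_I_sub_le (x : ℝ) : ‖exp (I * x) - 1 - I * x‖ ≤ 3 * x ^ 2 := by
  rcases le_total ‖I * (x : ℂ)‖ 1 with h | h
  · have := Complex.norm_exp_sub_one_sub_id_le h
    rw [norm_mul, Complex.norm_I, one_mul, Complex.norm_real, Real.norm_eq_abs, sq_abs] at this
    nlinarith [sq_nonneg x]
  · have h1 : ‖exp (I * x) - 1 - I * x‖ ≤ ‖exp (I * (x : ℂ)) - 1‖ + ‖I * (x : ℂ)‖ := norm_sub_le _ _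
    have h2 := Real.norm_exp_I_mul_ofReal_sub_one_le (x := x)
    rw [norm_mul, Complex.norm_I, one_mul, Complex.norm_real] at h h1
    rw [Real.norm_eq_abs] at h h1 h2
    rw [← sq_abs]
    nlinarith

lemma exists_taylor_bound {a : ℝ → ℂ} (ha : ContDiff ℝ 2 a) :
    ∃ M, 0 ≤ M ∧ ∀ t, |t| ≤ Real.pi → ‖a t - a 0 - t * deriv a 0‖ ≤ M * t ^ 2 := by
  have hd : ContDiff ℝ 1 (deriv a) := ((contDiff_succ_iff_deriv (n := 1)).1 ha).2.2
  obtain ⟨M, hM0, hM⟩ := exists_bound_Icc (hd.continuous_deriv le_rfl)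
  have hder : ∀ t, HasDerivAt (deriv a) (deriv (deriv a) t) t := fun t =>
    (hd.differentiable one_ne_zero t).hasDerivAt
  have h1 : ∀ t, |t| ≤ Real.pi → ‖deriv a t - deriv a 0‖ ≤ M * |t| := by
    intro t ht
    have := (convex_Icc (-Real.pi) Real.pi).norm_image_sub_le_of_norm_hasDerivWithin_le
      (fun x _ => (hder x).hasDerivWithinAt) (fun x hx => hM x (abs_le.2 hx))
      (abs_le.1 (abs_zero.trans_le Real.pi_pos.le)) (abs_le.1 ht)
    simpa using this
  refine ⟨M, hM0, fun t ht => ?_⟩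
  have h2 : ∀ x, HasDerivAt (fun x : ℝ => a x - a 0 - x * deriv a 0) (deriv a x - deriv a 0) x := by
    intro x
    have h3 : HasDerivAt a (deriv a x) x := (ha.differentiable two_ne_zero x).hasDerivAt
    have h4 : HasDerivAt (fun x : ℝ => (x : ℂ)) 1 x := Complex.ofRealCLM.hasDerivAt
    exact ((h3.sub_const (a 0)).sub (h4.mul_const (deriv a 0))).congr_deriv (by ring)
  have := (convex_Icc (-|t|) |t|).norm_image_sub_le_of_norm_hasDerivWithin_le (C := M * |t|)
      (fun x _ => (h2 x).hasDerivWithinAt)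
      (fun x hx => (h1 x ((abs_le.2 hx).trans ht)).trans (mul_le_mul_of_nonneg_left (abs_le.2 hx) hM0))
      (abs_le.1 (abs_zero.trans_le (abs_nonneg t))) (abs_le.1 le_rfl)
  simpa [mul_assoc, ← sq] using this

lemma abs_exp_sub_exp_le {x y b : ℝ} (hx : x ≤ b) (hy : y ≤ b) :
    |Real.exp x - Real.exp y| ≤ |x - y| * Real.exp b := by
  have := (convex_Iic b).norm_image_sub_le_of_norm_hasDerivWithin_le (C := Real.exp b)
      (fun x _ => (Real.hasDerivAt_exp x).hasDerivWithinAt)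
      (fun x hx => by
        rw [Real.norm_of_nonneg (Real.exp_pos _).le]; exact Real.exp_le_exp.2 hx)
      (Set.mem_Iic.2 hy) (Set.mem_Iic.2 hx)
  rw [Real.norm_eq_abs, Real.norm_eq_abs] at this
  linarith

lemma integral_eq_zero_of_odd {f : ℝ → ℂ} (hf : ∀ t, f (-t) = -f t) (b : ℝ) :
    ∫ t in (-b)..b, f t = 0 := by
  have h := intervalIntegral.integral_comp_neg (a := -b) (b := b) f
  simp only [hf, neg_neg, intervalIntegral.integral_neg] at h
  exact self_eq_neg.1 h.symm

lemma norm_remainder_le {k q lam : ℝ} (hq : 0 < q) (hl : 1 ≤ lam) (hl2 : k ^ 2 * q ≤ lam)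
    {a : ℝ → ℂ} {M t : ℝ} (ht : |t| ≤ Real.pi)
    (hM : ‖a t - a 0 - t * deriv a 0‖ ≤ M * t ^ 2) :
    ‖a t * ker k q lam t - a 0 * Real.exp (-(3 * lam) * t ^ 2)
      - Real.exp (lam * phi t) * (t * deriv a 0 + I * ((lam + lamT k q lam) * psi t : ℝ) * a 0)‖
      ≤ lam⁻¹ * (M * (lam * t ^ 2) + (2 * ‖deriv a 0‖ + 19 * ‖a 0‖) * (lam * t ^ 2) ^ 2
        + 12 * ‖a 0‖ * (lam * t ^ 2) ^ 3) * Real.exp (-(lam * t ^ 2 / 3)) := by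
  have hl0 : 0 < lam := by linarith
  set P : ℝ := (lam + lamT k q lam) * psi t with hP
  have hPle : |P| ≤ 2 * lam * |t| ^ 3 := by
    have h1 := lamT_nonneg (k := k) (lam := lam) hq
    have h2 := lamT_le (k := k) hq hl0
    have h3 : k ^ 2 * q * lam⁻¹ ≤ lam := by
      rw [← div_eq_mul_inv, div_le_iff₀ hl0]; nlinarith
    rw [hP, abs_mul, abs_of_nonneg (by positivity)]
    exact mul_le_mul (by linarith) (abs_psi_le t) (abs_nonneg _) (by positivity)
  have hexp : Real.exp (lam * phi t) ≤ Real.exp (-(lam * t ^ 2 / 3)) := by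
    apply Real.exp_le_exp.2; nlinarith [phi_le ht]
  have hexp2 : |Real.exp (lam * phi t) - Real.exp (-(3 * lam) * t ^ 2)|
      ≤ 19 * lam * t ^ 4 * Real.exp (-(lam * t ^ 2 / 3)) := by
    refine (abs_exp_sub_exp_le (b := -(lam * t ^ 2 / 3)) (by nlinarith [phi_le ht])
      (by nlinarith [sq_nonneg t])).trans ?_
    rw [show lam * phi t - -(3 * lam) * t ^ 2 = lam * (phi t + 3 * t ^ 2) by ring, abs_mul,
      abs_of_pos hl0]
    have := abs_phi_add_le t
    have h5 : lam * |phi t + 3 * t ^ 2| ≤ lam * (19 * t ^ 4) := by gcongr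
    have h6 := Real.exp_pos (-(lam * t ^ 2 / 3))
    nlinarith
  have key : a t * ker k q lam t - a 0 * Real.exp (-(3 * lam) * t ^ 2)
      - Real.exp (lam * phi t) * (t * deriv a 0 + I * P * a 0)
      = Real.exp (lam * phi t) * ((a t - a 0 - t * deriv a 0) * exp (I * P)
        + t * deriv a 0 * (exp (I * P) - 1) + a 0 * (exp (I * P) - 1 - I * P))
        + a 0 * (Real.exp (lam * phi t) - Real.exp (-(3 * lam) * t ^ 2) : ℝ) := by
    rw [ker_eq, ← hP]; push_cast; ring
  rw [key]
  have n1 : ‖(a t - a 0 - t * deriv a 0) * exp (I * P)‖ ≤ M * t ^ 2 := by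
    rwa [norm_mul, Complex.norm_exp_I_mul_ofReal, mul_one]
  have n2 : ‖t * deriv a 0 * (exp (I * P) - 1)‖ ≤ |t| * ‖deriv a 0‖ * (2 * lam * |t| ^ 3) := by
    rw [norm_mul, norm_mul, Complex.norm_real, Real.norm_eq_abs]
    gcongr
    exact Real.norm_exp_I_mul_ofReal_sub_one_le.trans hPle
  have n3 : ‖a 0 * (exp (I * P) - 1 - I * P)‖ ≤ ‖a 0‖ * (3 * (2 * lam * |t| ^ 3) ^ 2) := by
    rw [norm_mul]
    gcongr
    refine (norm_exp_I_sub_le P).trans ?_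
    rw [← sq_abs P]
    gcongr
  have n4 : ‖a 0 * (Real.exp (lam * phi t) - Real.exp (-(3 * lam) * t ^ 2) : ℝ)‖
      ≤ ‖a 0‖ * (19 * lam * t ^ 4 * Real.exp (-(lam * t ^ 2 / 3))) := by
    rw [norm_mul, Complex.norm_real, Real.norm_eq_abs]
    gcongr
  have e4 : |t| ^ 4 = t ^ 4 := Even.pow_abs (by decide) t
  have e6 : |t| ^ 6 = t ^ 6 := Even.pow_abs (by decide) t
  have n5 : ‖Real.exp (lam * phi t) * ((a t - a 0 - t * deriv a 0) * exp (I * P)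
        + t * deriv a 0 * (exp (I * P) - 1) + a 0 * (exp (I * P) - 1 - I * P))‖
      ≤ Real.exp (-(lam * t ^ 2 / 3)) * (M * t ^ 2 + |t| * ‖deriv a 0‖ * (2 * lam * |t| ^ 3)
        + ‖a 0‖ * (3 * (2 * lam * |t| ^ 3) ^ 2)) := by
    rw [norm_mul, Complex.norm_real, Real.norm_of_nonneg (Real.exp_pos _).le]
    exact mul_le_mul hexp (norm_add₃_le.trans (add_le_add_three n1 n2 n3)) (norm_nonneg _)
      (Real.exp_pos _).le
  refine (norm_add_le _ _).trans ((add_le_add n5 n4).trans (le_of_eq ?_))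
  rw [show |t| * ‖deriv a 0‖ * (2 * lam * |t| ^ 3) = 2 * ‖deriv a 0‖ * lam * |t| ^ 4 by ring,
    show ‖a 0‖ * (3 * (2 * lam * |t| ^ 3) ^ 2) = 12 * ‖a 0‖ * lam ^ 2 * |t| ^ 6 by ring, e4, e6]
  field_simp
  ring

/-- Leading term of Laplace's method at the cusp. -/
lemma K_leading {k q : ℝ} (hq : 0 < q) {a : ℝ → ℂ} (ha : ContDiff ℝ 2 a) :
    (fun lam => K k q a lam - a 0 * √(Real.pi / 3) * s0 lam)
      =O[atTop] (fun lam => lam⁻¹ * s0 lam) := by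
  obtain ⟨M, hM0, hM⟩ := exists_taylor_bound ha
  set C : ℝ := M * 6 + (2 * ‖deriv a 0‖ + 19 * ‖a 0‖) * 72 + 12 * ‖a 0‖ * 1296 with hC
  have hC0 : 0 ≤ C := by positivity
  refine IsBigO.of_bound (C * √(6 * Real.pi) + ‖a 0‖ * √Real.pi) ?_
  filter_upwards [eventually_ge_atTop 1, eventually_ge_atTop (k ^ 2 * q)] with lam hl hl2
  have hl0 : 0 < lam := by linarith
  have hkc := continuous_ker k q lam
  have hac := ha.continuous
  have hph := continuous_phi
  have hps := continuous_psi
  set D : ℝ → ℂ := fun t => a t * ker k q lam t - a 0 * Real.exp (-(3 * lam) * t ^ 2)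
      - Real.exp (lam * phi t) * (t * deriv a 0 + I * ((lam + lamT k q lam) * psi t : ℝ) * a 0)
      with hD
  have hDbound : ‖∫ t in (-Real.pi)..Real.pi, D t‖ ≤ lam⁻¹ * C * √(Real.pi / (lam / 6)) := by
    apply norm_integral_le_gaussian (by positivity) (by positivity)
    intro t ht
    refine (norm_remainder_le hq hl hl2 ht (hM t ht)).trans ?_
    have hs : 0 ≤ lam * t ^ 2 := by positivity
    have p1 := pow_mul_exp_le 1 hs
    have p2 := pow_mul_exp_le 2 hs
    have p3 := pow_mul_exp_le 3 hs
    norm_num [Nat.factorial] at p1 p2 p3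
    rw [show -(lam / 6) * t ^ 2 = -(lam * t ^ 2 / 6) by ring, mul_assoc, mul_assoc lam⁻¹ C]
    refine mul_le_mul_of_nonneg_left ?_ (inv_pos.2 hl0).le
    have q1 := mul_le_mul_of_nonneg_left p1 hM0
    have q2 := mul_le_mul_of_nonneg_left p2
      (by positivity : 0 ≤ 2 * ‖deriv a 0‖ + 19 * ‖a 0‖)
    have q3 := mul_le_mul_of_nonneg_left p3 (by positivity : 0 ≤ 12 * ‖a 0‖)
    rw [hC]
    linarith
  have hodd : ∫ t in (-Real.pi)..Real.pi, (Real.exp (lam * phi t) : ℂ) *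
      (t * deriv a 0 + I * ((lam + lamT k q lam) * psi t : ℝ) * a 0) = 0 := by
    apply integral_eq_zero_of_odd
    intro t
    rw [phi_neg, psi_neg]
    push_cast
    ring
  have hDint : ∫ t in (-Real.pi)..Real.pi, D t = K k q a lam - a 0 *
      ((∫ t in (-Real.pi)..Real.pi, Real.exp (-(3 * lam) * t ^ 2) : ℝ) : ℂ) := by
    rw [hD, intervalIntegral.integral_sub, intervalIntegral.integral_sub, hodd, sub_zero,
      intervalIntegral.integral_const_mul, intervalIntegral.integral_ofReal, K]
    all_goals exact Continuous.intervalIntegrable (by fun_prop) _ _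
  have htail := gaussian_tail hl
  have hsq : √(Real.pi / (3 * lam)) = √(Real.pi / 3) * s0 lam := by
    rw [← sqrt_div_eq (by positivity)]; congr 1; field_simp
  have hid : K k q a lam - a 0 * √(Real.pi / 3) * s0 lam = (∫ t in (-Real.pi)..Real.pi, D t)
      - a 0 * ((√(Real.pi / (3 * lam))
        - ∫ t in (-Real.pi)..Real.pi, Real.exp (-(3 * lam) * t ^ 2) : ℝ) : ℂ) := by
    rw [hDint, hsq]; push_cast; ring
  rw [show Real.pi / (lam / 6) = 6 * Real.pi / lam by field_simp,
    sqrt_div_eq (by positivity)] at hDbound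
  rw [sqrt_div_eq (lam := lam) Real.pi_pos.le] at htail
  rw [hid, Real.norm_of_nonneg (by unfold s0; positivity)]
  refine (norm_sub_le _ _).trans ?_
  rw [norm_mul, Complex.norm_real, Real.norm_eq_abs]
  have := mul_le_mul_of_nonneg_left htail (norm_nonneg (a 0))
  linarith

/-- Partial derivative in the first variable. -/
def D1 (F : ℂ × ℂ → ℂ) (p : ℂ × ℂ) : ℂ := fderiv ℂ F p (1, 0)

/-- Partial derivative in the second variable. -/
def D2 (F : ℂ × ℂ → ℂ) (p : ℂ × ℂ) : ℂ := fderiv ℂ F p (0, 1)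

/-- Restriction of a function to the deltoid. -/
def crv (F : ℂ × ℂ → ℂ) (t : ℝ) : ℂ := F (delt1 t, delt2 t)

variable {F : ℂ × ℂ → ℂ} {Ω : Set (ℂ × ℂ)}

lemma analytic_D1 (hF : AnalyticOnNhd ℂ F Ω) : AnalyticOnNhd ℂ (D1 F) Ω := fun p hp =>
  ((ContinuousLinearMap.apply ℂ ℂ ((1, 0) : ℂ × ℂ)).analyticAt _).comp (hF p hp).fderiv

lemma analytic_D2 (hF : AnalyticOnNhd ℂ F Ω) : AnalyticOnNhd ℂ (D2 F) Ω := fun p hp =>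
  ((ContinuousLinearMap.apply ℂ ℂ ((0, 1) : ℂ × ℂ)).analyticAt _).comp (hF p hp).fderiv

lemma deriv_fst {p : ℂ × ℂ} (hF : AnalyticAt ℂ F p) :
    deriv (fun z => F (z, p.2)) p.1 = D1 F p := by
  have h : HasDerivAt (fun z : ℂ => (z, p.2)) ((1, 0) : ℂ × ℂ) p.1 :=
    (hasDerivAt_id _).prodMk (hasDerivAt_const _ _)
  exact (HasFDerivAt.comp_hasDerivAt p.1 (f := fun z : ℂ => (z, p.2))
    hF.differentiableAt.hasFDerivAt h).deriv

lemma deriv_snd {p : ℂ × ℂ} (hF : AnalyticAt ℂ F p) :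
    deriv (fun w => F (p.1, w)) p.2 = D2 F p := by
  have h : HasDerivAt (fun w : ℂ => (p.1, w)) ((0, 1) : ℂ × ℂ) p.2 :=
    (hasDerivAt_const _ _).prodMk (hasDerivAt_id _)
  exact (HasFDerivAt.comp_hasDerivAt p.2 (f := fun w : ℂ => (p.1, w))
    hF.differentiableAt.hasFDerivAt h).deriv

lemma D1_D2_comm (hF : AnalyticOnNhd ℂ F Ω) {p : ℂ × ℂ} (hp : p ∈ Ω) :
    D1 (D2 F) p = D2 (D1 F) p := by
  have hd := (hF p hp).fderiv.differentiableAt.hasFDerivAt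
  have hs : IsSymmSndFDerivAt ℂ F p :=
    ((hF p hp).contDiffAt (n := 2)).isSymmSndFDerivAt (by simp)
  have h1 : fderiv ℂ (D1 F) p = (ContinuousLinearMap.apply ℂ ℂ ((1, 0) : ℂ × ℂ)).comp
      (fderiv ℂ (fderiv ℂ F) p) :=
    ((ContinuousLinearMap.apply ℂ ℂ ((1, 0) : ℂ × ℂ)).hasFDerivAt.comp p hd).fderiv
  have h2 : fderiv ℂ (D2 F) p = (ContinuousLinearMap.apply ℂ ℂ ((0, 1) : ℂ × ℂ)).comp
      (fderiv ℂ (fderiv ℂ F) p) :=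
    ((ContinuousLinearMap.apply ℂ ℂ ((0, 1) : ℂ × ℂ)).hasFDerivAt.comp p hd).fderiv
  rw [D1, D2, h1, h2]
  exact hs _ _

/-- The operator `∂₁ - i ∂₂`. -/
def Dz (F : ℂ × ℂ → ℂ) (p : ℂ × ℂ) : ℂ := D1 F p - I * D2 F p

lemma analytic_Dz (hF : AnalyticOnNhd ℂ F Ω) : AnalyticOnNhd ℂ (Dz F) Ω := fun p hp =>
  (analytic_D1 hF p hp).sub (analyticAt_const.mul (analytic_D2 hF p hp))

lemma laplacian_factor (hF : AnalyticOnNhd ℂ F Ω) {p : ℂ × ℂ} (hp : p ∈ Ω) :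
    D1 (Dz F) p + I * D2 (Dz F) p = D1 (D1 F) p + D2 (D2 F) p := by
  have h1 := (analytic_D1 hF p hp).differentiableAt.hasFDerivAt
  have h2 := (analytic_D2 hF p hp).differentiableAt.hasFDerivAt
  have h3 : fderiv ℂ (Dz F) p = fderiv ℂ (D1 F) p - I • fderiv ℂ (D2 F) p :=
    (h1.sub (h2.const_mul I)).fderiv
  have e1 : D1 (Dz F) p = D1 (D1 F) p - I * D1 (D2 F) p := by
    simp [D1, h3]
  have e2 : D2 (Dz F) p = D2 (D1 F) p - I * D2 (D2 F) p := by
    simp [D2, h3]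
  rw [e1, e2, D1_D2_comm hF hp]
  linear_combination -D2 (D2 F) p * Complex.I_sq

lemma deltoid_mem (hΩR : ∀ p : ℝ × ℝ, ((p.1 : ℂ), (p.2 : ℂ)) ∈ Ω) (t : ℝ) :
    (delt1 t, delt2 t) ∈ Ω := by
  rw [x1_ofReal, x2_ofReal]
  exact hΩR (_, _)

lemma contDiff_crv (hΩR : ∀ p : ℝ × ℝ, ((p.1 : ℂ), (p.2 : ℂ)) ∈ Ω) (hF : AnalyticOnNhd ℂ F Ω) :
    ContDiff ℝ ⊤ (crv F) := by
  rw [contDiff_iff_contDiffAt]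
  intro t
  exact ContDiffAt.comp t (f := fun t : ℝ => (delt1 t, delt2 t))
    (((hF _ (deltoid_mem hΩR t)).contDiffAt (n := ⊤)).restrict_scalars ℝ)
    (contDiff_x1.prodMk contDiff_x2).contDiffAt

lemma hasDerivAt_crv (hΩR : ∀ p : ℝ × ℝ, ((p.1 : ℂ), (p.2 : ℂ)) ∈ Ω)
    (hF : AnalyticOnNhd ℂ F Ω) (t : ℝ) :
    HasDerivAt (crv F) (d1 t * crv (D1 F) t + d2 t * crv (D2 F) t) t := by
  have h := (hF _ (deltoid_mem hΩR t)).differentiableAt.hasFDerivAt.restrictScalars ℝ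
  have h' := h.comp_hasDerivAt t (f := fun t : ℝ => (delt1 t, delt2 t))
    ((hasDerivAt_x1 t).prodMk (hasDerivAt_x2 t))
  refine h'.congr_deriv ?_
  have e : ((d1 t, d2 t) : ℂ × ℂ) = d1 t • ((1, 0) : ℂ × ℂ) + d2 t • ((0, 1) : ℂ × ℂ) := by
    simp
  simp only [ContinuousLinearMap.coe_restrictScalars']
  rw [e, map_add, map_smul, map_smul]
  rfl

lemma crv_pi (F : ℂ × ℂ → ℂ) : crv F Real.pi = crv F (-Real.pi) := by
  unfold crv
  rw [x1_pi, x2_pi]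

/-- The derivative along the deltoid divided by the phase velocity. -/
def slope (F : ℂ × ℂ → ℂ) (t : ℝ) : ℂ :=
  (1 + exp (I * t)) / 2 * crv (D1 F) t + (1 - exp (I * t)) / (2 * I) * crv (D2 F) t

lemma contDiff_slope (hΩR : ∀ p : ℝ × ℝ, ((p.1 : ℂ), (p.2 : ℂ)) ∈ Ω) (hF : AnalyticOnNhd ℂ F Ω) :
    ContDiff ℝ ⊤ (slope F) := by
  have := contDiff_crv hΩR (analytic_D1 hF)
  have := contDiff_crv hΩR (analytic_D2 hF)
  have := contDiff_expI
  unfold slope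
  fun_prop

lemma slope_pi (F : ℂ × ℂ → ℂ) : slope F Real.pi = slope F (-Real.pi) := by
  have := expI_pi
  unfold slope
  rw [crv_pi, crv_pi, this]

lemma hasDerivAt_crv_slope (hΩR : ∀ p : ℝ × ℝ, ((p.1 : ℂ), (p.2 : ℂ)) ∈ Ω)
    (hF : AnalyticOnNhd ℂ F Ω) (t : ℝ) : HasDerivAt (crv F) (G t * slope F t) t :=
  (hasDerivAt_crv hΩR hF t).congr_deriv (by unfold d1 d2 slope; ring)

/-- Amplitudes multiplied by the derivative of the second coordinate gain one power of `λ`. -/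
lemma K_d2_crv_isBigO {k q : ℝ} (hq : 0 < q)
    (hΩR : ∀ p : ℝ × ℝ, ((p.1 : ℂ), (p.2 : ℂ)) ∈ Ω) (hF : AnalyticOnNhd ℂ F Ω) :
    K k q (fun t => d2 t * crv F t) =O[atTop] (fun lam => lam⁻¹ * s0 lam) := by
  have h1 := contDiff_crv hΩR hF
  have h2 := contDiff_expI
  have h := K_G_mul_isBigO (k := k) hq (a := fun t => (1 - exp (I * t)) / (2 * I) * crv F t)
    ((by fun_prop : ContDiff ℝ ⊤ _).of_le le_top) (by
      have := expI_pi
      simp only [crv_pi, this])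
  simpa only [d2, mul_assoc] using h

/-- Amplitudes constant to first order at every critical point gain two powers of `λ`. -/
lemma K_G_crv_isBigO {k q : ℝ} (hq : 0 < q)
    (hΩR : ∀ p : ℝ × ℝ, ((p.1 : ℂ), (p.2 : ℂ)) ∈ Ω) (hF : AnalyticOnNhd ℂ F Ω) :
    K k q (fun t => G t * crv F t) =O[atTop] (fun lam => lam⁻¹ ^ 2 * s0 lam) := by
  have h1 := K_G_mul_isBigO (k := k) hq ((contDiff_slope hΩR hF).of_le le_top) (slope_pi F)
  have h2 := ((lamT_isBigO (k := k) hq).trans inv_isBigO_one).const_mul_left I |>.mul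
    (K_d2_crv_isBigO (k := k) hq hΩR hF)
  simp only [one_mul] at h2
  have h3 := inv_isBigO.neg_left.mul (h1.add h2)
  refine h3.congr' ?_ (Eventually.of_forall fun lam => by ring)
  filter_upwards [eventually_gt_atTop 0] with lam hl
  refine (K_G_mul k q hl.ne' (hasDerivAt_crv_slope hΩR hF) ?_ (crv_pi F)).symm
  exact contDiff_G.continuous.mul (contDiff_slope hΩR hF).continuous

lemma hasDerivAt_expI (t : ℝ) : HasDerivAt (fun t : ℝ => exp (I * t)) (I * exp (I * t)) t := by
  have h4 : HasDerivAt (fun x : ℝ => (x : ℂ)) 1 t := Complex.ofRealCLM.hasDerivAt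
  exact (h4.const_mul I).cexp.congr_deriv (by ring)

/-- Asymptotics of the integral with the conjugate phase velocity. -/
lemma K_conj_leading {k q : ℝ} (hq : 0 < q)
    (hΩR : ∀ p : ℝ × ℝ, ((p.1 : ℂ), (p.2 : ℂ)) ∈ Ω) (hF : AnalyticOnNhd ℂ F Ω) :
    (fun lam : ℝ => K k q (fun t => G t * (exp (I * t) * crv F t)) lam
      + (lam : ℂ)⁻¹ * (I * crv F 0 * √(Real.pi / 3) * s0 lam))
      =O[atTop] (fun lam => lam⁻¹ ^ 2 * s0 lam) := by
  have hc := contDiff_crv hΩR hF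
  have hs := contDiff_slope hΩR hF
  have he := contDiff_expI
  have hG := contDiff_G
  have hd2 := contDiff_d2
  have hepi := expI_pi
  have h1 := K_leading (k := k) hq (a := fun t => exp (I * t) * crv F t)
    ((by fun_prop : ContDiff ℝ ⊤ _).of_le le_top)
  have h2 := K_G_mul_isBigO (k := k) hq (a := fun t => exp (I * t) * slope F t)
    ((by fun_prop : ContDiff ℝ ⊤ _).of_le le_top) (by simp only [slope_pi, hepi])
  have h3 := K_G_mul_isBigO (k := k) hq
    (a := fun t => (1 - exp (I * t)) / (2 * I) * (exp (I * t) * crv F t))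
    ((by fun_prop : ContDiff ℝ ⊤ _).of_le le_top) (by simp only [crv_pi, hepi])
  have h4 := ((lamT_isBigO (k := k) hq).trans inv_isBigO_one).const_mul_left I |>.mul h3
  simp only [one_mul] at h4
  have h5 := inv_isBigO.neg_left.mul (((h1.const_mul_left I).add h2).add h4)
  refine h5.congr' ?_ (Eventually.of_forall fun lam => by ring)
  filter_upwards [eventually_gt_atTop 0] with lam hl
  have hK := K_G_mul k q hl.ne' (a := fun t => exp (I * t) * crv F t)
    (a' := fun t => I * (exp (I * t) * crv F t) + G t * (exp (I * t) * slope F t))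
    (fun t => ((hasDerivAt_expI t).mul (hasDerivAt_crv_slope hΩR hF t)).congr_deriv (by ring))
    (by have := hc.continuous; have := hs.continuous; have := he.continuous
        have := hG.continuous; fun_prop)
    (by simp only [crv_pi, hepi])
  rw [hK, K_add, K_const_mul]
  · have hd : (fun t => d2 t * (exp (I * t) * crv F t))
        = fun t => G t * ((1 - exp (I * t)) / (2 * I) * (exp (I * t) * crv F t)) := by
      ext t; unfold d2; ring
    rw [hd]
    simp only [Complex.ofReal_zero, mul_zero, Complex.exp_zero, one_mul]
    ring
  · have := hc.continuous; have := he.continuous; fun_prop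
  · have := hs.continuous; have := he.continuous; have := hG.continuous; fun_prop

lemma bdryI_eq {k q : ℝ} {U : ℂ → ℂ → ℂ}
    (hΩR : ∀ p : ℝ × ℝ, ((p.1 : ℂ), (p.2 : ℂ)) ∈ Ω)
    (hU : AnalyticOnNhd ℂ (fun p : ℂ × ℂ => U p.1 p.2) Ω) (lam : ℝ) :
    (Real.exp (-3 * lam) : ℂ) * bdryI k q delt1 delt2 U lam
      = -I * K k q (fun t => G t * crv (Dz fun p => U p.1 p.2) t) lam
        + I * lamT k q lam * K k q (fun t => G t * (exp (I * t) * crv (fun p => U p.1 p.2) t)) lam := by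
  set F : ℂ × ℂ → ℂ := fun p => U p.1 p.2 with hF
  have hc := (contDiff_crv hΩR hU).continuous
  have hz := (contDiff_crv hΩR (analytic_Dz hU)).continuous
  have h1 := (contDiff_crv hΩR (analytic_D1 hU)).continuous
  have h2 := (contDiff_crv hΩR (analytic_D2 hU)).continuous
  have he := contDiff_expI.continuous
  have hG := contDiff_G.continuous
  have hd1 := contDiff_d1.continuous
  have hd2 := contDiff_d2.continuous
  have hker := continuous_ker k q lam
  have htot := K_total_deriv k q lam (a := fun t => I * crv F t)
    (fun t => (hasDerivAt_crv hΩR hU t).const_mul I) (by fun_prop) (by simp only [crv_pi])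
  rw [← K_const_mul, ← K_const_mul, ← K_add k q lam (by fun_prop) (by fun_prop),
    ← zero_add (K k q _ lam), ← htot, K, ← intervalIntegral.integral_add, bdryI,
    ← intervalIntegral.integral_const_mul]
  · congr 1
    ext t
    have hP1 : P1 U (delt1 t) (delt2 t) = crv (D1 F) t := deriv_fst (hU _ (deltoid_mem hΩR t))
    have hP2 : P2 U (delt1 t) (delt2 t) = crv (D2 F) t := deriv_snd (hU _ (deltoid_mem hΩR t))
    have hx1 : deriv delt1 t = d1 t := by rw [d1_eq]; exact (hasDerivAt_delt1 t).deriv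
    have hx2 : deriv delt2 t = d2 t := by rw [d2_eq]; exact (hasDerivAt_delt2 t).deriv
    have hg : deriv (gC delt1 delt2) t = G t := by
      rw [G_eq, d1_eq, d2_eq]
      exact ((hasDerivAt_delt1 t).add ((hasDerivAt_delt2 t).const_mul I)).deriv
    have hk : ker k q lam t = (Real.exp (-3 * lam) : ℂ)
        * exp (lam * gC delt1 delt2 t + I * lamT k q lam * delt2 t) := by
      rw [ker, Complex.ofReal_exp, ← Complex.exp_add]
      congr 1
      push_cast
      ring
    have hDz : crv (Dz F) t = crv (D1 F) t - I * crv (D2 F) t := rfl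
    have hv : U (delt1 t) (delt2 t) = crv F t := rfl
    unfold bdryIntegrand
    rw [hP1, hP2, hx1, hx2, hg, hk, hDz, hv]
    have hcj := conj_G_eq t
    have hI := Complex.I_sq
    rw [show G t * (exp (I * t) * crv F t) = (d1 t - I * d2 t) * crv F t by rw [← hcj]; ring, G_eq]
    linear_combination (Real.exp (-3 * lam) : ℂ)
        * exp (lam * gC delt1 delt2 t + I * lamT k q lam * delt2 t) * (d2 t * crv (D1 F) t
          - d1 t * crv (D2 F) t - I * d2 t * crv (D2 F) t) * hI
  all_goals exact Continuous.intervalIntegrable (by fun_prop) _ _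

lemma K_G_Dz {k q : ℝ} (hΩR : ∀ p : ℝ × ℝ, ((p.1 : ℂ), (p.2 : ℂ)) ∈ Ω)
    (hF : AnalyticOnNhd ℂ F Ω)
    (hH : ∀ p ∈ Ω, D1 (D1 F) p + D2 (D2 F) p + (k : ℂ) ^ 2 * F p = 0) {lam : ℝ} (hl : lam ≠ 0) :
    K k q (fun t => G t * crv (Dz F) t) lam = -(lam : ℂ)⁻¹ *
      (1 / 2 * K k q (fun t => G t * crv (Dz (Dz F)) t) lam
        - (k : ℂ) ^ 2 / 2 * K k q (fun t => G t * (exp (I * t) * crv F t)) lam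
        + I * lamT k q lam * K k q (fun t => d2 t * crv (Dz F) t) lam) := by
  have hz := analytic_Dz hF
  have hc := (contDiff_crv hΩR hF).continuous
  have hzz := (contDiff_crv hΩR (analytic_Dz hz)).continuous
  have he := contDiff_expI.continuous
  have hG := contDiff_G.continuous
  rw [K_G_mul k q hl (a' := fun t => 1 / 2 * (G t * crv (Dz (Dz F)) t)
    + -((k : ℂ) ^ 2 / 2) * (G t * (exp (I * t) * crv F t))) _ (by fun_prop) (crv_pi _),
    K_add k q lam (by fun_prop) (by fun_prop), K_const_mul, K_const_mul]
  · ring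
  · intro t
    refine (hasDerivAt_crv hΩR hz t).congr_deriv ?_
    have hm := deltoid_mem hΩR t
    have h1 := laplacian_factor hF hm
    have h2 := hH _ hm
    rw [show G t * (exp (I * t) * crv F t) = (d1 t - I * d2 t) * crv F t by
      rw [← conj_G_eq]; ring, G_eq]
    simp only [crv, Dz.eq_1 (Dz F)] at *
    linear_combination (d1 t - I * d2 t) / 2 * (h1 + h2)
      + d2 t * D2 (Dz F) (delt1 t, delt2 t) * Complex.I_sq

lemma lamT_sub_isBigO {k q : ℝ} (hq : 0 < q) :
    (fun lam : ℝ => ((lamT k q lam : ℂ) - (k : ℂ) ^ 2 * q / 2 * (lam : ℂ)⁻¹))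
      =O[atTop] (fun lam : ℝ => lam⁻¹ ^ 2) := by
  refine IsBigO.of_bound ((k ^ 2 * q) ^ 2) ?_
  filter_upwards [eventually_ge_atTop 1] with lam hl
  have e : (lamT k q lam : ℂ) - (k : ℂ) ^ 2 * q / 2 * (lam : ℂ)⁻¹
      = ((lamT k q lam - k ^ 2 * q / (2 * lam) : ℝ) : ℂ) := by
    push_cast
    rw [div_mul_eq_div_div, div_eq_mul_inv _ (lam : ℂ)]
  rw [e, Complex.norm_real, Real.norm_eq_abs, Real.norm_of_nonneg (by positivity)]
  exact lamT_sub_le hq hl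

/-- The second-order steepest-descent expansion of the boundary functional at the cusp. -/
lemma bdryI_expansion {k q : ℝ} (hq : 0 < q) {U : ℂ → ℂ → ℂ}
    (hΩR : ∀ p : ℝ × ℝ, ((p.1 : ℂ), (p.2 : ℂ)) ∈ Ω)
    (hU : AnalyticOnNhd ℂ (fun p : ℂ × ℂ => U p.1 p.2) Ω)
    (hH : ∀ p ∈ Ω, D1 (D1 fun p => U p.1 p.2) p + D2 (D2 fun p => U p.1 p.2) p
      + (k : ℂ) ^ 2 * U p.1 p.2 = 0) :
    (fun lam : ℝ => (Real.exp (-3 * lam) : ℂ) * bdryI k q delt1 delt2 U lam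
      - (k : ℂ) ^ 2 * (q - 1) / 2 * √(Real.pi / 3) * U 3 0 * ((lam : ℂ)⁻¹ ^ 2 * s0 lam))
      =O[atTop] (fun lam => lam⁻¹ ^ 3 * s0 lam) := by
  have hv : crv (fun p => U p.1 p.2) 0 = U 3 0 := by
    simp only [crv, delt1, delt2, Complex.ofReal_zero, mul_zero, Complex.cos_zero,
      Complex.sin_zero]
    norm_num
  have hE := contDiff_expI
  have hA := K_G_crv_isBigO (k := k) hq hΩR (analytic_Dz (analytic_Dz hU))
  have hB := K_d2_crv_isBigO (k := k) hq hΩR (analytic_Dz hU)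
  have hC := K_conj_leading (k := k) hq hΩR hU
  have hC' := K_G_mul_isBigO (k := k) hq (a := fun t => exp (I * t) * crv (fun p => U p.1 p.2) t)
    ((hE.mul (contDiff_crv hΩR hU)).of_le le_top) (by simp only [crv_pi, expI_pi])
  have t1 := (inv_isBigO.mul hA).const_mul_left (I / 2)
  have t2 := (inv_isBigO.mul hC).const_mul_left (I * ((k : ℂ) ^ 2 * (q - 1) / 2))
  have t3 := ((lamT_sub_isBigO (k := k) hq).mul hC').const_mul_left I
  have t4 := ((lamT_isBigO (k := k) hq).mul (inv_isBigO.mul hB)).neg_left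
  have t1' := t1.congr_right (g₂ := fun lam => lam⁻¹ ^ 3 * s0 lam) fun lam => by ring
  have t2' := t2.congr_right (g₂ := fun lam => lam⁻¹ ^ 3 * s0 lam) fun lam => by ring
  have t3' := t3.congr_right (g₂ := fun lam => lam⁻¹ ^ 3 * s0 lam) fun lam => by ring
  have t4' := t4.congr_right (g₂ := fun lam => lam⁻¹ ^ 3 * s0 lam) fun lam => by ring
  refine (((t1'.add t2').add t3').add t4').congr' ?_ EventuallyEq.rfl
  filter_upwards [eventually_gt_atTop 0] with lam hl
  rw [bdryI_eq hΩR hU, K_G_Dz hΩR hU hH hl.ne', hv]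
  linear_combination ((k : ℂ) ^ 2 * (q - 1) / 2 * √(Real.pi / 3) * U 3 0 * ((lam : ℂ)⁻¹ ^ 2 * s0 lam)
    - lamT k q lam * (lam : ℂ)⁻¹ * K k q (fun t => d2 t * crv (Dz fun p => U p.1 p.2) t) lam)
    * Complex.I_sq

lemma helmholtz_D {k : ℝ} {U : ℂ → ℂ → ℂ} (hΩ : IsOpen Ω)
    (hU : AnalyticOnNhd ℂ (fun p : ℂ × ℂ => U p.1 p.2) Ω)
    (hHelm : ∀ p ∈ Ω, P1 (P1 U) p.1 p.2 + P2 (P2 U) p.1 p.2 + (k : ℂ) ^ 2 * U p.1 p.2 = 0) :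
    ∀ p ∈ Ω, D1 (D1 fun p => U p.1 p.2) p + D2 (D2 fun p => U p.1 p.2) p
      + (k : ℂ) ^ 2 * U p.1 p.2 = 0 := by
  intro p hp
  have hn := hΩ.mem_nhds hp
  have c1 : ContinuousAt (fun z : ℂ => (z, p.2)) p.1 := by fun_prop
  have c2 : ContinuousAt (fun w : ℂ => (p.1, w)) p.2 := by fun_prop
  have h1 : P1 (P1 U) p.1 p.2 = D1 (D1 fun p => U p.1 p.2) p := by
    rw [← deriv_fst (analytic_D1 hU p hp)]
    apply Filter.EventuallyEq.deriv_eq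
    filter_upwards [c1.preimage_mem_nhds hn] with z hz
    exact deriv_fst (hU _ hz)
  have h2 : P2 (P2 U) p.1 p.2 = D2 (D2 fun p => U p.1 p.2) p := by
    rw [← deriv_snd (analytic_D2 hU p hp)]
    apply Filter.EventuallyEq.deriv_eq
    filter_upwards [c2.preimage_mem_nhds hn] with z hz
    exact deriv_snd (hU _ hz)
  rw [← h1, ← h2]
  exact hHelm p hp

lemma rpow_five_half {lam : ℝ} (hl : 0 < lam) : lam ^ ((5 : ℝ) / 2) * (lam⁻¹ ^ 2 * s0 lam) = 1 := by
  have h : lam ^ ((5 : ℝ) / 2) = lam ^ 2 * √lam := by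
    rw [Real.sqrt_eq_rpow, ← Real.rpow_natCast, ← Real.rpow_add hl]
    norm_num
  have hs : √lam ≠ 0 := (Real.sqrt_pos.2 hl).ne'
  rw [h, s0]
  field_simp

end Deltoid

open Deltoid in
theorem stmt11
    (k q : ℝ) (hk : 0 < k) (hq : 0 < q)
    (U : ℂ → ℂ → ℂ) (Ω : Set (ℂ × ℂ)) (hΩ : IsOpen Ω)
    (hΩR : ∀ p : ℝ × ℝ, ((p.1 : ℂ), (p.2 : ℂ)) ∈ Ω)
    (hUan : ∀ p ∈ Ω, AnalyticAt ℂ (fun p : ℂ × ℂ => U p.1 p.2) p)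
    (hHelm : ∀ p ∈ Ω, P1 (P1 U) p.1 p.2 + P2 (P2 U) p.1 p.2 + (k : ℂ) ^ 2 * U p.1 p.2 = 0) :
    ((fun lam : ℝ => ((lam ^ ((5:ℝ)/2) : ℝ) : ℂ) * ((Real.exp (-3 * lam) : ℝ) : ℂ)
        * bdryI k q delt1 delt2 U lam
        - ((Real.sqrt (Real.pi / 12) : ℝ) : ℂ) * (k : ℂ) ^ 2 * ((q : ℂ) - 1) * U 3 0)
      =O[atTop] (fun lam : ℝ => 1 / lam)) ∧
    (q ≠ 1 → U 3 0 ≠ 0 → ∃ lam : ℝ, 0 < lam ∧ bdryI k q delt1 delt2 U lam ≠ 0) := by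
  have hU : AnalyticOnNhd ℂ (fun p : ℂ × ℂ => U p.1 p.2) Ω := hUan
  have hO : (fun lam : ℝ => ((lam ^ ((5:ℝ)/2) : ℝ) : ℂ) * ((Real.exp (-3 * lam) : ℝ) : ℂ)
        * bdryI k q delt1 delt2 U lam
        - ((Real.sqrt (Real.pi / 12) : ℝ) : ℂ) * (k : ℂ) ^ 2 * ((q : ℂ) - 1) * U 3 0)
      =O[atTop] (fun lam : ℝ => 1 / lam) := by
    have h := bdryI_expansion hq hΩR hU (helmholtz_D hΩ hU hHelm)
    have hp : (fun lam : ℝ => ((lam ^ ((5:ℝ)/2) : ℝ) : ℂ))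
        =O[atTop] (fun lam : ℝ => lam ^ ((5:ℝ)/2)) :=
      IsBigO.of_bound 1 (Eventually.of_forall fun lam => by rw [Complex.norm_real, one_mul])
    have hsq : √(Real.pi / 3) / 2 = √(Real.pi / 12) := by
      rw [show Real.pi / 3 = 2 ^ 2 * (Real.pi / 12) by ring, Real.sqrt_mul (by norm_num),
        Real.sqrt_sq (by norm_num)]
      ring
    refine (hp.mul h).congr' ?_ ?_
    · filter_upwards [eventually_gt_atTop 0] with lam hl
      have h1 : ((lam ^ ((5:ℝ)/2) : ℝ) : ℂ) * ((lam : ℂ)⁻¹ ^ 2 * s0 lam) = 1 := by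
        exact_mod_cast rpow_five_half hl
      rw [← hsq]
      push_cast
      linear_combination (-(k : ℂ) ^ 2 * (q - 1) / 2 * √(Real.pi / 3) * U 3 0) * h1
    · filter_upwards [eventually_gt_atTop 0] with lam hl
      rw [one_div]
      linear_combination lam⁻¹ * rpow_five_half hl
  refine ⟨hO, fun hq1 hU0 => ?_⟩
  by_contra! hcon
  have ht := hO.trans_tendsto (tendsto_const_nhds.div_atTop tendsto_id)
  have ht' : Tendsto (fun _ : ℝ => -(((Real.sqrt (Real.pi / 12) : ℝ) : ℂ) * (k : ℂ) ^ 2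
      * ((q : ℂ) - 1) * U 3 0)) atTop (nhds 0) := by
    refine ht.congr' ?_
    filter_upwards [eventually_gt_atTop 0] with lam hl
    rw [hcon lam hl, mul_zero, zero_sub]
  have h0 := neg_eq_zero.1 (tendsto_nhds_unique tendsto_const_nhds ht')
  have hs : ((Real.sqrt (Real.pi / 12) : ℝ) : ℂ) ≠ 0 := by
    exact_mod_cast (Real.sqrt_pos.2 (by positivity)).ne'
  have hk' : (k : ℂ) ≠ 0 := by exact_mod_cast hk.ne'
  have hq' : (q : ℂ) - 1 ≠ 0 := sub_ne_zero.2 (by exact_mod_cast hq1)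
  exact mul_ne_zero (mul_ne_zero (mul_ne_zero hs (pow_ne_zero 2 hk')) hq') hU0 h0
end
end

section
/- Let k > 0 and q > 0 with q ≠ 1, let θ ∈ (0, π/2) and set m = tan θ. Let D ⊂ ℝ² be a bounded measurable set with D ⊆ {x : x₁ < 0}, and suppose there exists ε > 0 such that D ∩ {x : x₁ > −ε} = { x : −ε < x₁ < 0 and |x₂| < −m·x₁ } (so D has a straight-sided corner of opening angle 2θ at the origin, bisected by the x₁-axis, and the rest of D lies in {x₁ ≤ −ε}). Let u : ℝ² → ℂ be smooth with Δu + k²·u = 0 on ℝ². Then, as λ → ∞, k²·(q−1)·∫_D u(x₁,x₂)·exp( λ·x₁ + i·√(λ²+k²q)·x₂ ) dx = C/λ² + O(λ^{−3}), where C = 2·k²·(tan θ/(1 + tan²θ))·(q−1)·u(0,0). In particular, if u(0,0) ≠ 0, then ∫_D u(x)·exp(λx₁ + i√(λ²+k²q)x₂) dx ≠ 0 for some λ > 0 (so u is scattered by D with constant refractive index q). -/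
open Complex MeasureTheory Filter Asymptotics

noncomputable section

/-- Partial derivative in the first (real) variable. -/
def rP1 (u : ℝ → ℝ → ℂ) : ℝ → ℝ → ℂ := fun x y => deriv (fun x' => u x' y) x

/-- Partial derivative in the second (real) variable. -/
def rP2 (u : ℝ → ℝ → ℂ) : ℝ → ℝ → ℂ := fun x y => deriv (fun y' => u x y') y

/-- The infinite sector with apex at the origin, opening to the left, with sides of slope `∓L`. -/
def leftSector (L : ℝ) : Set (ℝ × ℝ) := {p | |p.2| < -L * p.1}

lemma measurableSet_leftSector (L : ℝ) : MeasurableSet (leftSector L) :=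
  (isOpen_lt (by fun_prop) (by fun_prop)).measurableSet

lemma fst_neg_of_mem_leftSector {L : ℝ} (hL : 0 < L) {p : ℝ × ℝ} (hp : p ∈ leftSector L) :
    p.1 < 0 := by
  have h : |p.2| < -L * p.1 := hp
  nlinarith [abs_nonneg p.2]

lemma mem_leftSector_iff_mem_Ioo {L x y : ℝ} :
    (x, y) ∈ leftSector L ↔ y ∈ Set.Ioo (L * x) (-(L * x)) := by
  simp [leftSector, abs_lt]

lemma indicator_leftSector_section {E : Type*} [Zero E] (L x : ℝ) (F : ℝ × ℝ → E) :
    (fun y => (leftSector L).indicator F (x, y)) =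
      (Set.Ioo (L * x) (-(L * x))).indicator (fun y => F (x, y)) := by
  classical
  funext y
  simp only [Set.indicator_apply, mem_leftSector_iff_mem_Ioo]

lemma integral_indicator_leftSector_section {E : Type*} [NormedAddCommGroup E] [NormedSpace ℝ E]
    (L x : ℝ) (F : ℝ × ℝ → E) :
    ∫ y, (leftSector L).indicator F (x, y) = ∫ y in Set.Ioo (L * x) (-(L * x)), F (x, y) := by
  rw [indicator_leftSector_section, integral_indicator measurableSet_Ioo]

/-- The section over `x` has length `2 L |x|` if `x ≤ 0` and is empty otherwise. -/
lemma setIntegral_const_leftSector_section {L : ℝ} (hL : 0 < L) (c : ℝ → ℝ) (x : ℝ) :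
    ∫ _ in Set.Ioo (L * x) (-(L * x)), c x =
      (Set.Iic (0 : ℝ)).indicator (fun x => 2 * L * (-x * c x)) x := by
  rw [setIntegral_const, measureReal_def, Real.volume_Ioo]
  by_cases hx : x ≤ 0
  · rw [Set.indicator_of_mem (by simpa using hx), ENNReal.toReal_ofReal (by nlinarith),
      smul_eq_mul]
    ring
  · rw [Set.indicator_of_notMem (by simpa using hx), ENNReal.ofReal_of_nonpos (by nlinarith)]
    simp

lemma integrableOn_leftSector {E : Type*} [NormedAddCommGroup E] {L : ℝ} (hL : 0 < L)
    {F : ℝ × ℝ → E} (hF : Continuous F) {h : ℝ → ℝ} (hnorm : ∀ p, ‖F p‖ = h p.1)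
    (hint : IntegrableOn (fun x => -x * h x) (Set.Iic 0)) :
    IntegrableOn F (leftSector L) := by
  rw [← integrable_indicator_iff (measurableSet_leftSector L)]
  have hsm : AEStronglyMeasurable ((leftSector L).indicator F)
      ((volume : Measure ℝ).prod (volume : Measure ℝ)) :=
    (aestronglyMeasurable_indicator_iff (measurableSet_leftSector L)).2
      hF.aestronglyMeasurable
  refine (integrable_prod_iff hsm).2 ⟨ae_of_all _ fun x => ?_, ?_⟩
  · rw [indicator_leftSector_section, integrable_indicator_iff measurableSet_Ioo]
    exact (Continuous.integrableOn_Icc (by fun_prop)).mono_set Set.Ioo_subset_Icc_self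
  · simp_rw [norm_indicator_eq_indicator_norm]
    simp_rw [integral_indicator_leftSector_section L _ fun p => ‖F p‖, hnorm,
      setIntegral_const_leftSector_section hL h]
    exact (integrable_indicator_iff measurableSet_Iic).2 (hint.const_mul _)

lemma setIntegral_leftSector {E : Type*} [NormedAddCommGroup E] [NormedSpace ℝ E]
    {L : ℝ} {F : ℝ × ℝ → E} (hF : IntegrableOn F (leftSector L)) :
    ∫ p in leftSector L, F p = ∫ x, ∫ y in Set.Ioo (L * x) (-(L * x)), F (x, y) := by
  rw [← integral_indicator (measurableSet_leftSector L), Measure.volume_eq_prod,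
    integral_prod _ ((integrable_indicator_iff (measurableSet_leftSector L)).2 hF)]
  simp_rw [integral_indicator_leftSector_section]

lemma integrableOn_neg_pow_mul_exp_Iic (n : ℕ) {lam : ℝ} (hlam : 0 < lam) :
    IntegrableOn (fun x : ℝ => (-x) ^ n * Real.exp (lam * x)) (Set.Iic 0) := by
  have h := integrableOn_rpow_mul_exp_neg_mul_rpow (p := 1) (s := n) (b := lam)
    (by linarith [n.cast_nonneg (α := ℝ)]) one_pos hlam
  simp only [Real.rpow_natCast, Real.rpow_one] at h
  rw [← integrableOn_Ici_iff_integrableOn_Ioi] at h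
  have h' : IntegrableOn (fun x : ℝ => (-x) ^ n * Real.exp (-lam * -x)) (Set.Iic 0) :=
    IntegrableOn.comp_neg_Iic (c := (0 : ℝ)) (by rwa [neg_zero])
  simpa only [neg_mul_neg] using h'

lemma integral_neg_sq_mul_exp_Iic {lam : ℝ} (hlam : 0 < lam) :
    ∫ x in Set.Iic (0 : ℝ), (-x) ^ 2 * Real.exp (lam * x) = 2 / lam ^ 3 := by
  have h := Real.integral_rpow_mul_exp_neg_mul_Ioi (a := 3) (r := lam) (by norm_num) hlam
  have hG : Real.Gamma 3 = 2 := by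
    simp [Nat.factorial]
  have h' := integral_comp_neg_Iic (0 : ℝ) (fun t : ℝ => t ^ 2 * Real.exp (-(lam * t)))
  simp only [mul_neg, neg_neg, neg_zero] at h'
  rw [h']
  have e : (3 : ℝ) - 1 = (2 : ℕ) := by norm_num
  have e3 : (3 : ℝ) = (3 : ℕ) := by norm_num
  rw [e, hG] at h
  simp only [Real.rpow_natCast] at h
  rw [h, e3, Real.rpow_natCast]
  field_simp

/-- The weight `|x₁| e^{λ x₁}` is integrable over the sector, with integral `4 L / λ³`. -/
lemma integrableOn_leftSector_abs_mul_exp {L lam : ℝ} (hL : 0 < L) (hlam : 0 < lam) :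
    IntegrableOn (fun p : ℝ × ℝ => |p.1| * Real.exp (lam * p.1)) (leftSector L) := by
  refine integrableOn_leftSector hL (by fun_prop) (h := fun x => |x| * Real.exp (lam * x))
    (fun p => by simp) ?_
  refine (integrableOn_neg_pow_mul_exp_Iic 2 hlam).congr_fun (fun x hx => ?_) measurableSet_Iic
  simp only [abs_of_nonpos (Set.mem_Iic.1 hx)]
  ring

lemma setIntegral_leftSector_abs_mul_exp {L lam : ℝ} (hL : 0 < L) (hlam : 0 < lam) :
    ∫ p in leftSector L, |p.1| * Real.exp (lam * p.1) = 4 * L / lam ^ 3 := by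
  rw [setIntegral_leftSector (integrableOn_leftSector_abs_mul_exp hL hlam)]
  simp_rw [setIntegral_const_leftSector_section hL fun x => |x| * Real.exp (lam * x)]
  rw [integral_indicator measurableSet_Iic, integral_const_mul]
  have : ∫ x in Set.Iic (0 : ℝ), -x * (|x| * Real.exp (lam * x)) =
      ∫ x in Set.Iic (0 : ℝ), (-x) ^ 2 * Real.exp (lam * x) := by
    refine setIntegral_congr_fun measurableSet_Iic fun x hx => ?_
    simp only [abs_of_nonpos (Set.mem_Iic.1 hx)]
    ring
  rw [this, integral_neg_sq_mul_exp_Iic hlam]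
  ring

lemma norm_exp_ofReal_add_I_mul (lam mu : ℝ) (p : ℝ × ℝ) :
    ‖Complex.exp ((lam : ℂ) * (p.1 : ℂ) + Complex.I * (mu : ℂ) * (p.2 : ℂ))‖ =
      Real.exp (lam * p.1) := by
  rw [Complex.norm_exp]
  simp

lemma integrableOn_leftSector_exp {L lam : ℝ} (hL : 0 < L) (hlam : 0 < lam) (mu : ℝ) :
    IntegrableOn (fun p : ℝ × ℝ =>
      Complex.exp ((lam : ℂ) * (p.1 : ℂ) + Complex.I * (mu : ℂ) * (p.2 : ℂ))) (leftSector L) := by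
  refine integrableOn_leftSector hL (by fun_prop) (h := fun x => Real.exp (lam * x))
    (norm_exp_ofReal_add_I_mul lam mu) ?_
  simpa using integrableOn_neg_pow_mul_exp_Iic 1 hlam

/-- The integral over a section, written as a combination of exponentials in `x`. -/
lemma setIntegral_exp_leftSector_section {L : ℝ} (hL : 0 < L) (lam : ℝ) {mu : ℝ} (hmu : mu ≠ 0)
    (x : ℝ) :
    ∫ y in Set.Ioo (L * x) (-(L * x)),
        Complex.exp ((lam : ℂ) * (x : ℂ) + Complex.I * (mu : ℂ) * (y : ℂ)) =
      (Set.Iic (0 : ℝ)).indicator (fun x : ℝ => (Complex.I * (mu : ℂ))⁻¹ *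
        (Complex.exp ((lam - Complex.I * mu * L) * x) -
          Complex.exp ((lam + Complex.I * mu * L) * x))) x := by
  by_cases hx : x ≤ 0
  · rw [Set.indicator_of_mem (by simpa using hx), ← integral_Ioc_eq_integral_Ioo,
      ← intervalIntegral.integral_of_le (by nlinarith)]
    simp_rw [Complex.exp_add]
    rw [intervalIntegral.integral_const_mul, integral_exp_mul_complex (by simpa using hmu),
      div_eq_inv_mul, mul_left_comm, mul_sub, ← Complex.exp_add, ← Complex.exp_add]
    congr 3 <;> push_cast <;> ring
  · rw [Set.indicator_of_notMem (by simpa using hx), Set.Ioo_eq_empty (by nlinarith)]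
    simp

lemma setIntegral_leftSector_exp {L lam mu : ℝ} (hL : 0 < L) (hlam : 0 < lam) (hmu : mu ≠ 0) :
    ∫ p in leftSector L, Complex.exp ((lam : ℂ) * (p.1 : ℂ) + Complex.I * (mu : ℂ) * (p.2 : ℂ)) =
      ((2 * L / (lam ^ 2 + mu ^ 2 * L ^ 2) : ℝ) : ℂ) := by
  have h₁ : 0 < ((lam : ℂ) - Complex.I * mu * L).re := by simpa using hlam
  have h₂ : 0 < ((lam : ℂ) + Complex.I * mu * L).re := by simpa using hlam
  rw [setIntegral_leftSector (integrableOn_leftSector_exp hL hlam mu)]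
  simp_rw [setIntegral_exp_leftSector_section hL lam hmu]
  rw [integral_indicator measurableSet_Iic, integral_const_mul,
    integral_sub (integrableOn_exp_mul_complex_Iic h₁ 0) (integrableOn_exp_mul_complex_Iic h₂ 0),
    integral_exp_mul_complex_Iic h₁, integral_exp_mul_complex_Iic h₂]
  have n₁ : (lam : ℂ) - Complex.I * mu * L ≠ 0 := fun h => by simp [h] at h₁
  have n₂ : (lam : ℂ) + Complex.I * mu * L ≠ 0 := fun h => by simp [h] at h₂
  have nmu : (mu : ℂ) ≠ 0 := by exact_mod_cast hmu
  have hprod : (lam : ℂ) ^ 2 + (mu : ℂ) ^ 2 * (L : ℂ) ^ 2 =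
      ((lam : ℂ) - Complex.I * mu * L) * ((lam : ℂ) + Complex.I * mu * L) := by
    linear_combination ((mu : ℂ) ^ 2 * (L : ℂ) ^ 2) * Complex.I_sq
  push_cast
  rw [hprod]
  simp only [mul_zero, Complex.exp_zero]
  field_simp
  ring

/-- A smooth density on `D` differs from its value at the corner, supported on the exact sector,
by at most a multiple of `|x₁|`, supported on a wider sector. -/
lemma exists_norm_indicator_sub_indicator_le {m : ℝ} (hm : 0 < m) {D : Set (ℝ × ℝ)}
    (hDbdd : Bornology.IsBounded D) (hDleft : D ⊆ {p : ℝ × ℝ | p.1 < 0})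
    {ε : ℝ} (hε : 0 < ε)
    (hcorner : D ∩ {p : ℝ × ℝ | -ε < p.1} =
      {p : ℝ × ℝ | -ε < p.1 ∧ p.1 < 0 ∧ |p.2| < -m * p.1})
    {f : ℝ × ℝ → ℂ} (hf : ContDiff ℝ 1 f) :
    ∃ K L : ℝ, 0 ≤ K ∧ 0 < L ∧ ∀ p : ℝ × ℝ,
      ‖D.indicator f p - (leftSector m).indicator (fun _ => f 0) p‖ ≤
        (leftSector L).indicator (fun p => K * |p.1|) p := by
  obtain ⟨R, hR, hDR⟩ := hDbdd.subset_closedBall_lt 0 (0 : ℝ × ℝ)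
  obtain ⟨C, hC⟩ := (hf.contDiffOn (s := Metric.closedBall 0 R)).exists_lipschitzOnWith one_ne_zero
    (convex_closedBall _ _) (isCompact_closedBall _ _)
  have hlip : ∀ p ∈ D, ‖f p - f 0‖ ≤ C * ‖p‖ := fun p hp => by
    simpa using hC.norm_sub_le (hDR hp) (Metric.mem_closedBall_self hR.le)
  have hnorm : ∀ p ∈ D, ‖p‖ ≤ R := fun p hp => by simpa using hDR hp
  have hC0 : (0 : ℝ) ≤ C := C.2
  obtain ⟨L, hLdef⟩ : ∃ L, L = m + R / ε + 1 := ⟨_, rfl⟩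
  have hRε : 0 < R / ε := by positivity
  have hL1 : 1 ≤ L := by linarith
  have hmL : m ≤ L := by linarith
  have hL : 0 < L := by linarith
  have hM : 0 ≤ (C * R + 2 * ‖f 0‖) / ε := by positivity
  have hsub : ∀ p ∈ leftSector m, p ∈ leftSector L := fun p hp => by
    have h0 := fst_neg_of_mem_leftSector hm hp
    have h : |p.2| < -m * p.1 := hp
    change |p.2| < -L * p.1
    nlinarith
  refine ⟨C * L + (C * R + 2 * ‖f 0‖) / ε, L, by positivity, hL, fun p => ?_⟩
  have hnonneg : 0 ≤ (leftSector L).indicator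
      (fun p : ℝ × ℝ => (C * L + (C * R + 2 * ‖f 0‖) / ε) * |p.1|) p :=
    Set.indicator_nonneg (fun p _ => by positivity) p
  by_cases hp : -ε < p.1
  · have hiff : p ∈ D ↔ p ∈ leftSector m := by
      have := Set.ext_iff.1 hcorner p
      simp only [Set.mem_inter_iff, Set.mem_ofPred_eq, hp, true_and, and_true] at this
      rw [this]
      exact ⟨fun h => h.2, fun h => ⟨fst_neg_of_mem_leftSector hm h, h⟩⟩
    by_cases hD : p ∈ D
    · have hpm := hiff.1 hD
      have hpL := hsub p hpm
      rw [Set.indicator_of_mem hD, Set.indicator_of_mem hpm, Set.indicator_of_mem hpL]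
      have h0 : p.1 < 0 := hDleft hD
      have h : |p.2| < -L * p.1 := hpL
      have hpn : ‖p‖ ≤ L * |p.1| := by
        rw [Prod.norm_def, Real.norm_eq_abs, Real.norm_eq_abs]
        refine max_le (le_mul_of_one_le_left (abs_nonneg _) hL1) ?_
        rw [abs_of_neg h0]
        linarith
      calc ‖f p - f 0‖ ≤ C * ‖p‖ := hlip p hD
        _ ≤ C * (L * |p.1|) := by gcongr
        _ ≤ _ := by nlinarith [mul_nonneg hM (abs_nonneg p.1)]
    · rw [Set.indicator_of_notMem hD, Set.indicator_of_notMem (fun h => hD (hiff.2 h))]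
      simpa using hnonneg
  · have hp' : p.1 ≤ -ε := not_lt.1 hp
    by_cases hDm : p ∈ D ∨ p ∈ leftSector m
    · have hpL : p ∈ leftSector L := by
        rcases hDm with hD | hpm
        · have h2 : |p.2| ≤ R := (norm_snd_le p).trans (hnorm p hD)
          change |p.2| < -L * p.1
          have : R = R / ε * ε := by field_simp
          nlinarith
        · exact hsub p hpm
      rw [Set.indicator_of_mem hpL]
      have hbD : ‖D.indicator f p‖ ≤ C * R + ‖f 0‖ := by
        by_cases hD : p ∈ D
        · rw [Set.indicator_of_mem hD]
          have h1 : ‖f p‖ ≤ ‖f p - f 0‖ + ‖f 0‖ := by simpa using norm_add_le (f p - f 0) (f 0)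
          have h2 := mul_le_mul_of_nonneg_left (hnorm p hD) hC0
          linarith [hlip p hD]
        · rw [Set.indicator_of_notMem hD, norm_zero]
          positivity
      have hbm : ‖(leftSector m).indicator (fun _ => f 0) p‖ ≤ ‖f 0‖ :=
        norm_indicator_le_norm_self _ _
      have hmul : C * R + 2 * ‖f 0‖ ≤ (C * R + 2 * ‖f 0‖) / ε * |p.1| := by
        rw [div_mul_eq_mul_div, le_div_iff₀ hε]
        gcongr
        rw [abs_of_nonpos (by linarith)]
        linarith
      refine (norm_sub_le _ _).trans ?_
      nlinarith [mul_nonneg (mul_nonneg hC0 hL.le) (abs_nonneg p.1)]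
    · rw [not_or] at hDm
      rw [Set.indicator_of_notMem hDm.1, Set.indicator_of_notMem hDm.2]
      simpa using hnonneg

lemma exists_norm_corner_integral_sub_le {m : ℝ} (hm : 0 < m) {D : Set (ℝ × ℝ)}
    (hDmeas : MeasurableSet D)
    (hDbdd : Bornology.IsBounded D) (hDleft : D ⊆ {p : ℝ × ℝ | p.1 < 0})
    {ε : ℝ} (hε : 0 < ε)
    (hcorner : D ∩ {p : ℝ × ℝ | -ε < p.1} =
      {p : ℝ × ℝ | -ε < p.1 ∧ p.1 < 0 ∧ |p.2| < -m * p.1})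
    {f : ℝ × ℝ → ℂ} (hf : ContDiff ℝ 1 f) :
    ∃ A : ℝ, ∀ lam mu : ℝ, 0 < lam → mu ≠ 0 →
      ‖(∫ p in D, f p *
          Complex.exp ((lam : ℂ) * (p.1 : ℂ) + Complex.I * (mu : ℂ) * (p.2 : ℂ))) -
        f 0 * ((2 * m / (lam ^ 2 + mu ^ 2 * m ^ 2) : ℝ) : ℂ)‖ ≤ A / lam ^ 3 := by
  obtain ⟨K, L, -, hL, hKL⟩ :=
    exists_norm_indicator_sub_indicator_le hm hDbdd hDleft hε hcorner hf
  refine ⟨K * (4 * L), fun lam mu hlam hmu => ?_⟩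
  obtain ⟨R, hDR⟩ := hDbdd.subset_closedBall (0 : ℝ × ℝ)
  set e : ℝ × ℝ → ℂ := fun p =>
    Complex.exp ((lam : ℂ) * (p.1 : ℂ) + Complex.I * (mu : ℂ) * (p.2 : ℂ)) with he
  have hcont : Continuous fun p => f p * e p := by
    have := hf.continuous
    fun_prop
  have hintD : IntegrableOn (fun p => f p * e p) D :=
    (hcont.continuousOn.integrableOn_compact (isCompact_closedBall _ _)).mono_set hDR
  have hintm : IntegrableOn (fun p => f 0 * e p) (leftSector m) :=
    (integrableOn_leftSector_exp hm hlam mu).const_mul _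
  have hmS := measurableSet_leftSector m
  have hLS := measurableSet_leftSector L
  rw [← setIntegral_leftSector_exp hm hlam hmu, ← integral_const_mul,
    ← integral_indicator hDmeas, ← integral_indicator hmS,
    ← integral_sub ((integrable_indicator_iff hDmeas).2 hintD)
      ((integrable_indicator_iff hmS).2 hintm)]
  calc _ ≤ ∫ p, (leftSector L).indicator (fun p => K * (|p.1| * Real.exp (lam * p.1))) p := by
        refine norm_integral_le_of_norm_le ((integrable_indicator_iff hLS).2
          ((integrableOn_leftSector_abs_mul_exp hL hlam).const_mul K)) (ae_of_all _ fun p => ?_)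
        have hfac : D.indicator (fun p => f p * e p) p -
            (leftSector m).indicator (fun p => f 0 * e p) p =
            (D.indicator f p - (leftSector m).indicator (fun _ => f 0) p) * e p := by
          rw [Set.indicator_mul_left, Set.indicator_mul_left, sub_mul]
        have hfacL : (leftSector L).indicator (fun p => K * (|p.1| * Real.exp (lam * p.1))) p =
            (leftSector L).indicator (fun p => K * |p.1|) p * Real.exp (lam * p.1) := by
          simp_rw [← mul_assoc]
          rw [Set.indicator_mul_left]
        rw [hfac, hfacL, norm_mul, norm_exp_ofReal_add_I_mul]
        exact mul_le_mul_of_nonneg_right (hKL p) (Real.exp_pos _).le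
    _ = K * (4 * L) / lam ^ 3 := by
        rw [integral_indicator hLS, integral_const_mul, setIntegral_leftSector_abs_mul_exp hL hlam]
        ring

lemma abs_sector_coefficient_sub_le {m b lam : ℝ} (hm : 0 < m) (hb : 0 < b) (hlam : 1 ≤ lam) :
    |2 * m / (lam ^ 2 + (lam ^ 2 + b) * m ^ 2) - 2 * (m / (1 + m ^ 2)) / lam ^ 2| ≤
      2 * m * (b * m ^ 2) / lam ^ 3 := by
  have hl : 0 < lam := by linarith
  have hdiff : 2 * m / (lam ^ 2 + (lam ^ 2 + b) * m ^ 2) - 2 * (m / (1 + m ^ 2)) / lam ^ 2 =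
      -(2 * m * (b * m ^ 2) / ((lam ^ 2 + (lam ^ 2 + b) * m ^ 2) * ((1 + m ^ 2) * lam ^ 2))) := by
    field_simp
    ring
  rw [hdiff, abs_neg, abs_of_pos (by positivity)]
  gcongr
  calc lam ^ 3 ≤ lam ^ 2 * lam ^ 2 := by nlinarith [pow_pos hl 3]
    _ ≤ (lam ^ 2 + (lam ^ 2 + b) * m ^ 2) * ((1 + m ^ 2) * lam ^ 2) := by
        gcongr
        · nlinarith [mul_pos (add_pos (pow_pos hl 2) hb) (pow_pos hm 2)]
        · nlinarith [mul_pos (pow_pos hl 2) (pow_pos hm 2)]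

/-- A constant multiple of `λ⁻²` that is `O(λ⁻³)` vanishes. -/
lemma eq_zero_of_div_sq_isBigO_one_div_cube {c : ℂ}
    (h : (fun lam : ℝ => c / (lam : ℂ) ^ 2) =O[atTop] (fun lam : ℝ => 1 / lam ^ 3)) : c = 0 := by
  obtain ⟨A, hA⟩ := h.bound
  have hev : ∀ᶠ lam : ℝ in atTop, ‖c‖ ≤ A * lam⁻¹ := by
    filter_upwards [hA, eventually_gt_atTop 0] with lam hlam hpos
    simp only [norm_div, norm_pow, norm_one, Complex.norm_real, Real.norm_of_nonneg hpos.le]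
      at hlam
    rw [div_le_iff₀ (by positivity)] at hlam
    calc ‖c‖ ≤ _ := hlam
      _ = A * lam⁻¹ := by field_simp
  have hlim : Tendsto (fun lam : ℝ => A * lam⁻¹) atTop (nhds 0) := by
    simpa using tendsto_inv_atTop_zero.const_mul A
  exact norm_le_zero_iff.1 (ge_of_tendsto hlim hev)

theorem stmt13
    (k q θ : ℝ) (hk : 0 < k) (hq : 0 < q) (hq1 : q ≠ 1)
    (hθ : θ ∈ Set.Ioo 0 (Real.pi / 2))
    (D : Set (ℝ × ℝ)) (hDmeas : MeasurableSet D) (hDbdd : Bornology.IsBounded D)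
    (hDleft : D ⊆ {p : ℝ × ℝ | p.1 < 0})
    (ε : ℝ) (hε : 0 < ε)
    (hcorner : D ∩ {p : ℝ × ℝ | -ε < p.1} =
      {p : ℝ × ℝ | -ε < p.1 ∧ p.1 < 0 ∧ |p.2| < -(Real.tan θ) * p.1})
    (u : ℝ → ℝ → ℂ)
    (husmooth : ContDiff ℝ (⊤ : ℕ∞) (fun p : ℝ × ℝ => u p.1 p.2))
    (hHelm : ∀ x y : ℝ, rP1 (rP1 u) x y + rP2 (rP2 u) x y + (k : ℂ) ^ 2 * u x y = 0) :
    ((fun lam : ℝ => (k : ℂ) ^ 2 * ((q : ℂ) - 1) *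
        (∫ p in D, u p.1 p.2 *
          Complex.exp ((lam : ℂ) * (p.1 : ℂ)
            + Complex.I * ((Real.sqrt (lam ^ 2 + k ^ 2 * q) : ℝ) : ℂ) * (p.2 : ℂ)))
        - (2 * (k : ℂ) ^ 2 * ((Real.tan θ / (1 + Real.tan θ ^ 2) : ℝ) : ℂ)
            * ((q : ℂ) - 1) * u 0 0) / (lam : ℂ) ^ 2)
      =O[atTop] (fun lam : ℝ => 1 / lam ^ 3)) ∧
    (u 0 0 ≠ 0 → ∃ lam : ℝ, 0 < lam ∧
      (∫ p in D, u p.1 p.2 *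
        Complex.exp ((lam : ℂ) * (p.1 : ℂ)
          + Complex.I * ((Real.sqrt (lam ^ 2 + k ^ 2 * q) : ℝ) : ℂ) * (p.2 : ℂ))) ≠ 0) := by
  have hm : 0 < Real.tan θ := Real.tan_pos_of_pos_of_lt_pi_div_two hθ.1 hθ.2
  have hb : 0 < k ^ 2 * q := by positivity
  obtain ⟨A, hA⟩ := exists_norm_corner_integral_sub_le hm hDmeas hDbdd hDleft hε hcorner
    (husmooth.of_le (by exact_mod_cast le_top))
  have hO : (fun lam : ℝ => (k : ℂ) ^ 2 * ((q : ℂ) - 1) *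
        (∫ p in D, u p.1 p.2 *
          Complex.exp ((lam : ℂ) * (p.1 : ℂ)
            + Complex.I * ((Real.sqrt (lam ^ 2 + k ^ 2 * q) : ℝ) : ℂ) * (p.2 : ℂ)))
        - (2 * (k : ℂ) ^ 2 * ((Real.tan θ / (1 + Real.tan θ ^ 2) : ℝ) : ℂ)
            * ((q : ℂ) - 1) * u 0 0) / (lam : ℂ) ^ 2)
      =O[atTop] (fun lam : ℝ => 1 / lam ^ 3) := by
    refine IsBigO.of_bound (‖(k : ℂ) ^ 2 * ((q : ℂ) - 1)‖ *
      (A + ‖u 0 0‖ * (2 * Real.tan θ * (k ^ 2 * q * Real.tan θ ^ 2)))) ?_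
    filter_upwards [eventually_ge_atTop 1] with lam hlam
    have hl : 0 < lam := by linarith
    have hrad : 0 < lam ^ 2 + k ^ 2 * q := by positivity
    have h₁ := hA lam (Real.sqrt (lam ^ 2 + k ^ 2 * q)) hl (Real.sqrt_pos.2 hrad).ne'
    rw [Real.sq_sqrt hrad.le] at h₁
    have h₂ := mul_le_mul_of_nonneg_left (abs_sector_coefficient_sub_le hm hb hlam)
      (norm_nonneg (u 0 0))
    rw [← Real.norm_eq_abs, ← Complex.norm_real, ← norm_mul] at h₂
    rw [Real.norm_of_nonneg (by positivity : 0 ≤ 1 / lam ^ 3), mul_assoc]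
    refine le_trans (le_of_eq_of_le ?_ (mul_le_mul_of_nonneg_left
      ((norm_add_le _ _).trans (add_le_add h₁ h₂)) (norm_nonneg ((k : ℂ) ^ 2 * ((q : ℂ) - 1)))))
      (le_of_eq (by ring))
    rw [← norm_mul]
    congr 1
    simp only [Prod.fst_zero, Prod.snd_zero]
    push_cast
    ring
  refine ⟨hO, fun hu => ?_⟩
  by_contra! hzero
  have hC := eq_zero_of_div_sq_isBigO_one_div_cube
    (c := 2 * (k : ℂ) ^ 2 * ((Real.tan θ / (1 + Real.tan θ ^ 2) : ℝ) : ℂ) * ((q : ℂ) - 1) * u 0 0)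
    ((hO.neg_left).congr' (by
      filter_upwards [eventually_gt_atTop 0] with lam hlam
      rw [hzero lam hlam]
      ring) (EventuallyEq.refl _ _))
  have hk' : (k : ℂ) ≠ 0 := by exact_mod_cast hk.ne'
  have hq' : (q : ℂ) - 1 ≠ 0 := sub_ne_zero.2 (by exact_mod_cast hq1)
  have ht : ((Real.tan θ / (1 + Real.tan θ ^ 2) : ℝ) : ℂ) ≠ 0 := by
    have : 0 < Real.tan θ / (1 + Real.tan θ ^ 2) := by positivity
    exact_mod_cast this.ne'
  exact mul_ne_zero (mul_ne_zero (mul_ne_zero (mul_ne_zero two_ne_zero (pow_ne_zero 2 hk')) ht) hq')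
    hu hC
end
end

section
/- Let k > 0, q > 0, α ∈ [−π,π], and for λ > 0 set λ̃ = √(λ²+k²q) − λ. Let D = {x ∈ ℝ² : x₁² + x₂² < 1} be the open unit disk. Then for every λ > 0, ∫_D exp( i·( x₁·(k·cos α − i·λ) + x₂·(k·sin α + λ + λ̃) ) ) dx = π·Σ_{m=0}^∞ (−1)^m·c^m/(m!·(m+1)!), where c = −(i·k/2)·e^{iα}·λ + λ·λ̃/2 + k²/4 + (λ̃·k/2)·sin α + λ̃²/4. (The right-hand side equals π·J₁(2√c)/√c, where J₁ is the Bessel function of the first kind of order 1, and this expression is independent of the choice of branch of the square root.) -/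
open Complex MeasureTheory

noncomputable section

/-- Orthogonality of the characters `θ ↦ exp (i m θ)` on `[-π, π]`. -/
theorem integral_exp_int_mul_I (m : ℤ) :
    ∫ θ in (-Real.pi)..Real.pi, exp (m * I * (θ : ℂ)) = if m = 0 then 2 * (Real.pi : ℂ) else 0 := by
  split_ifs with h
  · simp [h]
    ring
  · have hc : (m : ℂ) * I ≠ 0 := mul_ne_zero (by exact_mod_cast h) I_ne_zero
    rw [integral_exp_mul_complex hc]
    have : exp (m * I * (Real.pi : ℂ)) = exp (m * I * ((-Real.pi : ℝ) : ℂ)) := by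
      rw [Complex.exp_eq_exp_iff_exists_int]
      exact ⟨m, by push_cast; ring⟩
    rw [this, sub_self, zero_div]

theorem trig_combination_pow (A B : ℂ) (n : ℕ) (θ : ℝ) :
    ((Real.cos θ : ℂ) * A + (Real.sin θ : ℂ) * B) ^ n =
      ∑ j ∈ Finset.range (n + 1), ((A - I * B) / 2) ^ j * ((A + I * B) / 2) ^ (n - j) *
        (n.choose j : ℂ) * exp (((2 * j - n : ℤ) : ℂ) * I * (θ : ℂ)) := by
  have h : (Real.cos θ : ℂ) * A + (Real.sin θ : ℂ) * B =
      (A - I * B) / 2 * exp (I * θ) + (A + I * B) / 2 * exp (-(I * θ)) := by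
    have h1 : exp (I * θ) = cos θ + sin θ * I := by rw [mul_comm, exp_mul_I]
    have h2 : exp (-(I * θ)) = cos θ - sin θ * I := by
      rw [show -(I * (θ : ℂ)) = (-θ : ℂ) * I by ring, exp_mul_I, cos_neg, sin_neg]
      ring
    rw [h1, h2]
    push_cast
    linear_combination (sin θ * B) * I_sq
  rw [h, add_pow]
  refine Finset.sum_congr rfl fun j hj => ?_
  have hj' : j ≤ n := by simpa [Nat.lt_succ_iff] using hj
  have he : exp (((2 * j - n : ℤ) : ℂ) * I * (θ : ℂ)) =
      exp (I * θ) ^ j * exp (-(I * θ)) ^ (n - j) := by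
    rw [← exp_nat_mul, ← exp_nat_mul, ← exp_add]
    congr 1
    push_cast [Nat.cast_sub hj']
    ring
  rw [he, mul_pow, mul_pow]
  ring

theorem integral_trig_combination_pow (A B : ℂ) (n : ℕ) :
    ∫ θ in (-Real.pi)..Real.pi, ((Real.cos θ : ℂ) * A + (Real.sin θ : ℂ) * B) ^ n =
      ∑ j ∈ Finset.range (n + 1), ((A - I * B) / 2) ^ j * ((A + I * B) / 2) ^ (n - j) *
        (n.choose j : ℂ) * if (2 * j - n : ℤ) = 0 then 2 * (Real.pi : ℂ) else 0 := by
  simp_rw [trig_combination_pow]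
  rw [intervalIntegral.integral_finsetSum]
  · refine Finset.sum_congr rfl fun j _ => ?_
    rw [intervalIntegral.integral_const_mul, integral_exp_int_mul_I]
  · intro j _
    apply Continuous.intervalIntegrable
    fun_prop

theorem integral_trig_combination_pow_odd (A B : ℂ) {n : ℕ} (hn : Odd n) :
    ∫ θ in (-Real.pi)..Real.pi, ((Real.cos θ : ℂ) * A + (Real.sin θ : ℂ) * B) ^ n = 0 := by
  rw [integral_trig_combination_pow]
  refine Finset.sum_eq_zero fun j _ => ?_
  obtain ⟨m, rfl⟩ := hn
  rw [if_neg (by lia), mul_zero]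

theorem integral_trig_combination_pow_even (A B : ℂ) (m : ℕ) :
    ∫ θ in (-Real.pi)..Real.pi, ((Real.cos θ : ℂ) * A + (Real.sin θ : ℂ) * B) ^ (2 * m) =
      2 * Real.pi * ((2 * m).choose m : ℂ) * ((A ^ 2 + B ^ 2) / 4) ^ m := by
  have hAB : (A ^ 2 + B ^ 2) / 4 = (A - I * B) / 2 * ((A + I * B) / 2) := by
    linear_combination (B ^ 2 / 4) * I_sq
  rw [integral_trig_combination_pow, Finset.sum_eq_single m]
  · rw [if_pos (by push_cast; ring), hAB, mul_pow, show 2 * m - m = m by lia]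
    ring
  · intro j _ hj
    rw [if_neg (by lia), mul_zero]
  · intro h
    exact absurd (Finset.mem_range.2 (by lia)) h

theorem measurableSet_unitDisk : MeasurableSet {p : ℝ × ℝ | p.1 ^ 2 + p.2 ^ 2 < 1} :=
  (isOpen_lt (by fun_prop) continuous_const).measurableSet

theorem norm_coord_le_one_of_mem_unitDisk {p : ℝ × ℝ} (hp : p.1 ^ 2 + p.2 ^ 2 < 1) :
    ‖(p.1 : ℂ)‖ ≤ 1 ∧ ‖(p.2 : ℂ)‖ ≤ 1 := by
  simp only [norm_real, Real.norm_eq_abs]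
  constructor <;> apply abs_le_one_iff_mul_self_le_one.2 <;> nlinarith [sq_nonneg p.1, sq_nonneg p.2]

theorem volume_unitDisk_lt_top : volume {p : ℝ × ℝ | p.1 ^ 2 + p.2 ^ 2 < 1} < ⊤ := by
  refine (measure_mono fun p hp => ?_).trans_lt
    (isCompact_closedBall (0 : ℝ × ℝ) 1).measure_lt_top
  have h := norm_coord_le_one_of_mem_unitDisk hp
  simp only [norm_real] at h
  rw [mem_closedBall_zero_iff, Prod.norm_def]
  exact max_le h.1 h.2

theorem integral_unitDisk_pow (A B : ℂ) (n : ℕ) :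
    ∫ p in {p : ℝ × ℝ | p.1 ^ 2 + p.2 ^ 2 < 1}, ((p.1 : ℂ) * A + (p.2 : ℂ) * B) ^ n =
      1 / (n + 2) *
        ∫ θ in (-Real.pi)..Real.pi, ((Real.cos θ : ℂ) * A + (Real.sin θ : ℂ) * B) ^ n := by
  rw [← integral_indicator measurableSet_unitDisk, ← integral_comp_polarCoord_symm]
  have hpolar : ∀ p ∈ polarCoord.target,
      p.1 • Set.indicator {p : ℝ × ℝ | p.1 ^ 2 + p.2 ^ 2 < 1}
        (fun p => ((p.1 : ℂ) * A + (p.2 : ℂ) * B) ^ n) (polarCoord.symm p) =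
      Set.indicator (Set.Iio 1) (fun r : ℝ => (r : ℂ) ^ (n + 1)) p.1 *
        ((Real.cos p.2 : ℂ) * A + (Real.sin p.2 : ℂ) * B) ^ n := by
    rintro ⟨r, θ⟩ ⟨hr, -⟩
    have hr : 0 < r := hr
    have hsq : (r * Real.cos θ) ^ 2 + (r * Real.sin θ) ^ 2 = r ^ 2 := by
      linear_combination r ^ 2 * Real.cos_sq_add_sin_sq θ
    simp only [polarCoord_symm_apply, Set.indicator_apply, Set.mem_ofPred_eq, Set.mem_Iio, hsq,
      sq_lt_one_iff₀ hr.le]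
    split_ifs
    · rw [real_smul]
      push_cast
      rw [mul_assoc, mul_assoc, ← mul_add, mul_pow]
      ring
    · simp
  rw [setIntegral_congr_fun polarCoord.open_target.measurableSet hpolar, polarCoord_target,
    Measure.volume_eq_prod, setIntegral_prod_mul
      (Set.indicator (Set.Iio 1) (fun r : ℝ => (r : ℂ) ^ (n + 1)))
      (fun θ : ℝ => ((Real.cos θ : ℂ) * A + (Real.sin θ : ℂ) * B) ^ n),
    ← integral_Ioc_eq_integral_Ioo,
    ← intervalIntegral.integral_of_le (by linarith [Real.pi_pos])]
  congr 1
  rw [setIntegral_indicator measurableSet_Iio, Set.Ioi_inter_Iio, ← integral_Ioc_eq_integral_Ioo,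
    ← intervalIntegral.integral_of_le zero_le_one]
  simp_rw [← ofReal_pow]
  rw [intervalIntegral.integral_ofReal, integral_pow]
  push_cast
  simp
  ring

theorem hasSum_integral_unitDisk_exp (A B : ℂ) :
    HasSum (fun n : ℕ => I ^ n / (n.factorial : ℂ) *
        ∫ p in {p : ℝ × ℝ | p.1 ^ 2 + p.2 ^ 2 < 1}, ((p.1 : ℂ) * A + (p.2 : ℂ) * B) ^ n)
      (∫ p in {p : ℝ × ℝ | p.1 ^ 2 + p.2 ^ 2 < 1},
        exp (I * ((p.1 : ℂ) * A + (p.2 : ℂ) * B))) := by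
  simp_rw [← integral_const_mul]
  have : IsFiniteMeasure (volume.restrict {p : ℝ × ℝ | p.1 ^ 2 + p.2 ^ 2 < 1}) :=
    isFiniteMeasure_restrict.2 volume_unitDisk_lt_top.ne
  refine hasSum_integral_of_dominated_convergence
    (fun n _ => (‖A‖ + ‖B‖) ^ n / (n.factorial : ℝ)) ?_ ?_ ?_ ?_ ?_
  · intro n
    apply Continuous.aestronglyMeasurable
    fun_prop
  · intro n
    filter_upwards [ae_restrict_mem measurableSet_unitDisk] with p hp
    obtain ⟨h1, h2⟩ := norm_coord_le_one_of_mem_unitDisk hp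
    have h : ‖(p.1 : ℂ) * A + (p.2 : ℂ) * B‖ ≤ ‖A‖ + ‖B‖ := by
      refine (norm_add_le _ _).trans (add_le_add ?_ ?_) <;> rw [norm_mul]
      · exact mul_le_of_le_one_left (norm_nonneg _) h1
      · exact mul_le_of_le_one_left (norm_nonneg _) h2
    rw [norm_mul, norm_div, norm_pow, norm_pow, norm_I, one_pow, norm_natCast, one_div_mul_eq_div]
    gcongr
  · exact .of_forall fun _ => Real.summable_pow_div_factorial _
  · exact integrable_const _
  · refine .of_forall fun p => ?_
    rw [exp_eq_exp_ℂ]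
    have h := NormedSpace.expSeries_div_hasSum_exp (I * ((p.1 : ℂ) * A + (p.2 : ℂ) * B))
    simpa only [mul_pow, mul_div_right_comm] using h

/-- The Fourier-Laplace transform of the unit disk. -/
theorem integral_unitDisk_exp (A B : ℂ) :
    ∫ p in {p : ℝ × ℝ | p.1 ^ 2 + p.2 ^ 2 < 1}, exp (I * ((p.1 : ℂ) * A + (p.2 : ℂ) * B)) =
      Real.pi * ∑' m : ℕ, (-1 : ℂ) ^ m * ((A ^ 2 + B ^ 2) / 4) ^ m /
        ((m.factorial : ℂ) * ((m + 1).factorial : ℂ)) := by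
  have hinj : Function.Injective fun m : ℕ => 2 * m := fun a b h => by
    simpa using h
  have hodd : ∀ n ∉ Set.range fun m : ℕ => 2 * m, I ^ n / (n.factorial : ℂ) *
      ∫ p in {p : ℝ × ℝ | p.1 ^ 2 + p.2 ^ 2 < 1}, ((p.1 : ℂ) * A + (p.2 : ℂ) * B) ^ n = 0 := by
    intro n hn
    have : Odd n := by
      rw [← Nat.not_even_iff_odd]
      rintro ⟨m, rfl⟩
      exact hn ⟨m, two_mul m⟩
    rw [integral_unitDisk_pow, integral_trig_combination_pow_odd A B this, mul_zero, mul_zero]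
  rw [← ((hinj.hasSum_iff hodd).2 (hasSum_integral_unitDisk_exp A B)).tsum_eq, ← tsum_mul_left]
  refine tsum_congr fun m => ?_
  simp only [Function.comp_apply]
  have hchoose : ((2 * m).choose m : ℂ) * (m.factorial * m.factorial) = (2 * m).factorial := by
    have := Nat.choose_mul_factorial_mul_factorial (show m ≤ 2 * m by lia)
    rw [show 2 * m - m = m by lia, mul_assoc] at this
    exact_mod_cast this
  have h0 : (m.factorial : ℂ) ≠ 0 := by exact_mod_cast m.factorial_ne_zero
  have h1 : ((2 * m).factorial : ℂ) ≠ 0 := by exact_mod_cast (2 * m).factorial_ne_zero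
  have h2 : (m : ℂ) + 1 ≠ 0 := by exact_mod_cast m.succ_ne_zero
  have h3 : ((2 * m : ℕ) : ℂ) + 2 = 2 * (m + 1) := by push_cast; ring
  rw [integral_unitDisk_pow, integral_trig_combination_pow_even, pow_mul, I_sq, h3,
    Nat.factorial_succ]
  push_cast
  rw [← hchoose] at h1 ⊢
  have h4 := left_ne_zero_of_mul h1
  field_simp

theorem stmt14
    (k q α : ℝ) (hk : 0 < k) (hq : 0 < q) (hα : α ∈ Set.Icc (-Real.pi) Real.pi) :
    ∀ lam : ℝ, 0 < lam →
      (∫ p in {p : ℝ × ℝ | p.1 ^ 2 + p.2 ^ 2 < 1},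
        Complex.exp (Complex.I *
          ((p.1 : ℂ) * ((k : ℂ) * ((Real.cos α : ℝ) : ℂ) - Complex.I * (lam : ℂ))
            + (p.2 : ℂ) * ((k : ℂ) * ((Real.sin α : ℝ) : ℂ) + (lam : ℂ)
              + (lamT k q lam : ℂ))))) =
      (Real.pi : ℂ) * ∑' m : ℕ, (-1 : ℂ) ^ m *
        (-(Complex.I * (k : ℂ) / 2) * Complex.exp (Complex.I * (α : ℂ)) * (lam : ℂ)
          + (lam : ℂ) * (lamT k q lam : ℂ) / 2 + (k : ℂ) ^ 2 / 4
          + ((lamT k q lam : ℂ) * (k : ℂ) / 2) * ((Real.sin α : ℝ) : ℂ)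
          + (lamT k q lam : ℂ) ^ 2 / 4) ^ m
        / ((Nat.factorial m : ℂ) * (Nat.factorial (m + 1) : ℂ)) := by
  intro lam _
  rw [integral_unitDisk_exp]
  congr 1
  refine tsum_congr fun m => ?_
  congr 3
  rw [mul_comm I (α : ℂ), exp_mul_I]
  push_cast
  linear_combination (k ^ 2 / 4 : ℂ) * Complex.cos_sq_add_sin_sq (α : ℂ) +
    ((lam : ℂ) ^ 2 / 4 + k * lam * Complex.sin α / 2) * I_sq
end
end

section
/- Let n ∈ ℤ, k > 0, q > 0, and for λ > 0 set λ̃ = √(λ²+k²q) − λ. Then for every λ > 0, 2π·i^n·∫_{−π}^{π} e^{int}·[ k·J_n'(k) − λ·J_n(k)·e^{it} − i·λ̃·J_n(k)·sin t ]·exp( λ·e^{it} + i·λ̃·sin t ) dt = 4π²·k·( −i·λ̃/(k·√q) )^n·[ J_n'(k)·J_n(k·√q) − √q·J_n(k)·J_n'(k·√q) ], where J_n' denotes the derivative of J_n. -/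
open Complex MeasureTheory

noncomputable section

/-- Bessel function of the first kind of nonnegative integer order, as an entire function. -/
def besselJNat (ν : ℕ) (z : ℂ) : ℂ :=
  ∑' m : ℕ, ((-1 : ℂ) ^ m / ((Nat.factorial m : ℂ) * (Nat.factorial (m + ν) : ℂ)))
    * (z / 2) ^ (2 * m + ν)

/-- Bessel function of the first kind of integer order: `J_{−n} = (−1)^n J_n`. -/
def besselJ (n : ℤ) (z : ℂ) : ℂ :=
  if 0 ≤ n then besselJNat n.toNat z else (-1 : ℂ) ^ n * besselJNat (-n).toNat z

theorem integral_exp_int_mul (N : ℤ) :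
    ∫ t in (-Real.pi)..Real.pi, Complex.exp (Complex.I * (N : ℂ) * (t : ℂ)) =
      if N = 0 then 2 * (Real.pi : ℂ) else 0 := by
  split_ifs with h
  · simp [h]; ring
  · have hc : Complex.I * (N : ℂ) ≠ 0 := by simp [h]
    rw [integral_exp_mul_complex hc, div_eq_zero_iff]
    left
    rw [sub_eq_zero, Complex.exp_eq_exp_iff_exists_int]
    exact ⟨N, by push_cast; ring⟩

/-- The coefficient extraction `(2π)⁻¹ ∫ e^{iνt} exp(x e^{it} + y e^{-it}) dt` as a power series. -/
theorem integral_exp_mul_exp_add (ν : ℕ) (x y : ℂ) :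
    ∫ t in (-Real.pi)..Real.pi, Complex.exp (Complex.I * (ν : ℂ) * (t : ℂ)) *
        Complex.exp (x * Complex.exp (Complex.I * (t : ℂ))
          + y * Complex.exp (-(Complex.I * (t : ℂ)))) =
      2 * (Real.pi : ℂ) * ∑' m : ℕ, x ^ m * y ^ (m + ν) /
        ((Nat.factorial m : ℂ) * (Nat.factorial (m + ν) : ℂ)) := by
  let c : ℕ × ℕ → ℂ := fun p ↦
    x ^ p.1 / (Nat.factorial p.1 : ℂ) * (y ^ p.2 / (Nat.factorial p.2 : ℂ))
  let f : ℕ × ℕ → C(ℝ, ℂ) := fun p ↦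
    ⟨fun t ↦ c p * Complex.exp (Complex.I * (((ν : ℤ) + p.1 - p.2 : ℤ) : ℂ) * (t : ℂ)), by fun_prop⟩
  have hc : Summable fun p ↦ ‖c p‖ := by
    have := (NormedSpace.norm_expSeries_div_summable x).mul_norm
      (NormedSpace.norm_expSeries_div_summable y)
    simpa [c] using this
  have hnorm : ∀ p, ‖(f p).restrict (⟨Set.uIcc (-Real.pi) Real.pi, isCompact_uIcc⟩ :
      TopologicalSpace.Compacts ℝ)‖ ≤ ‖c p‖ := by
    intro p
    refine (ContinuousMap.norm_le _ (norm_nonneg _)).2 fun t ↦ ?_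
    have : ‖Complex.exp (Complex.I * (((ν : ℤ) + p.1 - p.2 : ℤ) : ℂ) * ((t : ℝ) : ℂ))‖ = 1 := by
      rw [Complex.norm_exp]
      simp
    simp only [f, ContinuousMap.restrict_apply, ContinuousMap.coe_mk, norm_mul]
    rw [this, mul_one]
  have hsum := intervalIntegral.hasSum_intervalIntegral_of_summable_norm
    (a := -Real.pi) (b := Real.pi) (f := f) (Summable.of_nonneg_of_le (fun _ ↦ norm_nonneg _) hnorm hc)
  have hint : ∀ p, ∫ t in (-Real.pi)..Real.pi, f p t =
      if (ν : ℤ) + p.1 - p.2 = 0 then 2 * (Real.pi : ℂ) * c p else 0 := by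
    intro p
    simp only [f, ContinuousMap.coe_mk]
    rw [intervalIntegral.integral_const_mul, integral_exp_int_mul]
    split_ifs <;> ring
  have htsum : ∀ t : ℝ, ∑' p, f p t = Complex.exp (Complex.I * (ν : ℂ) * (t : ℂ)) *
        Complex.exp (x * Complex.exp (Complex.I * (t : ℂ))
          + y * Complex.exp (-(Complex.I * (t : ℂ)))) := by
    intro t
    have hx := NormedSpace.norm_expSeries_div_summable (x * Complex.exp (Complex.I * (t : ℂ)))
    have hy := NormedSpace.norm_expSeries_div_summable (y * Complex.exp (-(Complex.I * (t : ℂ))))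
    have hprod := tsum_mul_tsum_of_summable_norm hx hy
    have hexp : ∀ w : ℂ, ∑' m : ℕ, w ^ m / (Nat.factorial m : ℂ) = Complex.exp w := fun w ↦ by
      rw [Complex.exp_eq_exp_ℂ, NormedSpace.exp_eq_tsum_div]
    rw [hexp, hexp] at hprod
    rw [Complex.exp_add, hprod, ← tsum_mul_left]
    refine tsum_congr fun p ↦ ?_
    have he : Complex.exp (Complex.I * (((ν : ℤ) + p.1 - p.2 : ℤ) : ℂ) * (t : ℂ)) =
        Complex.exp (Complex.I * (ν : ℂ) * (t : ℂ)) * (Complex.exp (Complex.I * (t : ℂ)) ^ p.1 *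
          Complex.exp (-(Complex.I * (t : ℂ))) ^ p.2) := by
      rw [← Complex.exp_nat_mul, ← Complex.exp_nat_mul, ← Complex.exp_add, ← Complex.exp_add]
      congr 1
      push_cast
      ring
    simp only [f, c, ContinuousMap.coe_mk]
    rw [he]
    ring
  simp_rw [htsum, hint] at hsum
  rw [← hsum.tsum_eq, ← tsum_mul_left]
  have hinj : Function.Injective fun m : ℕ ↦ (m, m + ν) := fun a b h ↦ (Prod.mk.inj h).1
  rw [← hinj.tsum_eq]
  · refine tsum_congr fun m ↦ ?_
    rw [if_pos (by push_cast; ring)]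
    simp only [c]
    ring
  · rintro ⟨i, j⟩ h
    rw [Function.mem_support] at h
    have h' : (ν : ℤ) + i - j = 0 := by
      by_contra h0
      exact h (if_neg h0)
    exact ⟨i, Prod.ext rfl (by simp; omega)⟩

/-- The generating function of the Bessel functions, rescaled: if `4ab = z²`, the coefficient of
`w^{-n}` in `exp (s (a w - b / w))` is `(-2b / z) ^ n * J_n (s z)`. -/
theorem integral_eq_besselJ (n : ℤ) {a b z : ℂ} (hz : z ≠ 0) (hab : 4 * (a * b) = z ^ 2) (s : ℂ) :
    ∫ t in (-Real.pi)..Real.pi, Complex.exp (Complex.I * (n : ℂ) * (t : ℂ)) *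
        Complex.exp (s * (a * Complex.exp (Complex.I * (t : ℂ))
          - b * Complex.exp (-(Complex.I * (t : ℂ))))) =
      2 * (Real.pi : ℂ) * (-(2 * b) / z) ^ n * besselJ n (s * z) := by
  have hb : b ≠ 0 := by
    rintro rfl
    exact hz (pow_eq_zero_iff two_ne_zero |>.1 (by rw [← hab]; ring))
  have hpow : ∀ m : ℕ, (-1) ^ m * (s * z / 2) ^ (2 * m) = (s * a) ^ m * (-(s * b)) ^ m := by
    intro m
    rw [pow_mul, ← mul_pow, ← mul_pow]
    congr 1
    linear_combination s ^ 2 / 4 * hab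
  rcases le_or_gt 0 n with hn | hn
  · lift n to ℕ using hn
    have h := integral_exp_mul_exp_add n (s * a) (-(s * b))
    rw [besselJ, if_pos (by positivity), Int.toNat_natCast, besselJNat, mul_assoc, zpow_natCast,
      ← tsum_mul_left]
    convert h using 2
    · ext t
      push_cast
      ring_nf
    · refine tsum_congr fun m ↦ ?_
      have h1 : (-(2 * b) / z) ^ n * (s * z / 2) ^ n = (-(s * b)) ^ n := by
        rw [← mul_pow]
        congr 1
        field_simp
      rw [pow_add, pow_add, ← h1]
      linear_combination (-(2 * b) / z) ^ n * (s * z / 2) ^ n /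
        ((Nat.factorial m : ℂ) * (Nat.factorial (m + n) : ℂ)) * hpow m
  · obtain ⟨ν, rfl⟩ : ∃ ν : ℕ, n = -(ν : ℤ) := ⟨n.natAbs, by omega⟩
    have h := integral_exp_mul_exp_add ν (-(s * b)) (s * a)
    rw [besselJ, if_neg (by omega), neg_neg, Int.toNat_natCast, besselJNat, mul_assoc,
      ← mul_assoc (_ ^ (-(ν : ℤ))), ← tsum_mul_left, ← neg_neg Real.pi,
      ← intervalIntegral.integral_comp_neg, neg_neg]
    convert h using 2
    · ext t
      push_cast
      ring_nf
    · refine tsum_congr fun m ↦ ?_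
      have h1 : ((-(2 * b) / z) ^ (-(ν : ℤ)) * (-1) ^ (-(ν : ℤ))) * (s * z / 2) ^ ν =
          (s * a) ^ ν := by
        rw [← mul_zpow, zpow_neg, zpow_natCast, ← inv_pow, ← mul_pow]
        congr 1
        field_simp
        linear_combination -s * hab
      rw [pow_add, pow_add, ← h1]
      linear_combination ((-(2 * b) / z) ^ (-(ν : ℤ)) * (-1) ^ (-(ν : ℤ))) * (s * z / 2) ^ ν /
        ((Nat.factorial m : ℂ) * (Nat.factorial (m + ν) : ℂ)) * hpow m

theorem hasDerivAt_integral_exp (g φ : ℝ → ℂ) (hg : Continuous g) (hφ : Continuous φ) (s₀ : ℂ) :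
    HasDerivAt (fun s : ℂ ↦ ∫ t in (-Real.pi)..Real.pi, g t * Complex.exp (s * φ t))
      (∫ t in (-Real.pi)..Real.pi, g t * (φ t * Complex.exp (s₀ * φ t))) s₀ := by
  obtain ⟨M, hM⟩ := (isCompact_closedBall s₀ 1 |>.prod
    (isCompact_uIcc (a := -Real.pi) (b := Real.pi))).exists_bound_of_continuousOn
    (f := fun p : ℂ × ℝ ↦ g p.2 * (φ p.2 * Complex.exp (p.1 * φ p.2))) (by fun_prop)
  refine (intervalIntegral.hasDerivAt_integral_of_dominated_loc_of_deriv_le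
    (F := fun s t ↦ g t * Complex.exp (s * φ t))
    (F' := fun s t ↦ g t * (φ t * Complex.exp (s * φ t))) (bound := fun _ ↦ M)
    (Metric.closedBall_mem_nhds s₀ one_pos) ?_ ?_ ?_ ?_ ?_ ?_).2
  · exact .of_forall fun s ↦ (by fun_prop : Continuous _).aestronglyMeasurable
  · exact (by fun_prop : Continuous _).intervalIntegrable _ _
  · exact (by fun_prop : Continuous _).aestronglyMeasurable
  · exact .of_forall fun t ht s hs ↦ hM (s, t) ⟨hs, Set.uIoc_subset_uIcc ht⟩
  · exact intervalIntegrable_const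
  · refine .of_forall fun t _ s _ ↦ HasDerivAt.const_mul _ ?_
    have := ((hasDerivAt_id s).mul_const (φ t)).cexp
    simpa [mul_comm] using this

theorem integral_deriv_eq_besselJ (n : ℤ) {a b z : ℂ} (hz : z ≠ 0) (hab : 4 * (a * b) = z ^ 2) :
    ∫ t in (-Real.pi)..Real.pi, Complex.exp (Complex.I * (n : ℂ) * (t : ℂ)) *
        ((a * Complex.exp (Complex.I * (t : ℂ)) - b * Complex.exp (-(Complex.I * (t : ℂ)))) *
        Complex.exp (a * Complex.exp (Complex.I * (t : ℂ))
          - b * Complex.exp (-(Complex.I * (t : ℂ))))) =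
      2 * (Real.pi : ℂ) * (-(2 * b) / z) ^ n * (z * deriv (besselJ n) z) := by
  have hb : b ≠ 0 := by
    rintro rfl
    exact hz (pow_eq_zero_iff two_ne_zero |>.1 (by rw [← hab]; ring))
  have hρ : 2 * (Real.pi : ℂ) * (-(2 * b) / z) ^ n ≠ 0 := by
    have : (-(2 * b) / z) ≠ 0 := by simp [hb, hz]
    simp [Real.pi_ne_zero, zpow_ne_zero, this]
  have hK := hasDerivAt_integral_exp (fun t ↦ Complex.exp (Complex.I * (n : ℂ) * (t : ℂ)))
    (fun t ↦ a * Complex.exp (Complex.I * (t : ℂ)) - b * Complex.exp (-(Complex.I * (t : ℂ))))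
    (by fun_prop) (by fun_prop) 1
  simp only [integral_eq_besselJ n hz hab, one_mul] at hK
  have hJ : HasDerivAt (besselJ n) (deriv (besselJ n) z) z := by
    have h1 : HasDerivAt (fun y : ℂ ↦ y / z) (1 / z) z := (hasDerivAt_id z).div_const z
    have h2 := (HasDerivAt.comp_of_eq z hK h1 (div_self hz).symm).const_mul (2 * (Real.pi : ℂ) * (-(2 * b) / z) ^ n)⁻¹
    refine DifferentiableAt.hasDerivAt (h2.differentiableAt.congr_of_eventuallyEq ?_)
    refine .of_forall fun y ↦ ?_
    simp only [Function.comp_apply, div_mul_cancel₀ _ hz]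
    rw [inv_mul_cancel_left₀ hρ]
  have h3 : HasDerivAt (fun s : ℂ ↦ besselJ n (s * z)) (deriv (besselJ n) z * z) 1 := by
    have h4 : HasDerivAt (fun s : ℂ ↦ s * z) z 1 := by
      simpa using (hasDerivAt_id (1 : ℂ)).mul_const z
    exact HasDerivAt.comp_of_eq (1 : ℂ) hJ h4 (one_mul z).symm
  rw [hK.unique (h3.const_mul _), mul_comm z]

theorem stmt15
    (n : ℤ) (k q : ℝ) (hk : 0 < k) (hq : 0 < q) :
    ∀ lam : ℝ, 0 < lam →
      2 * (Real.pi : ℂ) * Complex.I ^ n *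
        (∫ t in (-Real.pi)..Real.pi,
          Complex.exp (Complex.I * (n : ℂ) * (t : ℂ)) *
            ((k : ℂ) * deriv (besselJ n) (k : ℂ)
              - (lam : ℂ) * besselJ n (k : ℂ) * Complex.exp (Complex.I * (t : ℂ))
              - Complex.I * (lamT k q lam : ℂ) * besselJ n (k : ℂ) * Complex.sin (t : ℂ)) *
            Complex.exp ((lam : ℂ) * Complex.exp (Complex.I * (t : ℂ))
              + Complex.I * (lamT k q lam : ℂ) * Complex.sin (t : ℂ))) =
      4 * (Real.pi : ℂ) ^ 2 * (k : ℂ) *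
        ((-Complex.I * (lamT k q lam : ℂ)) / ((k : ℂ) * ((Real.sqrt q : ℝ) : ℂ))) ^ n *
        (deriv (besselJ n) (k : ℂ) * besselJ n ((k * Real.sqrt q : ℝ) : ℂ)
          - ((Real.sqrt q : ℝ) : ℂ) * besselJ n (k : ℂ)
            * deriv (besselJ n) ((k * Real.sqrt q : ℝ) : ℂ)) := by
  intro lam hlam
  set r : ℝ := Real.sqrt q with hr
  set L : ℝ := lamT k q lam with hL
  have hr0 : 0 < r := Real.sqrt_pos.2 hq
  have hrq : r ^ 2 = q := Real.sq_sqrt hq.le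
  have hLq : L * (2 * lam + L) = (k * r) ^ 2 := by
    have h := Real.sq_sqrt (show 0 ≤ lam ^ 2 + k ^ 2 * q by positivity)
    rw [mul_pow, hrq, hL, lamT]
    linear_combination h
  have hz : ((k * r : ℝ) : ℂ) ≠ 0 := by exact_mod_cast (mul_pos hk hr0).ne'
  have hab : 4 * (((lam : ℂ) + L / 2) * ((L : ℂ) / 2)) = ((k * r : ℝ) : ℂ) ^ 2 := by
    rw [← Complex.ofReal_pow, ← hLq]
    push_cast
    ring
  have h1 := integral_eq_besselJ n hz hab 1
  have h2 := integral_deriv_eq_besselJ n hz hab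
  simp only [one_mul] at h1
  have hsin : ∀ t : ℝ, Complex.I * (L : ℂ) * Complex.sin (t : ℂ) =
      L / 2 * Complex.exp (Complex.I * t) - L / 2 * Complex.exp (-(Complex.I * t)) := by
    intro t
    rw [Complex.sin, neg_mul, mul_comm (t : ℂ)]
    linear_combination (L : ℂ) / 2 * (Complex.exp (-(Complex.I * t)) - Complex.exp (Complex.I * t))
      * Complex.I_sq
  have key : ∀ t : ℝ, Complex.exp (Complex.I * (n : ℂ) * (t : ℂ)) *
            ((k : ℂ) * deriv (besselJ n) (k : ℂ)
              - (lam : ℂ) * besselJ n (k : ℂ) * Complex.exp (Complex.I * (t : ℂ))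
              - Complex.I * (L : ℂ) * besselJ n (k : ℂ) * Complex.sin (t : ℂ)) *
            Complex.exp ((lam : ℂ) * Complex.exp (Complex.I * (t : ℂ))
              + Complex.I * (L : ℂ) * Complex.sin (t : ℂ)) =
      (k : ℂ) * deriv (besselJ n) (k : ℂ) * (Complex.exp (Complex.I * (n : ℂ) * (t : ℂ)) *
        Complex.exp (((lam : ℂ) + L / 2) * Complex.exp (Complex.I * (t : ℂ))
          - (L : ℂ) / 2 * Complex.exp (-(Complex.I * (t : ℂ))))) -
      besselJ n (k : ℂ) * (Complex.exp (Complex.I * (n : ℂ) * (t : ℂ)) *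
        ((((lam : ℂ) + L / 2) * Complex.exp (Complex.I * (t : ℂ))
          - (L : ℂ) / 2 * Complex.exp (-(Complex.I * (t : ℂ)))) *
        Complex.exp (((lam : ℂ) + L / 2) * Complex.exp (Complex.I * (t : ℂ))
          - (L : ℂ) / 2 * Complex.exp (-(Complex.I * (t : ℂ)))))) := by
    intro t
    have h3 : (lam : ℂ) * Complex.exp (Complex.I * (t : ℂ))
              + Complex.I * (L : ℂ) * Complex.sin (t : ℂ) =
        ((lam : ℂ) + L / 2) * Complex.exp (Complex.I * (t : ℂ))
          - (L : ℂ) / 2 * Complex.exp (-(Complex.I * (t : ℂ))) := by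
      rw [hsin]
      ring
    rw [← h3]
    ring
  simp_rw [key]
  rw [intervalIntegral.integral_sub
      ((by fun_prop : Continuous _).intervalIntegrable _ _)
      ((by fun_prop : Continuous _).intervalIntegrable _ _),
    intervalIntegral.integral_const_mul, intervalIntegral.integral_const_mul, h1, h2]
  have hpow : (-Complex.I * (L : ℂ) / ((k : ℂ) * (r : ℂ))) ^ n =
      Complex.I ^ n * (-(2 * ((L : ℂ) / 2)) / ((k * r : ℝ) : ℂ)) ^ n := by
    rw [← mul_zpow]
    congr 1
    push_cast
    ring
  rw [hpow]
  push_cast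
  ring
end
end

section
/- Let n ∈ ℤ and a, b ∈ ℂ. Then (1/(2πi))·∮_{|z|=1} z^{n−1}·exp( a·z − b/z ) dz = Σ_{m ≥ max(0,−n)} a^m·(−b)^{m+n}/(m!·(m+n)!), where the integral is over the unit circle centered at the origin traversed counterclockwise. (Equivalently, this sum equals (−b)^n·J_{|n|}(2√(ab))/(ab)^{|n|/2} for n ≥ 0 and a^{−n}·J_{|n|}(2√(ab))/(ab)^{|n|/2} for n ≤ 0, where J_ν is the Bessel function of the first kind of order ν, and the value is independent of the choice of branch of the square root.) -/
open Complex

noncomputable section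

/-- An absolutely summable Laurent series may be integrated termwise over the unit circle. -/
theorem hasSum_circleIntegral_const_mul_zpow {ι : Type*} [Countable ι] {c : ι → ℂ} {e : ι → ℤ}
    {f : ℂ → ℂ} (hc : Summable fun i => ‖c i‖)
    (hf : ∀ z : ℂ, ‖z‖ = 1 → HasSum (fun i => c i * z ^ e i) (f z)) :
    HasSum (fun i => ∮ z in C(0, 1), c i * z ^ e i) (∮ z in C(0, 1), f z) := by
  have hnorm (θ : ℝ) : ‖circleMap 0 1 θ‖ = 1 := by simp
  refine intervalIntegral.hasSum_integral_of_dominated_convergence (fun i _ => ‖c i‖)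
    (fun i => ?_) (fun i => ?_) ?_ ?_ ?_
  · refine Continuous.aestronglyMeasurable ?_
    have h : Continuous fun θ : ℝ => circleMap 0 1 θ ^ e i :=
      (continuous_circleMap 0 1).zpow₀ _ fun θ => Or.inl (circleMap_ne_center one_ne_zero)
    simp only [deriv_circleMap, smul_eq_mul]
    fun_prop
  · exact .of_forall fun θ _ => by simp
  · exact .of_forall fun θ _ => hc
  · exact intervalIntegrable_const
  · exact .of_forall fun θ _ => (hf _ (hnorm θ)).const_smul _

/-- The integral of an integer power over the unit circle. -/
theorem circleIntegral_zpow (k : ℤ) :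
    (∮ z in C(0, 1), z ^ k) = if k = -1 then 2 * (Real.pi : ℂ) * I else 0 := by
  split_ifs with hk
  · simpa [hk] using circleIntegral.integral_sub_center_inv 0 one_ne_zero
  · simpa using circleIntegral.integral_sub_zpow_of_ne hk 0 0 1

theorem hasSum_pow_div_factorial (w : ℂ) :
    HasSum (fun m : ℕ => w ^ m / (m.factorial : ℂ)) (exp w) := by
  rw [exp_eq_exp_ℂ]
  exact NormedSpace.expSeries_div_hasSum_exp w

/-- The product of two exponential series converges absolutely. -/
theorem summable_norm_pow_div_factorial_mul (v w : ℂ) :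
    Summable fun p : ℕ × ℕ =>
      ‖v ^ p.1 / (p.1.factorial : ℂ) * (w ^ p.2 / (p.2.factorial : ℂ))‖ := by
  exact Summable.mul_norm (f := fun m : ℕ => v ^ m / (m.factorial : ℂ))
    (g := fun m : ℕ => w ^ m / (m.factorial : ℂ))
    (hasSum_pow_div_factorial v).summable.norm (hasSum_pow_div_factorial w).summable.norm

/-- The Laurent expansion of `z ^ (n - 1) * exp (a * z - b / z)` away from the origin. -/
theorem hasSum_zpow_mul_exp_sub_div (n : ℤ) (a b : ℂ) {z : ℂ} (hz : z ≠ 0) :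
    HasSum (fun p : ℕ × ℕ => a ^ p.1 / (p.1.factorial : ℂ) * ((-b) ^ p.2 / (p.2.factorial : ℂ)) *
      z ^ (n - 1 + p.1 - p.2)) (z ^ (n - 1) * exp (a * z - b / z)) := by
  have hs := (hasSum_pow_div_factorial (a * z)).mul (hasSum_pow_div_factorial (-b / z))
    (summable_norm_pow_div_factorial_mul (a * z) (-b / z)).of_norm
  rw [← exp_add, show a * z + -b / z = a * z - b / z by ring] at hs
  refine (hs.mul_left (z ^ (n - 1))).congr_fun fun p => ?_
  rw [zpow_sub₀ hz, zpow_add₀ hz, zpow_natCast, zpow_natCast, mul_pow, div_pow]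
  ring

theorem stmt16 (n : ℤ) (a b : ℂ) :
    (1 / (2 * (Real.pi : ℂ) * Complex.I)) *
      (∮ z in C(0, 1), z ^ (n - 1) * Complex.exp (a * z - b / z)) =
    ∑' m : ℕ, (a ^ (m + (-n).toNat) * (-b) ^ (m + n.toNat))
      / ((Nat.factorial (m + (-n).toNat) : ℂ) * (Nat.factorial (m + n.toNat) : ℂ)) := by
  have hs := (hasSum_circleIntegral_const_mul_zpow
    (summable_norm_pow_div_factorial_mul a (-b)) fun z hz =>
    hasSum_zpow_mul_exp_sub_div n a b (norm_ne_zero_iff.1 (hz ▸ one_ne_zero))).mul_left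
      (1 / (2 * (Real.pi : ℂ) * I))
  simp only [circleIntegral.integral_const_mul, circleIntegral_zpow] at hs
  have hinj : Function.Injective fun m : ℕ => (m + (-n).toNat, m + n.toNat) := fun m m' h => by
    simpa using congrArg Prod.fst h
  rw [← hinj.hasSum_iff] at hs
  · rw [← hs.tsum_eq]
    refine tsum_congr fun m => ?_
    have hm : n - 1 + ((m + (-n).toNat : ℕ) : ℤ) - ((m + n.toNat : ℕ) : ℤ) = -1 := by omega
    simp only [Function.comp_apply, hm, if_true]
    have := two_pi_I_ne_zero
    field_simp
  · rintro ⟨k, j⟩ hkj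
    rw [if_neg, mul_zero, mul_zero]
    intro h
    refine hkj ⟨k - (-n).toNat, ?_⟩
    simp only [Prod.mk.injEq]
    omega
end
end
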